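/- For every integer t ≥ 3, the Euler genus of the complete graph K_t equals ⌈(t-3)(t-4)/6⌉. -/

import Mathlib

open SimpleGraph Set

universe u

/-- A branch-decomposition of a graph `G`: a ternary tree `T` (internal vertices of
degree 3) together with a bijection from the edges of `G` to the leaves of `T`. -/
structure BranchDecomp {V : Type u} (G : SimpleGraph V) : Type (u + 1) where
  t : Type
  fin : Fintype t
  T : SimpleGraph t
  isTree : T.IsTree
  ternary : ∀ v : t, (T.neighborSet v).ncard ≤ 1 ∨ (T.neighborSet v).ncard = 3
  τ : G.edgeSet ≃ {v : t // (T.neighborSet v).ncard ≤ 1}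

namespace BranchDecomp

variable {V : Type u} {G : SimpleGraph V} (B : BranchDecomp G)

/-- The edges of `G` whose leaves lie on the `a`-side of the tree edge `ab`. -/
def side (a b : B.t) : Set G.edgeSet :=
  {e | (B.T.deleteEdges {s(a, b)}).Reachable a (B.τ e).1}

/-- The boundary `∂(X_e)` of the bipartition of `E(G)` induced by the tree edge `ab`:
vertices incident to edges on both sides. -/
def bdry (a b : B.t) : Set V :=
  {v | (∃ e : G.edgeSet, e ∈ B.side a b ∧ v ∈ (e : Sym2 V)) ∧
       (∃ e : G.edgeSet, e ∉ B.side a b ∧ v ∈ (e : Sym2 V))}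

/-- The width of a branch-decomposition: the maximum, over edges of the tree, of the
size of the corresponding boundary. -/
noncomputable def width : ℕ :=
  sSup {n | ∃ a b : B.t, B.T.Adj a b ∧ n = (B.bdry a b).ncard}

end BranchDecomp

/-- The branchwidth of a graph: the minimum width of a branch-decomposition. -/
noncomputable def branchwidth {V : Type u} (G : SimpleGraph V) : ℕ :=
  sInf {n | ∃ B : BranchDecomp G, B.width = n}

/-- A tree-decomposition of a graph. -/
structure TreeDecomp {V : Type u} (G : SimpleGraph V) : Type (u + 1) where
  t : Type
  fin : Fintype t
  T : SimpleGraph t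
  isTree : T.IsTree
  β : t → Set V
  covers_edge : ∀ ⦃u v : V⦄, G.Adj u v → ∃ x, u ∈ β x ∧ v ∈ β x
  covers_vert : ∀ v : V, ∃ x, v ∈ β x
  subtree : ∀ v : V, (T.induce {x | v ∈ β x}).Connected

/-- The width of a tree-decomposition: maximum bag size minus one. -/
noncomputable def TreeDecomp.width {V : Type u} {G : SimpleGraph V} (D : TreeDecomp G) : ℕ :=
  sSup {n | ∃ x : D.t, n + 1 = (D.β x).ncard}

/-- The treewidth of a graph. -/
noncomputable def treewidth {V : Type u} (G : SimpleGraph V) : ℕ :=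
  sInf {n | ∃ D : TreeDecomp G, D.width = n}

/-- A minor model of `H` in `G`: disjoint connected branch sets with edges realized. -/
def IsMinorModel {V : Type u} {W : Type*} (G : SimpleGraph V) (H : SimpleGraph W)
    (φ : W → Set V) : Prop :=
  (∀ w, (G.induce (φ w)).Connected) ∧
  (Pairwise fun w₁ w₂ => Disjoint (φ w₁) (φ w₂)) ∧
  (∀ ⦃w₁ w₂ : W⦄, H.Adj w₁ w₂ → ∃ a ∈ φ w₁, ∃ b ∈ φ w₂, G.Adj a b)

/-- `G` has `H` as a minor. -/
def HasMinor {V : Type u} {W : Type*} (G : SimpleGraph V) (H : SimpleGraph W) : Prop :=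
  ∃ φ : W → Set V, IsMinorModel G H φ

/-- The `(k × k)`-grid. -/
def gridGraph (k : ℕ) : SimpleGraph (Fin k × Fin k) :=
  SimpleGraph.fromRel fun p q =>
    (p.1 = q.1 ∧ (p.2 : ℕ) + 1 = (q.2 : ℕ)) ∨ (p.2 = q.2 ∧ (p.1 : ℕ) + 1 = (q.1 : ℕ))

/-- A combinatorial closed surface presented as a flag system ("graph-encoded map"):
three fixed-point-free involutions on a finite set of flags, with `σ₀` and `σ₂`
commuting and `σ₀σ₂` fixed-point free. Vertices, edges, faces of the map are the orbits
of `⟨σ₁,σ₂⟩`, `⟨σ₀,σ₂⟩`, `⟨σ₀,σ₁⟩` respectively. -/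
structure FlagSystem : Type 1 where
  F : Type
  fin : Fintype F
  σ₀ : Equiv.Perm F
  σ₁ : Equiv.Perm F
  σ₂ : Equiv.Perm F
  inv₀ : σ₀ * σ₀ = 1
  inv₁ : σ₁ * σ₁ = 1
  inv₂ : σ₂ * σ₂ = 1
  fpf₀ : ∀ x, σ₀ x ≠ x
  fpf₁ : ∀ x, σ₁ x ≠ x
  fpf₂ : ∀ x, σ₂ x ≠ x
  comm02 : σ₀ * σ₂ = σ₂ * σ₀
  fpf02 : ∀ x, (σ₀ * σ₂) x ≠ x

namespace FlagSystem

variable (M : FlagSystem)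

/-- Two flags lie in a common orbit of the subgroup generated by a set of permutations. -/
def SameOrbit (S : Set (Equiv.Perm M.F)) (x y : M.F) : Prop :=
  ∃ g ∈ Subgroup.closure S, g x = y

/-- The number of orbits of the subgroup generated by `S` on the flags. -/
noncomputable def numOrbits (S : Set (Equiv.Perm M.F)) : ℕ :=
  Nat.card (Quotient (MulAction.orbitRel (Subgroup.closure S) M.F))

/-- Number of vertices of the map. -/
noncomputable def nV : ℕ := M.numOrbits {M.σ₁, M.σ₂}
/-- Number of edges of the map. -/
noncomputable def nE : ℕ := M.numOrbits {M.σ₀, M.σ₂}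
/-- Number of faces of the map. -/
noncomputable def nF : ℕ := M.numOrbits {M.σ₀, M.σ₁}
/-- Number of connected components of the map (= of the underlying surface). -/
noncomputable def nC : ℕ := M.numOrbits {M.σ₀, M.σ₁, M.σ₂}

/-- The flag system `M` is (the flag system of) a 2-cell embedding of the graph `G`:
there are assignments of a (non-isolated) vertex and an edge of `G` to each flag which
identify the vertex orbits with the non-isolated vertices of `G` and the edge orbits
with the edges of `G`, respecting all incidences. -/
def Realizes {V : Type u} (G : SimpleGraph V) : Prop :=
  ∃ (fv : M.F → {v : V // ∃ e ∈ G.edgeSet, v ∈ e}) (fe : M.F → G.edgeSet),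
    (∀ x, ((fv x : V) ∈ (fe x : Sym2 V))) ∧
    (∀ x, fv (M.σ₁ x) = fv x) ∧ (∀ x, fv (M.σ₂ x) = fv x) ∧
    (∀ x, fv (M.σ₀ x) ≠ fv x) ∧
    (∀ x, fe (M.σ₀ x) = fe x) ∧ (∀ x, fe (M.σ₂ x) = fe x) ∧
    (∀ x y, fv x = fv y → M.SameOrbit {M.σ₁, M.σ₂} x y) ∧
    (∀ x y, fe x = fe y → M.SameOrbit {M.σ₀, M.σ₂} x y) ∧
    Function.Surjective fv ∧
    (∀ (e : G.edgeSet) (v : V), v ∈ (e : Sym2 V) → ∃ x, fe x = e ∧ (fv x : V) = v)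

end FlagSystem

/-- The Euler genus of a graph `G`: the least `g` such that some 2-cell embedding of `G`
(given by a flag system `M` realizing `G`) satisfies the Euler formula
`g + v + f = 2·c + e`, i.e. `g = 2c - v + e - f`. -/
noncomputable def eulerGenus {V : Type u} (G : SimpleGraph V) : ℕ :=
  sInf {g | ∃ M : FlagSystem, M.Realizes G ∧ g + M.nV + M.nF = 2 * M.nC + M.nE}

namespace FlagSystem

theorem orbit_inv {M : FlagSystem} {S : Set (Equiv.Perm M.F)} {P : M.F → Prop}
    (h : ∀ σ ∈ S, ∀ x, P (σ x) ↔ P x) {x y : M.F} (hxy : M.SameOrbit S x y) : P x ↔ P y := by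
  obtain ⟨g, hg, rfl⟩ := hxy
  suffices H : ∀ g ∈ Subgroup.closure S, ∀ x, P (g x) ↔ P x from (H g hg x).symm
  intro g hg
  induction hg using Subgroup.closure_induction with
  | mem σ hσ => exact h σ hσ
  | one => intro x; rfl
  | mul a b _ _ ha hb => intro x; rw [Equiv.Perm.mul_apply, ha, hb]
  | inv a _ ha => intro x; rw [← ha (a⁻¹ x)]; simp

theorem SameOrbit.refl {M : FlagSystem} {S : Set (Equiv.Perm M.F)} (x : M.F) : M.SameOrbit S x x :=
  ⟨1, Subgroup.one_mem _, rfl⟩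

theorem SameOrbit.symm {M : FlagSystem} {S : Set (Equiv.Perm M.F)} {x y : M.F}
    (h : M.SameOrbit S x y) : M.SameOrbit S y x := by
  obtain ⟨g, hg, rfl⟩ := h
  exact ⟨g⁻¹, Subgroup.inv_mem _ hg, by simp⟩

theorem SameOrbit.trans {M : FlagSystem} {S : Set (Equiv.Perm M.F)} {x y z : M.F}
    (h : M.SameOrbit S x y) (h' : M.SameOrbit S y z) : M.SameOrbit S x z := by
  obtain ⟨g, hg, rfl⟩ := h
  obtain ⟨g', hg', rfl⟩ := h'
  exact ⟨g' * g, Subgroup.mul_mem _ hg' hg, rfl⟩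

theorem SameOrbit.mono {M : FlagSystem} {S S' : Set (Equiv.Perm M.F)} (hS : S ⊆ S') {x y : M.F}
    (h : M.SameOrbit S x y) : M.SameOrbit S' x y := by
  obtain ⟨g, hg, rfl⟩ := h
  exact ⟨g, Subgroup.closure_mono hS hg, rfl⟩

theorem SameOrbit.of_mem {M : FlagSystem} {S : Set (Equiv.Perm M.F)} {σ : Equiv.Perm M.F}
    (h : σ ∈ S) (x : M.F) : M.SameOrbit S x (σ x) :=
  ⟨σ, Subgroup.subset_closure h, rfl⟩

/-- The quotient map onto orbits. -/
def orb {M : FlagSystem} (S : Set (Equiv.Perm M.F)) (x : M.F) :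
    Quotient (MulAction.orbitRel (Subgroup.closure S) M.F) := Quotient.mk _ x

theorem orb_eq {M : FlagSystem} {S : Set (Equiv.Perm M.F)} {x y : M.F} :
    orb S x = orb S y ↔ M.SameOrbit S x y := by
  unfold orb
  rw [Quotient.eq]
  change MulAction.orbitRel _ _ x y ↔ _
  rw [MulAction.orbitRel_apply, MulAction.mem_orbit_iff]
  constructor
  · rintro ⟨g, hg⟩
    exact SameOrbit.symm ⟨g.1, g.2, hg⟩
  · intro h
    obtain ⟨g, hg, h⟩ := h.symm
    exact ⟨⟨g, hg⟩, h⟩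

theorem orb_surj {M : FlagSystem} (S : Set (Equiv.Perm M.F)) : Function.Surjective (orb S) :=
  Quotient.mk_surjective

theorem numOrbits_eq {M : FlagSystem} {S : Set (Equiv.Perm M.F)} {β : Type*} (f : M.F → β)
    (hf : Function.Surjective f) (h : ∀ σ ∈ S, ∀ x, f (σ x) = f x)
    (h' : ∀ x y, f x = f y → M.SameOrbit S x y) : M.numOrbits S = Nat.card β := by
  have key : ∀ x y, M.SameOrbit S x y → f x = f y := by
    intro x y hxy
    have := orbit_inv (P := fun z => f z = f y) (fun σ hσ x => by rw [h σ hσ x]) hxy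
    simpa using this
  unfold numOrbits
  refine Nat.card_congr (Equiv.ofBijective (Quotient.lift f ?_) ⟨?_, ?_⟩)
  · intro x y hxy
    exact key x y (orb_eq.1 (Quotient.sound hxy))
  · intro a b
    induction a using Quotient.inductionOn
    induction b using Quotient.inductionOn
    intro hab
    exact orb_eq.2 (h' _ _ hab)
  · intro b
    obtain ⟨x, rfl⟩ := hf b
    exact ⟨Quotient.mk _ x, rfl⟩

section
variable {M : FlagSystem}
theorem s0s0 (x : M.F) : M.σ₀ (M.σ₀ x) = x := by
  have := congrArg (fun g : Equiv.Perm M.F => g x) M.inv₀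
  simpa using this
theorem s1s1 (x : M.F) : M.σ₁ (M.σ₁ x) = x := by
  have := congrArg (fun g : Equiv.Perm M.F => g x) M.inv₁
  simpa using this
theorem s2s2 (x : M.F) : M.σ₂ (M.σ₂ x) = x := by
  have := congrArg (fun g : Equiv.Perm M.F => g x) M.inv₂
  simpa using this
theorem s02 (x : M.F) : M.σ₀ (M.σ₂ x) = M.σ₂ (M.σ₀ x) := by
  have := congrArg (fun g : Equiv.Perm M.F => g x) M.comm02
  simpa using this

theorem edge_orbit {x y : M.F} (h : M.SameOrbit {M.σ₀, M.σ₂} x y) :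
    y = x ∨ y = M.σ₀ x ∨ y = M.σ₂ x ∨ y = M.σ₀ (M.σ₂ x) := by
  refine (orbit_inv (P := fun z => z = x ∨ z = M.σ₀ x ∨ z = M.σ₂ x ∨ z = M.σ₀ (M.σ₂ x)) ?_ h).1
    (Or.inl rfl)
  have imp0 : ∀ z, (z = x ∨ z = M.σ₀ x ∨ z = M.σ₂ x ∨ z = M.σ₀ (M.σ₂ x)) →
    (M.σ₀ z = x ∨ M.σ₀ z = M.σ₀ x ∨ M.σ₀ z = M.σ₂ x ∨ M.σ₀ z = M.σ₀ (M.σ₂ x)) := by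
    rintro z (rfl | rfl | rfl | rfl) <;> simp [s0s0]
  have imp2 : ∀ z, (z = x ∨ z = M.σ₀ x ∨ z = M.σ₂ x ∨ z = M.σ₀ (M.σ₂ x)) →
    (M.σ₂ z = x ∨ M.σ₂ z = M.σ₀ x ∨ M.σ₂ z = M.σ₂ x ∨ M.σ₂ z = M.σ₀ (M.σ₂ x)) := by
    rintro z (rfl | rfl | rfl | rfl) <;> simp [s2s2, s02]
  intro σ hσ z
  rcases hσ with rfl | rfl
  · exact ⟨fun h => by simpa [s0s0] using imp0 _ h, imp0 z⟩
  · exact ⟨fun h => by simpa [s2s2] using imp2 _ h, imp2 z⟩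
end

/-- Lower bound for the number of faces. -/
theorem faces_lower (M : FlagSystem) (S0 : Finset M.F)
    (h0 : ∀ x ∈ S0, M.σ₀ x ∈ S0 ∧ M.σ₁ x ∈ S0)
    (hO : ∀ x ∉ S0, ∃ O : Finset M.F, x ∈ O ∧ O.card ≤ 6 ∧ ∀ y ∈ O, M.σ₀ y ∈ O ∧ M.σ₁ y ∈ O)
    (hS : S0.card ≤ 10) : Nat.card M.F ≤ 6 * M.nF + 4 := by
  classical
  haveI := M.fin
  have clos : ∀ O : Finset M.F, (∀ y ∈ O, M.σ₀ y ∈ O ∧ M.σ₁ y ∈ O) → ∀ x y,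
      M.SameOrbit {M.σ₀, M.σ₁} x y → (x ∈ O ↔ y ∈ O) := by
    intro O hO x y hxy
    refine orbit_inv (P := fun z => z ∈ O) ?_ hxy
    intro σ hσ z
    rcases hσ with rfl | rfl
    · exact ⟨fun h => by simpa [s0s0] using (hO _ h).1, fun h => (hO _ h).1⟩
    · exact ⟨fun h => by simpa [s1s1] using (hO _ h).2, fun h => (hO _ h).2⟩
  set S : Set (Equiv.Perm M.F) := {M.σ₀, M.σ₁} with hSdef
  haveI : Fintype (Quotient (MulAction.orbitRel (Subgroup.closure S) M.F)) := Fintype.ofFinite _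
  have hnF : M.nF = (Finset.univ : Finset (Quotient (MulAction.orbitRel (Subgroup.closure S) M.F))).card := by
    unfold nF numOrbits
    rw [Nat.card_eq_fintype_card, Finset.card_univ]
  have h1 : (S0ᶜ).card ≤ 6 * (Finset.univ \ S0.image (orb S)).card := by
    refine Finset.card_le_mul_card_image_of_maps_to (f := orb S) ?_ 6 ?_
    · intro x hx
      simp only [Finset.mem_coe, Finset.mem_sdiff, Finset.mem_univ, true_and, Finset.mem_image, not_exists, not_and]
      intro y hy hxy
      have := (clos S0 h0 y x (orb_eq.1 hxy)).1 hy
      simp at hx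
      exact hx this
    · intro q _
      by_cases hne : ((S0ᶜ).filter (fun x => orb S x = q)).Nonempty
      · obtain ⟨x, hx⟩ := hne
        simp only [Finset.mem_filter, Finset.mem_compl] at hx
        obtain ⟨O, hxO, hc, hcl⟩ := hO x hx.1
        refine le_trans (Finset.card_le_card ?_) hc
        intro y hy
        simp only [Finset.mem_filter, Finset.mem_compl] at hy
        exact (clos O hcl x y (orb_eq.1 (hx.2.trans hy.2.symm))).1 hxO
      · rw [Finset.not_nonempty_iff_eq_empty.1 hne]; simp
  have h2 : (Finset.univ \ S0.image (orb S)).card + (S0.image (orb S)).card = M.nF := by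
    rw [hnF]; exact Finset.card_sdiff_add_card_eq_card (Finset.subset_univ _)
  have h3 : (S0ᶜ).card + S0.card = Nat.card M.F := by
    rw [Nat.card_eq_fintype_card, ← Finset.card_compl_add_card S0]
  by_cases he : S0 = ∅
  · have e0 : S0.card = 0 := by rw [he]; rfl
    omega
  · have : 0 < (S0.image (orb S)).card :=
      Finset.card_pos.2 ((Finset.nonempty_iff_ne_empty.2 he).image _)
    omega

end FlagSystem

namespace FlagSystem

theorem counts (M : FlagSystem) (t : ℕ) (ht : 3 ≤ t) (h : M.Realizes (⊤ : SimpleGraph (Fin t))) :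
    M.nV = t ∧ 2 * M.nE = t * (t - 1) ∧ M.nC = 1 ∧ Nat.card M.F ≤ 4 * M.nE ∧
      6 * M.nF ≤ Nat.card M.F := by
  classical
  have := M.fin
  obtain ⟨fv, fe, hin, v1, v2, v0, e0, e2, hv, he, sv, se⟩ := h
  have hother : ∀ c : Fin t, ∃ d : Fin t, d ≠ c := by
    intro c
    by_contra hh
    push Not at hh
    have h1 := hh ⟨0, by omega⟩
    have h2 := hh ⟨1, by omega⟩
    rw [← h2] at h1
    simp [Fin.ext_iff] at h1
  have hother2 : ∀ c d : Fin t, ∃ e : Fin t, e ≠ c ∧ e ≠ d := by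
    intro c d
    have : ∃ e ∈ (Finset.univ : Finset (Fin t)), e ∉ ({c, d} : Finset (Fin t)) := by
      apply Finset.exists_mem_notMem_of_card_lt_card
      have := Finset.card_le_two (a := c) (b := d)
      simp; omega
    obtain ⟨e, _, he⟩ := this
    simp at he
    exact ⟨e, he⟩
  have hsurE : Function.Surjective fe := by
    intro e
    obtain ⟨a, ha⟩ : ∃ a, a ∈ (e : Sym2 (Fin t)) := ⟨_, Sym2.out_fst_mem _⟩
    obtain ⟨x, hx, _⟩ := se e a ha
    exact ⟨x, hx⟩
  have edgeq : ∀ (e : (⊤ : SimpleGraph (Fin t)).edgeSet) (a b : Fin t), a ∈ (e : Sym2 (Fin t)) →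
      b ∈ (e : Sym2 (Fin t)) → a ≠ b → (e : Sym2 (Fin t)) = s(a, b) := by
    intro e a b ha hb hab
    exact (Sym2.mem_and_mem_iff hab).1 ⟨ha, hb⟩
  have v0' : ∀ x, (fv (M.σ₀ x) : Fin t) ≠ fv x := fun x hx => v0 x (Subtype.ext hx)
  have hflag : ∀ a b : Fin t, a ≠ b → ∃ x, (fv x : Fin t) = a ∧ (fe x : Sym2 (Fin t)) = s(a, b) := by
    intro a b hab
    obtain ⟨x, hx, hx'⟩ := se ⟨s(a, b), by simpa using hab⟩ a (by simp)
    exact ⟨x, hx', by rw [hx]⟩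
  have hnV : M.nV = t := by
    unfold nV
    rw [numOrbits_eq fv sv (by rintro σ (rfl | rfl) x; exacts [v1 x, v2 x]) hv]
    have : Nat.card {v : Fin t // ∃ e ∈ (⊤ : SimpleGraph (Fin t)).edgeSet, v ∈ e} = Nat.card (Fin t) := by
      refine Nat.card_congr (Equiv.subtypeUnivEquiv ?_)
      intro a
      obtain ⟨b, hb⟩ := hother a
      exact ⟨s(a, b), by simpa using hb.symm, by simp⟩
    rw [this]; simp
  have hnE0 : M.nE = Nat.card (⊤ : SimpleGraph (Fin t)).edgeSet := by
    unfold nE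
    rw [numOrbits_eq fe hsurE (by rintro σ (rfl | rfl) x; exacts [e0 x, e2 x]) he]
  have hnE : 2 * M.nE = t * (t - 1) := by
    rw [hnE0, Nat.card_eq_fintype_card, ← SimpleGraph.edgeFinset_card,
      SimpleGraph.card_edgeFinset_top_eq_card_choose_two, Fintype.card_fin, Nat.choose_two_right]
    exact Nat.mul_div_cancel' (even_iff_two_dvd.1 (Nat.even_mul_pred_self t))
  have hnC : M.nC = 1 := by
    unfold nC
    rw [numOrbits_eq (fun _ => ()) ?_ (by intros; rfl) ?_]
    · simp
    · intro _
      obtain ⟨b, hb⟩ := hother ⟨0, by omega⟩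
      obtain ⟨x, _⟩ := hflag _ _ hb
      exact ⟨x, rfl⟩
    · intro x y _
      have s12 : ({M.σ₁, M.σ₂} : Set (Equiv.Perm M.F)) ⊆ {M.σ₀, M.σ₁, M.σ₂} := by
        intro a; simp; tauto
      by_cases hxy : fv x = fv y
      · exact (hv x y hxy).mono s12
      · have hxy' : (fv x : Fin t) ≠ fv y := fun h => hxy (Subtype.ext h)
        obtain ⟨z, hz, hz'⟩ := hflag _ _ hxy'
        refine ((hv x z (Subtype.ext hz.symm)).mono s12).trans
          (SameOrbit.trans (SameOrbit.of_mem (σ := M.σ₀) (by simp) z) ((hv _ y ?_).mono s12))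
        apply Subtype.ext
        have h1 := hin (M.σ₀ z)
        rw [e0, hz', Sym2.mem_iff] at h1
        rcases h1 with h1 | h1
        · exact absurd (h1.trans hz.symm) (v0' z)
        · exact h1
  have hF4 : Nat.card M.F ≤ 4 * M.nE := by
    rw [hnE0, Nat.card_eq_fintype_card, Nat.card_eq_fintype_card]
    rw [← Finset.card_univ, ← Finset.card_univ]
    refine Finset.card_le_mul_card_image_of_maps_to (f := fe) (fun _ _ => Finset.mem_univ _) 4 ?_
    intro e _
    obtain ⟨x, rfl⟩ := hsurE e
    refine le_trans (Finset.card_le_card (t := {x, M.σ₀ x, M.σ₂ x, M.σ₀ (M.σ₂ x)}) ?_) Finset.card_le_four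
    intro y hy
    simp only [Finset.mem_filter, Finset.mem_univ, true_and] at hy
    simpa using edge_orbit (he x y hy.symm)
  have hdeg : ∀ y, fe (M.σ₁ y) ≠ fe y := by
    intro y hy
    have h12 : M.σ₁ y = M.σ₂ y := by
      rcases edge_orbit (he _ _ hy.symm) with h | h | h | h
      · exact absurd h (M.fpf₁ y)
      · exact absurd (by rw [← h, v1]) (v0 y)
      · exact h
      · exact absurd (by rw [← h, v1, v2]) (v0 (M.σ₂ y))
    obtain ⟨c, hc⟩ := hother2 (fv y) (fv (M.σ₀ y))
    obtain ⟨z, hz, hz'⟩ := hflag (fv y) c hc.1.symm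
    have hfz : fe z ≠ fe y := by
      intro h
      have h1 := hin (M.σ₀ y)
      rw [e0, ← h, hz', Sym2.mem_iff] at h1
      rcases h1 with h1 | h1
      · exact v0' y h1
      · exact hc.2 h1.symm
    have := (orbit_inv (P := fun z => z = y ∨ z = M.σ₁ y) ?_ (hv y z (Subtype.ext hz.symm))).1 (Or.inl rfl)
    · rcases this with rfl | rfl
      · exact hfz rfl
      · exact hfz hy
    · have i1 : ∀ z, (z = y ∨ z = M.σ₁ y) → (M.σ₁ z = y ∨ M.σ₁ z = M.σ₁ y) := by
        rintro z (rfl | rfl) <;> simp [s1s1]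
      have i2 : ∀ z, (z = y ∨ z = M.σ₁ y) → (M.σ₂ z = y ∨ M.σ₂ z = M.σ₁ y) := by
        rintro z (rfl | rfl) <;> simp [s2s2, h12]
      rintro σ (rfl | rfl) z
      · exact ⟨fun h => by simpa [s1s1] using i1 _ h, i1 z⟩
      · exact ⟨fun h => by simpa [s2s2] using i2 _ h, i2 z⟩
  have hF6 : 6 * M.nF ≤ Nat.card M.F := by
    have : Fintype (Quotient (MulAction.orbitRel (Subgroup.closure {M.σ₀, M.σ₁}) M.F)) :=
      Fintype.ofFinite _
    unfold nF numOrbits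
    rw [Nat.card_eq_fintype_card, Nat.card_eq_fintype_card]
    rw [← Finset.card_univ, ← Finset.card_univ]
    refine Finset.mul_card_image_le_card_of_maps_to (f := orb {M.σ₀, M.σ₁})
      (fun _ _ => Finset.mem_univ _) 6 ?_
    intro q _
    obtain ⟨x, rfl⟩ := orb_surj _ q
    have k0 : ∀ y, M.SameOrbit {M.σ₀, M.σ₁} y (M.σ₀ y) := fun y => SameOrbit.of_mem (by simp) y
    have k1 : ∀ y, M.SameOrbit {M.σ₀, M.σ₁} y (M.σ₁ y) := fun y => SameOrbit.of_mem (by simp) y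
    have n1 : fe (M.σ₁ x) ≠ fe x := hdeg x
    have n2 : fe (M.σ₁ (M.σ₀ x)) ≠ fe x := by
      have := hdeg (M.σ₀ x); rwa [e0] at this
    have n3 : fe (M.σ₁ (M.σ₀ x)) ≠ fe (M.σ₁ x) := by
      intro h
      have h1 := hin (M.σ₁ (M.σ₀ x))
      rw [v1, h] at h1
      have h2 := hin (M.σ₁ x)
      rw [v1] at h2
      have h3 := edgeq _ _ _ h1 h2 (v0' x)
      have h4 := hin (M.σ₀ x)
      rw [e0] at h4
      have h5 := edgeq _ _ _ h4 (hin x) (v0' x)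
      exact n1 (Subtype.ext (h3.trans h5.symm))
    have hsub : ({x, M.σ₀ x, M.σ₁ x, M.σ₀ (M.σ₁ x), M.σ₁ (M.σ₀ x), M.σ₀ (M.σ₁ (M.σ₀ x))} : Finset M.F) ⊆
        Finset.univ.filter (fun y => orb {M.σ₀, M.σ₁} y = orb {M.σ₀, M.σ₁} x) := by
      intro y hy
      simp only [Finset.mem_filter, Finset.mem_univ, true_and]
      rw [orb_eq]
      simp only [Finset.mem_insert, Finset.mem_singleton] at hy
      rcases hy with rfl | rfl | rfl | rfl | rfl | rfl
      · exact SameOrbit.refl _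
      · exact (k0 x).symm
      · exact (k1 x).symm
      · exact ((k1 x).trans (k0 _)).symm
      · exact ((k0 x).trans (k1 _)).symm
      · exact (((k0 x).trans (k1 _)).trans (k0 _)).symm
    refine le_trans (le_of_eq ?_) (Finset.card_le_card hsub)
    have ne : ∀ {y z : M.F}, fe y ≠ fe z → y ≠ z := fun h h' => h (by rw [h'])
    have m := M.fpf₀
    rw [Finset.card_insert_of_notMem, Finset.card_insert_of_notMem, Finset.card_insert_of_notMem,
      Finset.card_insert_of_notMem, Finset.card_insert_of_notMem, Finset.card_singleton]
    all_goals simp only [Finset.mem_insert, Finset.mem_singleton, not_or]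
    · exact (m _).symm
    · exact ⟨ne (by rw [e0]; exact n3.symm), ne (by rw [e0, e0]; exact n3.symm)⟩
    · exact ⟨(m _).symm, ne n3.symm, ne (by rw [e0]; exact n3.symm)⟩
    · exact ⟨ne (by rw [e0]; exact n1.symm), ne (by rw [e0, e0]; exact n1.symm),
        ne (by rw [e0]; exact n2.symm), ne (by rw [e0, e0]; exact n2.symm)⟩
    · exact ⟨(m _).symm, ne n1.symm, ne (by rw [e0]; exact n1.symm),
        ne n2.symm, ne (by rw [e0]; exact n2.symm)⟩
  exact ⟨hnV, hnE, hnC, hF4, hF6⟩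

end FlagSystem

/-- The existence of a good map suffices. -/
theorem eulerGenus_of_good (t : ℕ) (ht : 3 ≤ t)
    (h : ∃ M : FlagSystem, M.Realizes (⊤ : SimpleGraph (Fin t)) ∧
      2 * (t * (t - 1)) ≤ 6 * M.nF + 4) :
    eulerGenus (⊤ : SimpleGraph (Fin t)) = ((t - 3) * (t - 4) + 5) / 6 := by
  have ari : ∀ f e : ℕ, 2 * e = t * (t - 1) → 6 * f ≤ 4 * e →
      ∀ g, g + t + f = 2 * 1 + e → ((t - 3) * (t - 4) + 5) / 6 ≤ g := by
    intro f e he hf g hg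
    rcases Nat.lt_or_ge t 4 with h4 | h4
    · obtain rfl : t = 3 := by omega
      simp
    · obtain ⟨s, rfl⟩ := Nat.exists_eq_add_of_le h4
      have e1 : 4 + s - 3 = s + 1 := by omega
      have e2 : 4 + s - 4 = s := by omega
      have e3 : 4 + s - 1 = s + 3 := by omega
      rw [e1, e2]
      rw [e3] at he
      ring_nf at he ⊢
      omega
  obtain ⟨M, hM, hf⟩ := h
  obtain ⟨c1, c2, c3, c4, c5⟩ := M.counts t ht hM
  unfold eulerGenus
  apply le_antisymm
  · apply Nat.sInf_le
    refine ⟨M, hM, ?_⟩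
    rw [c1, c3]
    rcases Nat.lt_or_ge t 4 with h4 | h4
    · obtain rfl : t = 3 := by omega
      simp at *
      omega
    · obtain ⟨s, rfl⟩ := Nat.exists_eq_add_of_le h4
      have e1 : 4 + s - 3 = s + 1 := by omega
      have e2 : 4 + s - 4 = s := by omega
      have e3 : 4 + s - 1 = s + 3 := by omega
      rw [e1, e2]
      rw [e3] at c2 hf
      ring_nf at c2 hf ⊢
      omega
  · refine le_csInf ⟨M.nE + 2 - t - M.nF + 0, ?_⟩ ?_
    · refine ⟨M, hM, ?_⟩
      rw [c1, c3]
      have : t + M.nF ≤ M.nE + 2 := by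
        have h1 : 6 * M.nF ≤ 4 * M.nE := by omega
        rcases Nat.lt_or_ge t 4 with h4 | h4
        · obtain rfl : t = 3 := by omega
          simp at *
          omega
        · obtain ⟨s, rfl⟩ := Nat.exists_eq_add_of_le h4
          have e3 : 4 + s - 1 = s + 3 := by omega
          rw [e3] at c2
          ring_nf at c2
          have : s ^ 2 ≥ 0 := Nat.zero_le _
          have : s ^ 2 + 1 ≥ 2 * s := by
            have : (s:ℤ)^2 + 1 ≥ 2 * s := by nlinarith [sq_nonneg ((s:ℤ) - 1)]
            exact_mod_cast this
          omega
      omega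
    · rintro g ⟨M', hM', hg⟩
      obtain ⟨d1, d2, d3, d4, d5⟩ := M'.counts t ht hM'
      rw [d1, d3] at hg
      exact ari _ _ d2 (by omega) g hg

/-- Building a map of the complete graph from corners and a face-tracing function. -/
theorem good_of_corners (V : Type) [Fintype V] [DecidableEq V] (t : ℕ) (ht : 3 ≤ t)
    (hcard : Fintype.card V = t) (C : V → V → V → Prop) (z : V → V → V → V)
    (csymm : ∀ v u w, C v u w → C v w u)
    (cne : ∀ v u w, C v u w → u ≠ v ∧ u ≠ w)
    (ctwo : ∀ v u, u ≠ v → ∃ w w', w ≠ w' ∧ C v u w ∧ C v u w' ∧ ∀ y, C v u y → y = w ∨ y = w')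
    (cconn : ∀ v u u', u ≠ v → u' ≠ v → Relation.ReflTransGen (C v) u u')
    (zC : ∀ v u w, C v u w → C u v (z v u w) ∧ z u v (z v u w) = w)
    (S0 : Finset (V × V × V)) (hS0 : S0.card ≤ 10)
    (hcl : ∀ v u w, C v u w → (v, u, w) ∈ S0 → (v, w, u) ∈ S0 ∧ (u, v, z v u w) ∈ S0)
    (hO : ∀ v u w, C v u w → (v, u, w) ∉ S0 → ∃ O : Finset (V × V × V), (v, u, w) ∈ O ∧
      O.card ≤ 6 ∧ ∀ v u w, C v u w → (v, u, w) ∈ O → (v, w, u) ∈ O ∧ (u, v, z v u w) ∈ O) :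
    ∃ M : FlagSystem, M.Realizes (⊤ : SimpleGraph (Fin t)) ∧
      2 * (t * (t - 1)) ≤ 6 * M.nF + 4 := by
  classical
  have hoth : ∀ v u w, C v u w → ∃ w', w' ≠ w ∧ C v u w' ∧ ∀ y, C v u y → y = w ∨ y = w' := by
    intro v u w h
    obtain ⟨a, b, hab, ha, hb, hy⟩ := ctwo v u (cne _ _ _ h).1
    rcases hy w h with rfl | rfl
    · exact ⟨b, hab.symm, hb, hy⟩
    · exact ⟨a, hab, ha, fun y h => (hy y h).symm⟩
  choose! oth o1 o2 o3 using hoth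
  let F := {p : V × V × V // C p.1 p.2.1 p.2.2}
  let f0 : F → F := fun p => ⟨(p.1.2.1, p.1.1, z p.1.1 p.1.2.1 p.1.2.2), (zC _ _ _ p.2).1⟩
  let f1 : F → F := fun p => ⟨(p.1.1, p.1.2.2, p.1.2.1), csymm _ _ _ p.2⟩
  let f2 : F → F := fun p => ⟨(p.1.1, p.1.2.1, oth p.1.1 p.1.2.1 p.1.2.2), o2 _ _ _ p.2⟩
  have ext3 : ∀ p q : F, p.1.1 = q.1.1 → p.1.2.1 = q.1.2.1 → p.1.2.2 = q.1.2.2 → p = q := by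
    intro p q h1 h2 h3
    exact Subtype.ext (Prod.ext h1 (Prod.ext h2 h3))
  have i0 : Function.Involutive f0 := fun p => ext3 _ _ rfl rfl (zC _ _ _ p.2).2
  have i1 : Function.Involutive f1 := fun p => ext3 _ _ rfl rfl rfl
  have i2 : Function.Involutive f2 := by
    intro p
    refine ext3 _ _ rfl rfl ?_
    have h := o2 _ _ _ p.2
    rcases o3 _ _ _ p.2 _ (o2 _ _ _ h) with h' | h'
    · exact h'
    · exact absurd h' (o1 _ _ _ h)
  have c02 : ∀ p, f0 (f2 p) = f2 (f0 p) := by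
    intro p
    refine ext3 _ _ rfl rfl ?_
    have h := o2 _ _ _ p.2
    have h1 := zC _ _ _ p.2
    have h2 := zC _ _ _ h
    rcases o3 _ _ _ h1.1 _ h2.1 with h' | h'
    · exfalso
      have := h2.2
      rw [h', h1.2] at this
      exact o1 _ _ _ p.2 this.symm
    · exact h'
  let M : FlagSystem :=
    { F := F
      fin := Fintype.ofFinite _
      σ₀ := i0.toPerm
      σ₁ := i1.toPerm
      σ₂ := i2.toPerm
      inv₀ := Equiv.ext i0
      inv₁ := Equiv.ext i1
      inv₂ := Equiv.ext i2
      fpf₀ := fun p h => (cne _ _ _ p.2).1 (congrArg (fun q : F => q.1.1) h)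
      fpf₁ := fun p h => (cne _ _ _ p.2).2 (congrArg (fun q : F => q.1.2.2) h)
      fpf₂ := fun p h => o1 _ _ _ p.2 (congrArg (fun q : F => q.1.2.2) h)
      comm02 := Equiv.ext c02
      fpf02 := fun p h => (cne _ _ _ p.2).1 (congrArg (fun q : F => q.1.1) h) }
  have hM0 : ∀ p : F, M.σ₀ p = f0 p := fun _ => rfl
  have hM1 : ∀ p : F, M.σ₁ p = f1 p := fun _ => rfl
  have hM2 : ∀ p : F, M.σ₂ p = f2 p := fun _ => rfl
  refine ⟨M, ?_, ?_⟩
  · let e : V ≃ Fin t := Fintype.equivFinOfCardEq hcard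
    have ene : ∀ p : F, e p.1.1 ≠ e p.1.2.1 := fun p h => (cne _ _ _ p.2).1 (e.injective h).symm
    let fe : F → (⊤ : SimpleGraph (Fin t)).edgeSet := fun p =>
      ⟨s(e p.1.1, e p.1.2.1), by simpa using (cne _ _ _ p.2).1.symm⟩
    let fv : F → {v : Fin t // ∃ e ∈ (⊤ : SimpleGraph (Fin t)).edgeSet, v ∈ e} := fun p =>
      ⟨e p.1.1, (fe p).1, (fe p).2, by simp [fe]⟩
    have same2 : ∀ (S : Set (Equiv.Perm F)), i2.toPerm ∈ S → ∀ p q : F, p.1.1 = q.1.1 →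
        p.1.2.1 = q.1.2.1 → M.SameOrbit S p q := by
      rintro S hS ⟨⟨v, u, w⟩, hp⟩ ⟨⟨v', u', w'⟩, hq⟩ h1 h2
      simp only at h1 h2
      subst h1 h2
      rcases o3 _ _ _ hp _ hq with h | h
      · obtain rfl : w' = w := h
        exact FlagSystem.SameOrbit.refl _
      · have : (⟨⟨v, u, w'⟩, hq⟩ : F) = M.σ₂ ⟨⟨v, u, w⟩, hp⟩ := ext3 _ _ rfl rfl h
        rw [this]
        exact FlagSystem.SameOrbit.of_mem hS _
    refine ⟨fv, fe, ?_, ?_, ?_, ?_, ?_, ?_, ?_, ?_, ?_, ?_⟩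
    · intro p; simp [fv, fe]
    · intro p; rfl
    · intro p; rfl
    · intro p h
      have := congrArg Subtype.val h
      exact (cne _ _ _ p.2).1 (e.injective this)
    · intro p
      exact Subtype.ext Sym2.eq_swap
    · intro p; rfl
    · intro p q hpq
      have hpq : p.1.1 = q.1.1 := e.injective (congrArg Subtype.val hpq)
      have key : ∀ u', Relation.ReflTransGen (C p.1.1) p.1.2.1 u' → ∀ q : F, p.1.1 = q.1.1 →
          q.1.2.1 = u' → M.SameOrbit {M.σ₁, M.σ₂} p q := by
        intro u' hu
        induction hu with
        | refl =>
          intro q h1 h2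
          exact same2 _ (Or.inr rfl) _ _ h1 h2.symm
        | @tail b c hb hc ih =>
          intro q h1 h2
          have := ih ⟨(p.1.1, b, c), hc⟩ rfl rfl
          refine this.trans ((FlagSystem.SameOrbit.of_mem (σ := M.σ₁) (Or.inl rfl) _).trans ?_)
          exact same2 _ (Or.inr rfl) _ _ h1 h2.symm
      exact key _ (cconn _ _ _ (cne _ _ _ p.2).1 (by rw [hpq]; exact (cne _ _ _ q.2).1)) q hpq rfl
    · intro p q hpq
      have h := congrArg Subtype.val hpq
      simp only [fe, Sym2.eq_iff] at h
      rcases h with ⟨h1, h2⟩ | ⟨h1, h2⟩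
      · exact same2 _ (Or.inr rfl) _ _ (e.injective h1) (e.injective h2)
      · refine (FlagSystem.SameOrbit.of_mem (σ := M.σ₀) (Or.inl rfl) _).trans ?_
        exact same2 _ (Or.inr rfl) _ _ (e.injective h2) (e.injective h1)
    · rintro ⟨v, s, hs, hv⟩
      obtain ⟨v, rfl⟩ := e.surjective v
      obtain ⟨d, hd⟩ : ∃ d : V, d ≠ v := by
        have : Nontrivial V := Fintype.one_lt_card_iff_nontrivial.1 (by omega)
        exact exists_ne v
      obtain ⟨w, _, _, hw, _⟩ := ctwo v d hd
      exact ⟨⟨(v, d, w), hw⟩, rfl⟩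
    · rintro ⟨s, hs⟩ v hv
      obtain ⟨u, rfl⟩ := Sym2.mem_iff_exists.1 hv
      obtain ⟨v, rfl⟩ := e.surjective v
      obtain ⟨u, rfl⟩ := e.surjective u
      have hne : u ≠ v := by
        rintro rfl
        simp at hs
      obtain ⟨w, _, _, hw, _⟩ := ctwo v u hne
      exact ⟨⟨(v, u, w), hw⟩, rfl, rfl⟩
  · have hFin : Fintype F := Fintype.ofFinite _
    have h1 : 2 * (t * (t - 1)) ≤ Nat.card M.F := by
      change _ ≤ Nat.card F
      rw [Nat.card_eq_fintype_card, ← Finset.card_univ]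
      have h2 : (Finset.univ : Finset V).offDiag.card = t * (t - 1) := by
        rw [Finset.offDiag_card, Finset.card_univ, hcard, Nat.mul_sub, mul_one]
      rw [← h2]
      refine Finset.mul_card_image_le_card_of_maps_to (f := fun p : F => (p.1.1, p.1.2.1)) ?_ 2 ?_
      · intro p _
        simpa using (cne _ _ _ p.2).1.symm
      · rintro ⟨v, u⟩ hvu
        simp only [Finset.mem_offDiag, Finset.mem_univ, true_and] at hvu
        obtain ⟨w, w', hne, hw, hw', _⟩ := ctwo v u hvu.symm
        have : ({⟨(v, u, w), hw⟩, ⟨(v, u, w'), hw'⟩} : Finset F).card = 2 := by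
          rw [Finset.card_pair]
          intro h
          exact hne (congrArg (fun q : F => q.1.2.2) h)
        rw [← this]
        apply Finset.card_le_card
        intro p hp
        simp only [Finset.mem_insert, Finset.mem_singleton] at hp
        rcases hp with rfl | rfl <;> simp
    refine h1.trans ?_
    refine M.faces_lower (Finset.univ.filter (fun p : F => p.1 ∈ S0)) ?_ ?_ ?_
    · rintro ⟨⟨v, u, w⟩, hp⟩ h
      simp only [Finset.mem_filter, Finset.mem_univ, true_and] at h
      have := hcl v u w hp h
      rw [hM0, hM1]
      simp only [Finset.mem_filter, Finset.mem_univ, true_and]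
      exact ⟨this.2, this.1⟩
    · rintro ⟨⟨v, u, w⟩, hp⟩ h
      simp only [Finset.mem_filter, Finset.mem_univ, true_and] at h
      obtain ⟨O, h1, h2, h3⟩ := hO v u w hp h
      refine ⟨Finset.univ.filter (fun p : F => p.1 ∈ O), ?_, ?_, ?_⟩
      · simpa using h1
      · refine le_trans (Finset.card_le_card_of_injOn (fun p : F => p.1) ?_ ?_) h2
        · intro p hp; simpa using hp
        · intro p _ q _ h; exact Subtype.ext h
      · rintro ⟨⟨v, u, w⟩, hp⟩ h
        simp only [Finset.mem_filter, Finset.mem_univ, true_and] at h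
        have := h3 v u w hp h
        rw [hM0, hM1]
        simp only [Finset.mem_filter, Finset.mem_univ, true_and]
        exact ⟨this.2, this.1⟩
    · refine le_trans (Finset.card_le_card_of_injOn (fun p : F => p.1) ?_ ?_) hS0
      · intro p hp; simpa using hp
      · intro p _ q _ h; exact Subtype.ext h

/-- `Arc R a b n S`: there is an `R`-path with `n` nodes from `a` to `b` covering `S`. -/
def Arc {V : Type*} (R : V → V → Prop) (a b : V) (n : ℕ) (S : Set V) : Prop :=
  ∃ l : List V, l.IsChain R ∧ l.head? = some a ∧ l.getLast? = some b ∧ l.length = n ∧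
    ∀ s ∈ S, s ∈ l

namespace Arc
variable {V : Type*} {R : V → V → Prop} {a b c d : V} {n n' : ℕ} {S S' : Set V}

theorem single (a : V) : Arc R a a 1 {a} := ⟨[a], by simp, rfl, rfl, rfl, by simp⟩

theorem app (h : Arc R a b n S) (hbc : R b c) (h' : Arc R c d n' S') :
    Arc R a d (n + n') (S ∪ S') := by
  obtain ⟨l, h1, h2, h3, h4, h5⟩ := h
  obtain ⟨l', k1, k2, k3, k4, k5⟩ := h'
  refine ⟨l ++ l', ?_, ?_, ?_, by simp [h4, k4], ?_⟩
  · rw [List.isChain_append]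
    refine ⟨h1, k1, ?_⟩
    intro x hx y hy
    rw [h3] at hx; rw [k2] at hy
    simp at hx hy
    subst hx hy
    exact hbc
  · rw [List.head?_append, h2]; rfl
  · rw [List.getLast?_append, k3]; rfl
  · rintro s (hs | hs)
    · exact List.mem_append_left _ (h5 s hs)
    · exact List.mem_append_right _ (k5 s hs)

theorem rev (hR : ∀ x y, R x y → R y x) (h : Arc R a b n S) : Arc R b a n S := by
  obtain ⟨l, h1, h2, h3, h4, h5⟩ := h
  refine ⟨l.reverse, ?_, by simpa using h3, by simpa using h2, by simpa using h4, by simpa using h5⟩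
  rw [List.isChain_reverse]
  exact h1.imp (fun x y => hR x y)

theorem mono (h : Arc R a b n S) (hS : S' ⊆ S) : Arc R a b n S' := by
  obtain ⟨l, h1, h2, h3, h4, h5⟩ := h
  exact ⟨l, h1, h2, h3, h4, fun s hs => h5 s (hS hs)⟩

theorem range (f : ℕ → V) (n : ℕ) (h : ∀ i < n, R (f i) (f (i + 1))) :
    Arc R (f 0) (f n) (n + 1) {u | ∃ i ≤ n, u = f i} := by
  refine ⟨(List.range (n + 1)).map f, ?_, ?_, ?_, by simp, ?_⟩
  · rw [List.isChain_map, List.isChain_range_succ]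
    exact h
  · simp [List.range_succ_eq_map]
  · simp [List.range_succ]
  · rintro u ⟨i, hi, rfl⟩
    exact List.mem_map.2 ⟨i, by simp; omega, rfl⟩

end Arc

/-- Cyclic chains. -/
def Cyc {V : Type*} (R : V → V → Prop) (l : List V) : Prop :=
  l.IsChain R ∧ ∀ b ∈ l.getLast?, ∀ a ∈ l.head?, R b a

theorem Cyc.rot {V : Type*} {R : V → V → Prop} {s t : List V} (h : Cyc R (s ++ t)) :
    Cyc R (t ++ s) := by
  obtain ⟨h1, h2⟩ := h
  rw [List.isChain_append] at h1
  cases s with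
  | nil => simpa [Cyc] using ⟨h1.2.1, by simpa using h2⟩
  | cons a s =>
    cases t with
    | nil => simp at h2; exact ⟨by simpa using h1.1, by simpa using h2⟩
    | cons b t =>
      refine ⟨?_, ?_⟩
      · rw [List.isChain_append]
        refine ⟨h1.2.1, h1.1, ?_⟩
        intro x hx y hy
        refine h2 x ?_ y ?_
        · rw [List.getLast?_append]; rw [hx]; rfl
        · simpa using hy
      · intro x hx y hy
        refine h1.2.2 x ?_ y ?_
        · rw [List.getLast?_append] at hx
          rw [List.getLast?_eq_some_getLast (by simp : a :: s ≠ [])] at hx ⊢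
          simpa using hx
        · simpa using hy

theorem Cyc.rotate_mem {V : Type*} {R : V → V → Prop} {l : List V} (h : Cyc R l) (hn : l.Nodup)
    {u : V} (hu : u ∈ l) : ∃ t, Cyc R (u :: t) ∧ (u :: t).Nodup ∧ (u :: t).Perm l := by
  obtain ⟨s, t, rfl⟩ := List.append_of_mem hu
  refine ⟨t ++ s, ?_, ?_, ?_⟩
  · exact h.rot
  · exact (List.perm_append_comm (l₁ := s) (l₂ := u :: t)).nodup_iff.1 hn
  · exact (List.perm_append_comm (l₁ := s) (l₂ := u :: t)).symm

/-- A triangulated closed surface with vertex set `V`, adjacency `A` and triangles `T`. -/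
structure IsTriang {V : Type*} (A : V → V → Prop) (T : V → V → V → Prop) : Prop where
  s12 : ∀ u v w, T u v w → T v u w
  s23 : ∀ u v w, T u v w → T u w v
  adj : ∀ u v w, T u v w → A u v
  two : ∀ v u, A v u → ∃ w w', w ≠ w' ∧ T v u w ∧ T v u w' ∧ ∀ y, T v u y → y = w ∨ y = w'
  link : ∀ v, ∃ l : List V, l.Nodup ∧ Cyc (T v) l ∧ ∀ u, u ∈ l ↔ A v u

/-- permutation closure of a triple -/
def PermOf {V : Type*} (p : V × V × V) (u v w : V) : Prop :=
  p = (u, v, w) ∨ p = (u, w, v) ∨ p = (v, u, w) ∨ p = (v, w, u) ∨ p = (w, u, v) ∨ p = (w, v, u)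

/-- triangles listed by a family -/
def TriOf {V ι : Type*} (tri : ι → V × V × V) (u v w : V) : Prop := ∃ i, PermOf (tri i) u v w

theorem TriOf.s12 {V ι : Type*} {tri : ι → V × V × V} {u v w : V} (h : TriOf tri u v w) :
    TriOf tri v u w := by
  obtain ⟨i, h⟩ := h
  exact ⟨i, by unfold PermOf at *; tauto⟩

theorem TriOf.s23 {V ι : Type*} {tri : ι → V × V × V} {u v w : V} (h : TriOf tri u v w) :
    TriOf tri u w v := by
  obtain ⟨i, h⟩ := h
  exact ⟨i, by unfold PermOf at *; tauto⟩

theorem TriOf.mk {V ι : Type*} {tri : ι → V × V × V} {u v w : V} (i : ι) (h : tri i = (u, v, w)) :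
    TriOf tri u v w := ⟨i, Or.inl h⟩

open Classical in
theorem isTriang_of_count {V ι : Type*} [Fintype V] [Fintype ι] (A : V → V → Prop)
    (tri : ι → V × V × V)
    (hcount : 6 * Fintype.card ι ≤ 2 * (Finset.univ.filter (fun p : V × V => A p.1 p.2)).card)
    (hdeg : ∀ v, 3 ≤ (Finset.univ.filter (A v)).card)
    (hlink : ∀ v, ∃ a b n S, Arc (TriOf tri v) a b n S ∧ TriOf tri v b a ∧
      n ≤ (Finset.univ.filter (A v)).card ∧ ∀ u, A v u → u ∈ S) :
    IsTriang A (TriOf tri) := by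
  have link : ∀ v, ∃ l : List V, l.Nodup ∧ Cyc (TriOf tri v) l ∧ ∀ u, u ∈ l ↔ A v u := by
    intro v
    obtain ⟨a, b, n, S, ⟨l, h1, h2, h3, h4, h5⟩, hba, hn, hS⟩ := hlink v
    have hsub : Finset.univ.filter (A v) ⊆ l.toFinset := by
      intro u hu
      simp only [Finset.mem_filter, Finset.mem_univ, true_and] at hu
      simpa using h5 u (hS u hu)
    have hle := l.toFinset_card_le
    have heq := Finset.eq_of_subset_of_card_le hsub (by omega)
    have hc := Finset.card_le_card hsub
    refine ⟨l, ?_, ⟨h1, ?_⟩, ?_⟩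
    · rw [← Multiset.coe_nodup, ← Multiset.dedup_card_eq_card_iff_nodup]
      have : (Multiset.dedup (l : Multiset V)).card = l.toFinset.card := by
        simp [List.toFinset, Finset.card, Multiset.toFinset]
      rw [this]; simp; omega
    · intro x hx y hy
      rw [h3] at hx; rw [h2] at hy
      simp at hx hy
      subst hx hy
      exact hba
    · intro u
      rw [← List.mem_toFinset, ← heq]; simp
  have two : ∀ v u, A v u → ∃ w w', w ≠ w' ∧ TriOf tri v u w ∧ TriOf tri v u w' := by
    intro v u hvu
    obtain ⟨l, hl, hc, hm⟩ := link v
    obtain ⟨t, ht, hn, hp⟩ := hc.rotate_mem hl ((hm u).2 hvu)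
    have hlen : 3 ≤ l.length := by
      refine (hdeg v).trans ?_
      refine le_trans (Finset.card_le_card ?_) l.toFinset_card_le
      intro x hx
      simp at hx ⊢
      exact (hm x).2 hx
    rw [← hp.length_eq] at hlen
    match t, ht, hn, hlen with
    | w :: w' :: t', ht, hn, _ =>
      obtain ⟨h1, h2⟩ := ht
      refine ⟨w, (w' :: t').getLast (by simp), ?_, ?_, ?_⟩
      · intro h
        have : w ∈ w' :: t' := by
          have h9 : (w' :: t').getLast (by simp) ∈ w' :: t' := List.getLast_mem _
          rwa [← h] at h9
        simp only [List.nodup_cons] at hn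
        exact hn.2.1 this
      · simp only [List.isChain_cons_cons] at h1
        exact h1.1
      · refine (h2 ((w' :: t').getLast (by simp)) ?_ u rfl).s23
        rw [List.getLast?_cons_cons, List.getLast?_cons_cons, List.getLast?_eq_some_getLast (by simp)]
        rfl
  set TT : Finset (V × V × V) := Finset.univ.filter (fun p => TriOf tri p.1 p.2.1 p.2.2) with hTT
  have hTTcard : TT.card ≤ 6 * Fintype.card ι := by
    have : TT ⊆ (Finset.univ : Finset ι).biUnion (fun i => {((tri i).1, (tri i).2.1, (tri i).2.2),
        ((tri i).1, (tri i).2.2, (tri i).2.1), ((tri i).2.1, (tri i).1, (tri i).2.2),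
        ((tri i).2.1, (tri i).2.2, (tri i).1), ((tri i).2.2, (tri i).1, (tri i).2.1),
        ((tri i).2.2, (tri i).2.1, (tri i).1)}) := by
      rintro ⟨u, v, w⟩ hp
      simp only [hTT, Finset.mem_filter, Finset.mem_univ, true_and] at hp
      obtain ⟨i, hi⟩ := hp
      refine Finset.mem_biUnion.2 ⟨i, Finset.mem_univ _, ?_⟩
      rcases hi with hi | hi | hi | hi | hi | hi <;> rw [hi] <;> simp
    refine (Finset.card_le_card this).trans ?_
    rw [mul_comm, ← Finset.card_univ]
    exact Finset.card_biUnion_le_card_mul _ _ _ (fun i _ => Finset.card_le_six)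
  have hfib : TT.card = ∑ q : V × V, (TT.filter (fun p => (p.1, p.2.1) = q)).card :=
    Finset.card_eq_sum_card_fiberwise (fun _ _ => Finset.mem_univ _)
  have hge : ∀ q : V × V, (if A q.1 q.2 then 2 else 0) ≤ (TT.filter (fun p => (p.1, p.2.1) = q)).card := by
    rintro ⟨v, u⟩
    split_ifs with h
    · obtain ⟨w, w', hne, hw, hw'⟩ := two v u h
      have h2 : ({(v, u, w), (v, u, w')} : Finset (V × V × V)).card = 2 := by
        rw [Finset.card_pair]; simpa using hne
      rw [← h2]
      apply Finset.card_le_card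
      intro p hp
      simp only [Finset.mem_insert, Finset.mem_singleton] at hp
      rcases hp with rfl | rfl <;> simp [hTT, hw, hw']
    · exact Nat.zero_le _
  have hsum : ∑ q : V × V, (if A q.1 q.2 then 2 else 0) =
      2 * (Finset.univ.filter (fun p : V × V => A p.1 p.2)).card := by
    rw [← Finset.sum_filter, Finset.sum_const, smul_eq_mul, mul_comm]
  have hall : ∀ q : V × V, (if A q.1 q.2 then 2 else 0) = (TT.filter (fun p => (p.1, p.2.1) = q)).card := by
    have := (Finset.sum_eq_sum_iff_of_le (s := Finset.univ) (fun q _ => hge q)).1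
      (le_antisymm (Finset.sum_le_sum (fun q _ => hge q)) (by rw [hsum, ← hfib]; omega))
    exact fun q => this q (Finset.mem_univ _)
  refine ⟨fun _ _ _ h => h.s12, fun _ _ _ h => h.s23, ?_, ?_, link⟩
  · intro u v w h
    by_contra hA
    have := hall (u, v)
    rw [if_neg hA] at this
    have h0 := Finset.card_eq_zero.1 this.symm
    have : (u, v, w) ∈ TT.filter (fun p => (p.1, p.2.1) = (u, v)) := by simp [hTT, h]
    rw [h0] at this
    simp at this
  · intro v u h
    obtain ⟨w, w', hne, hw, hw'⟩ := two v u h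
    refine ⟨w, w', hne, hw, hw', ?_⟩
    intro y hy
    by_contra hcon
    push Not at hcon
    have := hall (v, u)
    rw [if_pos h] at this
    have h3 : ({(v, u, w), (v, u, w'), (v, u, y)} : Finset (V × V × V)).card = 3 := by
      rw [Finset.card_eq_three]
      exact ⟨_, _, _, by simpa using hne, by simpa using hcon.1.symm, by simpa using hcon.2.symm, rfl⟩
    have h4 : ({(v, u, w), (v, u, w'), (v, u, y)} : Finset (V × V × V)) ⊆
        TT.filter (fun p => (p.1, p.2.1) = (v, u)) := by
      intro p hp
      simp only [Finset.mem_insert, Finset.mem_singleton] at hp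
      rcases hp with rfl | rfl | rfl <;> simp [hTT, hw, hw', hy]
    have := Finset.card_le_card h4
    omega

theorem chain_reach {V : Type*} {R : V → V → Prop} : ∀ (l : List V) (u : V),
    (u :: l).IsChain R → ∀ x ∈ u :: l, Relation.ReflTransGen R u x := by
  intro l
  induction l with
  | nil =>
    intro u _ x hx
    simp at hx
    rw [hx]
  | cons b l ih =>
    intro u h x hx
    rw [List.isChain_cons_cons] at h
    rcases List.mem_cons.1 hx with rfl | hx
    · exact .refl
    · exact .head h.1 (ih b h.2 x hx)

theorem IsTriang.conn {V : Type*} {A : V → V → Prop} {T : V → V → V → Prop} (h : IsTriang A T)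
    {v u u' : V} (hu : A v u) (hu' : A v u') : Relation.ReflTransGen (T v) u u' := by
  obtain ⟨l, hl, hc, hm⟩ := h.link v
  obtain ⟨t, ht, hn, hp⟩ := hc.rotate_mem hl ((hm u).2 hu)
  exact chain_reach t u ht.1 u' (hp.mem_iff.2 ((hm u').2 hu'))

theorem good_of_triang (V : Type) [Fintype V] (t : ℕ) (ht : 3 ≤ t)
    (hcard : Fintype.card V = t) (T : V → V → V → Prop) (h : IsTriang (fun u v => u ≠ v) T) :
    ∃ M : FlagSystem, M.Realizes (⊤ : SimpleGraph (Fin t)) ∧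
      2 * (t * (t - 1)) ≤ 6 * M.nF + 4 := by
  classical
  refine good_of_corners V t ht hcard T (fun _ _ w => w) (h.s23) ?_ ?_ ?_ ?_ ∅ (by simp) (by simp) ?_
  · intro v u w hT
    exact ⟨(h.adj _ _ _ hT).symm, h.adj _ _ _ (h.s23 _ _ _ (h.s12 _ _ _ hT))⟩
  · intro v u hvu
    exact h.two v u hvu.symm
  · intro v u u' hu hu'
    exact h.conn hu.symm hu'.symm
  · intro v u w hT
    exact ⟨h.s12 _ _ _ hT, rfl⟩
  · intro v u w hT _
    refine ⟨{(v, u, w), (v, w, u), (u, v, w), (u, w, v), (w, u, v), (w, v, u)}, by simp,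
      Finset.card_le_six, ?_⟩
    intro v' u' w' _ hm
    simp only [Finset.mem_insert, Finset.mem_singleton, Prod.mk.injEq] at hm ⊢
    rcases hm with ⟨rfl, rfl, rfl⟩ | ⟨rfl, rfl, rfl⟩ | ⟨rfl, rfl, rfl⟩ | ⟨rfl, rfl, rfl⟩ |
      ⟨rfl, rfl, rfl⟩ | ⟨rfl, rfl, rfl⟩ <;> simp

section AddEdge
variable {V : Type}

/-- adjacency of the complete graph minus an edge -/
def KMinus (a b : V) (u v : V) : Prop := u ≠ v ∧ ¬ (u = a ∧ v = b) ∧ ¬ (u = b ∧ v = a)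

/-- the ten flags of the pentagon -/
def PenFlag (a b y c d : V) (v u w : V) : Prop :=
  (v = a ∧ u = c ∧ w = b) ∨ (v = a ∧ u = b ∧ w = c) ∨
  (v = c ∧ u = a ∧ w = y) ∨ (v = c ∧ u = y ∧ w = a) ∨
  (v = y ∧ u = c ∧ w = d) ∨ (v = y ∧ u = d ∧ w = c) ∨
  (v = d ∧ u = y ∧ w = b) ∨ (v = d ∧ u = b ∧ w = y) ∨
  (v = b ∧ u = d ∧ w = a) ∨ (v = b ∧ u = a ∧ w = d)

/-- membership of the triple in a set of three -/
def Per (a b c : V) (v u w : V) : Prop :=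
  (v = a ∧ u = b ∧ w = c) ∨ (v = a ∧ u = c ∧ w = b) ∨ (v = b ∧ u = a ∧ w = c) ∨
  (v = b ∧ u = c ∧ w = a) ∨ (v = c ∧ u = a ∧ w = b) ∨ (v = c ∧ u = b ∧ w = a)

theorem Per.s12 {a b c v u w : V} (h : Per a b c v u w) : Per a b c u v w := by
  unfold Per at *; tauto

theorem Per.s23 {a b c v u w : V} (h : Per a b c v u w) : Per a b c v w u := by
  unfold Per at *; tauto

theorem chain_last {R : V → V → Prop} : ∀ (l : List V) (u b : V),
    (u :: l).IsChain R → (u :: l).getLast? = some b → ∀ x ∈ u :: l, Relation.ReflTransGen R x b := by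
  intro l
  induction l with
  | nil =>
    intro u b _ hb x hx
    simp at hx hb
    rw [hx, hb]
  | cons c l ih =>
    intro u b h hb x hx
    rw [List.isChain_cons_cons] at h
    rw [List.getLast?_cons_cons] at hb
    rcases List.mem_cons.1 hx with rfl | hx
    · exact .head h.1 (ih c b h.2 hb c (by simp))
    · exact ih c b h.2 hb x hx

/-- triangular flags after the addition -/
def TriFlag (T : V → V → V → Prop) (a b y c d : V) (v u w : V) : Prop :=
  (T v u w ∧ ¬ Per a y c v u w ∧ ¬ Per b y d v u w) ∨ Per a y b v u w

open Classical in
/-- face tracing after the addition -/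
noncomputable def penz (a b y c d : V) (v u w : V) : V :=
  if v = a ∧ u = c ∧ w = b then y else
  if v = a ∧ u = b ∧ w = c then d else
  if v = c ∧ u = a ∧ w = y then b else
  if v = c ∧ u = y ∧ w = a then d else
  if v = y ∧ u = c ∧ w = d then a else
  if v = y ∧ u = d ∧ w = c then b else
  if v = d ∧ u = y ∧ w = b then c else
  if v = d ∧ u = b ∧ w = y then a else
  if v = b ∧ u = d ∧ w = a then y else
  if v = b ∧ u = a ∧ w = d then c else w

theorem PenFlag.s23 {a b y c d v u w : V} (h : PenFlag a b y c d v u w) :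
    PenFlag a b y c d v w u := by
  rcases h with ⟨rfl, rfl, rfl⟩ | ⟨rfl, rfl, rfl⟩ | ⟨rfl, rfl, rfl⟩ | ⟨rfl, rfl, rfl⟩ |
    ⟨rfl, rfl, rfl⟩ | ⟨rfl, rfl, rfl⟩ | ⟨rfl, rfl, rfl⟩ | ⟨rfl, rfl, rfl⟩ | ⟨rfl, rfl, rfl⟩ |
    ⟨rfl, rfl, rfl⟩ <;> simp [PenFlag]

theorem Per.pen1 {a b y c d v x x' : V} (h : Per a y c v x x') (h1 : v ≠ a) (h2 : v ≠ y) :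
    PenFlag a b y c d v x x' := by
  rcases h with ⟨rfl, rfl, rfl⟩ | ⟨rfl, rfl, rfl⟩ | ⟨rfl, rfl, rfl⟩ | ⟨rfl, rfl, rfl⟩ |
    ⟨rfl, rfl, rfl⟩ | ⟨rfl, rfl, rfl⟩ <;> first | exact absurd rfl h1 | exact absurd rfl h2 | simp [PenFlag]

theorem Per.pen2 {a b y c d v x x' : V} (h : Per b y d v x x') (h1 : v ≠ b) (h2 : v ≠ y) :
    PenFlag a b y c d v x x' := by
  rcases h with ⟨rfl, rfl, rfl⟩ | ⟨rfl, rfl, rfl⟩ | ⟨rfl, rfl, rfl⟩ | ⟨rfl, rfl, rfl⟩ |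
    ⟨rfl, rfl, rfl⟩ | ⟨rfl, rfl, rfl⟩ <;> first | exact absurd rfl h1 | exact absurd rfl h2 | simp [PenFlag]

theorem penz_other {a b y c d : V} (v u w : V) (hP : ¬ PenFlag a b y c d v u w) :
    penz a b y c d v u w = w := by
  unfold PenFlag at hP
  simp only [not_or] at hP
  obtain ⟨h1, h2, h3, h4, h5, h6, h7, h8, h9, h10⟩ := hP
  unfold penz
  rw [if_neg h1, if_neg h2, if_neg h3, if_neg h4, if_neg h5, if_neg h6, if_neg h7, if_neg h8,
    if_neg h9, if_neg h10]

theorem penz_pen {a b y c d : V} (hab : a ≠ b) (hya : y ≠ a) (hyb : y ≠ b) (hyc : y ≠ c)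
    (hyd : y ≠ d) (hac : a ≠ c) (had : a ≠ d) (hbc : b ≠ c) (hbd : b ≠ d) (hcd : c ≠ d)
    (v u w : V) (hP : PenFlag a b y c d v u w) :
    PenFlag a b y c d u v (penz a b y c d v u w) ∧
      penz a b y c d u v (penz a b y c d v u w) = w := by
  rcases hP with ⟨rfl, rfl, rfl⟩ | ⟨rfl, rfl, rfl⟩ | ⟨rfl, rfl, rfl⟩ | ⟨rfl, rfl, rfl⟩ |
    ⟨rfl, rfl, rfl⟩ | ⟨rfl, rfl, rfl⟩ | ⟨rfl, rfl, rfl⟩ | ⟨rfl, rfl, rfl⟩ | ⟨rfl, rfl, rfl⟩ |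
    ⟨rfl, rfl, rfl⟩ <;>
  simp [penz, PenFlag, hab, hab.symm, hya, hya.symm, hyb, hyb.symm, hyc, hyc.symm, hyd, hyd.symm,
    hac, hac.symm, had, had.symm, hbc, hbc.symm, hbd, hbd.symm, hcd, hcd.symm]

set_option maxHeartbeats 1000000 in
theorem good_of_addEdge [Fintype V] (t : ℕ) (ht : 3 ≤ t)
    (hcard : Fintype.card V = t) (T : V → V → V → Prop) (a b : V) (hab : a ≠ b)
    (h : IsTriang (KMinus a b) T) :
    ∃ M : FlagSystem, M.Realizes (⊤ : SimpleGraph (Fin t)) ∧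
      2 * (t * (t - 1)) ≤ 6 * M.nF + 4 := by
  classical
  obtain ⟨y, hya, hyb⟩ : ∃ y, y ≠ a ∧ y ≠ b := by
    have : ∃ e ∈ (Finset.univ : Finset V), e ∉ ({a, b} : Finset V) := by
      apply Finset.exists_mem_notMem_of_card_lt_card
      have := Finset.card_le_two (a := a) (b := b)
      simp; omega
    obtain ⟨e, _, he⟩ := this
    simp at he
    exact ⟨e, he⟩
  have Ts12 := h.s12
  have Ts23 := h.s23
  have Tne : ∀ u v w, T u v w → u ≠ v := fun u v w hT => (h.adj _ _ _ hT).1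
  have Tab : ∀ w, ¬ T a b w := fun w hT => (h.adj _ _ _ hT).2.1 ⟨rfl, rfl⟩
  -- the link of y
  obtain ⟨l, hl, hc, hm⟩ := h.link y
  obtain ⟨t', ht', hn', hp'⟩ := hc.rotate_mem hl ((hm a).2 ⟨hya, by simp [hya, hyb], by simp [hya, hyb]⟩)
  have hb' : b ∈ t' := by
    have : b ∈ a :: t' := hp'.mem_iff.2 ((hm b).2 ⟨hyb, by simp [hya, hyb], by simp [hya, hyb]⟩)
    simpa [hab.symm] using this
  have hmem : ∀ u, u ≠ y → u ∈ a :: t' := by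
    intro u hu
    exact hp'.mem_iff.2 ((hm u).2 ⟨hu.symm, by simp [hya, hyb], by simp [hya, hyb]⟩)
  obtain ⟨l1, l2, rfl⟩ := List.append_of_mem hb'
  obtain ⟨hch, hlast⟩ := ht'
  obtain ⟨c, l1, rfl⟩ : ∃ c s, l1 = c :: s := by
    cases l1 with
    | nil =>
      exfalso
      simp only [List.nil_append, List.isChain_cons_cons] at hch
      exact Tab y (Ts23 _ _ _ (Ts12 _ _ _ hch.1))
    | cons c s => exact ⟨c, s, rfl⟩
  obtain ⟨d, l2, rfl⟩ : ∃ d s, l2 = d :: s := by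
    cases l2 with
    | nil =>
      exfalso
      have := hlast b (by rw [← List.cons_append, List.getLast?_append]; rfl) a rfl
      exact Tab y (Ts23 _ _ _ (Ts12 _ _ _ (Ts23 _ _ _ this)))
    | cons c s => exact ⟨c, s, rfl⟩
  have hch2 : (c :: (l1 ++ [b])).IsChain (T y) ∧ T y a c ∧ (b :: d :: l2).IsChain (T y) := by
    have e1 : a :: (c :: l1 ++ b :: d :: l2) = [a] ++ (c :: l1 ++ [b]) ++ (d :: l2) := by simp
    have e2 : a :: (c :: l1 ++ b :: d :: l2) = (a :: c :: l1) ++ (b :: d :: l2) := by simp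
    refine ⟨?_, ?_, ?_⟩
    · rw [e1] at hch
      exact hch.left_of_append.right_of_append
    · exact (List.isChain_cons_cons.1 hch).1
    · rw [e2] at hch
      exact hch.right_of_append
  obtain ⟨ch1, Tyac, ch2⟩ := hch2
  have Tybd : T y b d := (List.isChain_cons_cons.1 ch2).1
  replace ch2 := (List.isChain_cons_cons.1 ch2).2
  have hlast' : T y ((d :: l2).getLast (by simp)) a := by
    refine hlast _ ?_ a rfl
    rw [show a :: (c :: l1 ++ b :: d :: l2) = (a :: c :: l1 ++ [b]) ++ (d :: l2) by simp,
      List.getLast?_append, List.getLast?_eq_some_getLast (l := d :: l2) (by simp)]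
    rfl
  have nd : (a :: (c :: l1 ++ b :: d :: l2)).Nodup := hn'
  have hyc : y ≠ c := Tne y c a (Ts23 _ _ _ Tyac)
  have hyd : y ≠ d := Tne y d b (Ts23 _ _ _ Tybd)
  have hac : a ≠ c := by rintro rfl; simp at nd
  have had : a ≠ d := by rintro rfl; simp at nd
  have hbc : b ≠ c := by rintro rfl; simp at nd
  have hbd : b ≠ d := by rintro rfl; simp [List.nodup_append] at nd
  have hcd : c ≠ d := by rintro rfl; simp at nd
  have two' : ∀ v u e, T v u e → ∃ p, p ≠ e ∧ ∀ x, T v u x ↔ x = e ∨ x = p := by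
    intro v u e he
    obtain ⟨w, w', hne, hw, hw', hx⟩ := h.two v u (h.adj _ _ _ he)
    rcases hx e he with rfl | rfl
    · refine ⟨w', hne.symm, fun x => ⟨hx x, ?_⟩⟩
      rintro (rfl | rfl) <;> assumption
    · refine ⟨w, hne, fun x => ⟨fun h => (hx x h).symm, ?_⟩⟩
      rintro (rfl | rfl) <;> assumption
  have Tycd : ¬ T y c d := by
    intro hT
    obtain ⟨p, hp, hpx⟩ := two' y c a (Ts23 _ _ _ Tyac)
    have hd : d = p := by
      rcases (hpx d).1 hT with h | h
      · exact absurd h.symm had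
      · exact h
    cases l1 with
    | nil =>
      have hcb : T y c b := (List.isChain_cons_cons.1 ch1).1
      rcases (hpx b).1 hcb with h | h
      · exact hab h.symm
      · exact hbd (h.trans hd.symm)
    | cons s l1 =>
      have hcb : T y c s := (List.isChain_cons_cons.1 ch1).1
      rcases (hpx s).1 hcb with h | h
      · rw [h] at nd; simp at nd
      · rw [h, ← hd] at nd; simp at nd
  have Wd : ∀ v u w, TriFlag T a b y c d v u w → ¬ PenFlag a b y c d v u w := by
    intro v u w hW hP
    have Tba : ∀ w, ¬ T b a w := fun w hw => Tab w (Ts12 _ _ _ hw)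
    rcases hP with ⟨rfl, rfl, rfl⟩ | ⟨rfl, rfl, rfl⟩ | ⟨rfl, rfl, rfl⟩ | ⟨rfl, rfl, rfl⟩ |
      ⟨rfl, rfl, rfl⟩ | ⟨rfl, rfl, rfl⟩ | ⟨rfl, rfl, rfl⟩ | ⟨rfl, rfl, rfl⟩ | ⟨rfl, rfl, rfl⟩ |
      ⟨rfl, rfl, rfl⟩ <;>
    rcases hW with ⟨h1, h2, h3⟩ | h1 <;>
    first
      | exact Tab _ h1
      | exact Tab _ (Ts23 _ _ _ h1)
      | exact Tba _ h1
      | exact Tba _ (Ts23 _ _ _ h1)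
      | exact Tycd h1
      | exact Tycd (Ts23 _ _ _ h1)
      | (refine h2 ?_; simp [Per]; done)
      | (refine h3 ?_; simp [Per]; done)
      | (simp [Per, hab, hab.symm, hya, hya.symm, hyb, hyb.symm, hyc, hyc.symm, hyd, hyd.symm,
          hac, hac.symm, had, had.symm, hbc, hbc.symm, hbd, hbd.symm, hcd, hcd.symm] at h1)
  have W12 : ∀ v u w, TriFlag T a b y c d v u w → TriFlag T a b y c d u v w := by
    rintro v u w (⟨h1, h2, h3⟩ | h1)
    · exact Or.inl ⟨Ts12 _ _ _ h1, fun h => h2 h.s12, fun h => h3 h.s12⟩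
    · exact Or.inr h1.s12
  have W23 : ∀ v u w, TriFlag T a b y c d v u w → TriFlag T a b y c d v w u := by
    rintro v u w (⟨h1, h2, h3⟩ | h1)
    · exact Or.inl ⟨Ts23 _ _ _ h1, fun h => h2 h.s23, fun h => h3 h.s23⟩
    · exact Or.inr h1.s23
  have P23 := fun v u w => PenFlag.s23 (a := a) (b := b) (y := y) (c := c) (d := d) (v := v) (u := u) (w := w)
  have zW := penz_other (a := a) (b := b) (y := y) (c := c) (d := d)
  have zP := penz_pen hab hya hyb hyc hyd hac had hbc hbd hcd
  let C : V → V → V → Prop := fun v u w => TriFlag T a b y c d v u w ∨ PenFlag a b y c d v u w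
  have C23 : ∀ v u w, C v u w → C v w u := fun v u w hC =>
    hC.elim (fun h => Or.inl (W23 _ _ _ h)) (fun h => Or.inr (P23 _ _ _ h))
  have TC : ∀ v u w, T v u w → ¬ Per a y c v u w → ¬ Per b y d v u w → C v u w :=
    fun v u w h1 h2 h3 => Or.inl (Or.inl ⟨h1, h2, h3⟩)
  have fin : ∀ v u p q, p ≠ q → (∀ x, C v u x ↔ x = p ∨ x = q) →
      ∃ w w', w ≠ w' ∧ C v u w ∧ C v u w' ∧ ∀ y, C v u y → y = w ∨ y = w' :=
    fun v u p q hpq hx => ⟨p, q, hpq, (hx p).2 (Or.inl rfl), (hx q).2 (Or.inr rfl),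
      fun y hy => (hx y).1 hy⟩
  have ctwo : ∀ v u, u ≠ v → ∃ w w', w ≠ w' ∧ C v u w ∧ C v u w' ∧
      ∀ y, C v u y → y = w ∨ y = w' := by
    intro v u huv
    have Tacy : T a c y := Ts23 _ _ _ (Ts12 _ _ _ Tyac)
    have Tbdy : T b d y := Ts23 _ _ _ (Ts12 _ _ _ Tybd)
    have Tba : ∀ w, ¬ T b a w := fun w hw => Tab w (Ts12 _ _ _ hw)
    have gen : ∀ v u e e', T v u e → (e' = e ∨ ¬ T v u e') →
        (∀ x, C v u x ↔ (T v u x ∧ x ≠ e) ∨ x = e') →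
        ∃ w w', w ≠ w' ∧ C v u w ∧ C v u w' ∧ ∀ y, C v u y → y = w ∨ y = w' := by
      intro v u e e' he hn hx
      obtain ⟨p, hp, hpx⟩ := two' v u e he
      refine fin v u e' p ?_ ?_
      · rintro rfl
        rcases hn with h | h
        · exact hp h
        · exact h ((hpx _).2 (Or.inr rfl))
      · intro x
        rw [hx, hpx]
        constructor
        · rintro (⟨h | h, h'⟩ | h)
          · exact absurd h h'
          · exact Or.inr h
          · exact Or.inl h
        · rintro (h | h)
          · exact Or.inr h
          · exact Or.inl ⟨Or.inr h, by rw [h]; exact hp⟩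
    by_cases h_ac : v = a ∧ u = c
    · obtain ⟨rfl, rfl⟩ := h_ac
      refine gen _ _ y b (Ts23 _ _ _ (Ts12 _ _ _ Tyac)) (Or.inr (fun hT => Tab _ (Ts23 _ _ _ hT))) ?_
      intro x
      simp [C, TriFlag, PenFlag, Per, hab, hab.symm, hya, hya.symm, hyb, hyb.symm, hyc, hyc.symm, hyd, hyd.symm,
          hac, hac.symm, had, had.symm, hbc, hbc.symm, hbd, hbd.symm, hcd, hcd.symm]
    by_cases h_ca : v = c ∧ u = a
    · obtain ⟨rfl, rfl⟩ := h_ca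
      refine gen _ _ y y (Ts12 _ _ _ (Ts23 _ _ _ (Ts12 _ _ _ Tyac))) (Or.inl rfl) ?_
      intro x
      simp [C, TriFlag, PenFlag, Per, hab, hab.symm, hya, hya.symm, hyb, hyb.symm, hyc, hyc.symm, hyd, hyd.symm,
          hac, hac.symm, had, had.symm, hbc, hbc.symm, hbd, hbd.symm, hcd, hcd.symm]
    by_cases h_ay : v = a ∧ u = y
    · obtain ⟨rfl, rfl⟩ := h_ay
      refine gen _ _ c b (Ts12 _ _ _ Tyac) (Or.inr (fun hT => Tab _ (Ts23 _ _ _ hT))) ?_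
      intro x
      simp [C, TriFlag, PenFlag, Per, hab, hab.symm, hya, hya.symm, hyb, hyb.symm, hyc, hyc.symm, hyd, hyd.symm,
          hac, hac.symm, had, had.symm, hbc, hbc.symm, hbd, hbd.symm, hcd, hcd.symm]
    by_cases h_ya : v = y ∧ u = a
    · obtain ⟨rfl, rfl⟩ := h_ya
      refine gen _ _ c b Tyac (Or.inr (fun hT => Tab _ (Ts23 _ _ _ (Ts12 _ _ _ hT)))) ?_
      intro x
      simp [C, TriFlag, PenFlag, Per, hab, hab.symm, hya, hya.symm, hyb, hyb.symm, hyc, hyc.symm, hyd, hyd.symm,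
          hac, hac.symm, had, had.symm, hbc, hbc.symm, hbd, hbd.symm, hcd, hcd.symm]
    by_cases h_cy : v = c ∧ u = y
    · obtain ⟨rfl, rfl⟩ := h_cy
      refine gen _ _ a a (Ts12 _ _ _ (Ts23 _ _ _ Tyac)) (Or.inl rfl) ?_
      intro x
      simp [C, TriFlag, PenFlag, Per, hab, hab.symm, hya, hya.symm, hyb, hyb.symm, hyc, hyc.symm, hyd, hyd.symm,
          hac, hac.symm, had, had.symm, hbc, hbc.symm, hbd, hbd.symm, hcd, hcd.symm]
    by_cases h_yc : v = y ∧ u = c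
    · obtain ⟨rfl, rfl⟩ := h_yc
      refine gen _ _ a d (Ts23 _ _ _ Tyac) (Or.inr Tycd) ?_
      intro x
      simp [C, TriFlag, PenFlag, Per, hab, hab.symm, hya, hya.symm, hyb, hyb.symm, hyc, hyc.symm, hyd, hyd.symm,
          hac, hac.symm, had, had.symm, hbc, hbc.symm, hbd, hbd.symm, hcd, hcd.symm]
    by_cases h_bd : v = b ∧ u = d
    · obtain ⟨rfl, rfl⟩ := h_bd
      refine gen _ _ y a (Ts23 _ _ _ (Ts12 _ _ _ Tybd)) (Or.inr (fun hT => Tba _ (Ts23 _ _ _ hT))) ?_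
      intro x
      simp [C, TriFlag, PenFlag, Per, hab, hab.symm, hya, hya.symm, hyb, hyb.symm, hyc, hyc.symm, hyd, hyd.symm,
          hac, hac.symm, had, had.symm, hbc, hbc.symm, hbd, hbd.symm, hcd, hcd.symm]
    by_cases h_db : v = d ∧ u = b
    · obtain ⟨rfl, rfl⟩ := h_db
      refine gen _ _ y y (Ts12 _ _ _ (Ts23 _ _ _ (Ts12 _ _ _ Tybd))) (Or.inl rfl) ?_
      intro x
      simp [C, TriFlag, PenFlag, Per, hab, hab.symm, hya, hya.symm, hyb, hyb.symm, hyc, hyc.symm, hyd, hyd.symm,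
          hac, hac.symm, had, had.symm, hbc, hbc.symm, hbd, hbd.symm, hcd, hcd.symm]
    by_cases h_by : v = b ∧ u = y
    · obtain ⟨rfl, rfl⟩ := h_by
      refine gen _ _ d a (Ts12 _ _ _ Tybd) (Or.inr (fun hT => Tba _ (Ts23 _ _ _ hT))) ?_
      intro x
      simp [C, TriFlag, PenFlag, Per, hab, hab.symm, hya, hya.symm, hyb, hyb.symm, hyc, hyc.symm, hyd, hyd.symm,
          hac, hac.symm, had, had.symm, hbc, hbc.symm, hbd, hbd.symm, hcd, hcd.symm]
    by_cases h_yb : v = y ∧ u = b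
    · obtain ⟨rfl, rfl⟩ := h_yb
      refine gen _ _ d a Tybd (Or.inr (fun hT => Tba _ (Ts23 _ _ _ (Ts12 _ _ _ hT)))) ?_
      intro x
      simp [C, TriFlag, PenFlag, Per, hab, hab.symm, hya, hya.symm, hyb, hyb.symm, hyc, hyc.symm, hyd, hyd.symm,
          hac, hac.symm, had, had.symm, hbc, hbc.symm, hbd, hbd.symm, hcd, hcd.symm]
    by_cases h_dy : v = d ∧ u = y
    · obtain ⟨rfl, rfl⟩ := h_dy
      refine gen _ _ b b (Ts12 _ _ _ (Ts23 _ _ _ Tybd)) (Or.inl rfl) ?_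
      intro x
      simp [C, TriFlag, PenFlag, Per, hab, hab.symm, hya, hya.symm, hyb, hyb.symm, hyc, hyc.symm, hyd, hyd.symm,
          hac, hac.symm, had, had.symm, hbc, hbc.symm, hbd, hbd.symm, hcd, hcd.symm]
    by_cases h_yd : v = y ∧ u = d
    · obtain ⟨rfl, rfl⟩ := h_yd
      refine gen _ _ b c (Ts23 _ _ _ Tybd) (Or.inr (fun hT => Tycd (Ts23 _ _ _ hT))) ?_
      intro x
      simp [C, TriFlag, PenFlag, Per, hab, hab.symm, hya, hya.symm, hyb, hyb.symm, hyc, hyc.symm, hyd, hyd.symm,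
          hac, hac.symm, had, had.symm, hbc, hbc.symm, hbd, hbd.symm, hcd, hcd.symm]
    by_cases h_ab : v = a ∧ u = b
    · obtain ⟨rfl, rfl⟩ := h_ab
      refine fin _ _ y c (by first | exact hyc | exact hyd) ?_
      intro x
      simp [C, TriFlag, PenFlag, Per, Tab, Tba, hab, hab.symm, hya, hya.symm, hyb, hyb.symm, hyc, hyc.symm, hyd, hyd.symm,
          hac, hac.symm, had, had.symm, hbc, hbc.symm, hbd, hbd.symm, hcd, hcd.symm]
    by_cases h_ba : v = b ∧ u = a
    · obtain ⟨rfl, rfl⟩ := h_ba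
      refine fin _ _ y d (by first | exact hyc | exact hyd) ?_
      intro x
      simp [C, TriFlag, PenFlag, Per, Tab, Tba, hab, hab.symm, hya, hya.symm, hyb, hyb.symm, hyc, hyc.symm, hyd, hyd.symm,
          hac, hac.symm, had, had.symm, hbc, hbc.symm, hbd, hbd.symm, hcd, hcd.symm]
    have hCT : ∀ x, C v u x ↔ T v u x := by
      intro x
      have q1 : ¬ Per a y c v u x := by
        rintro (⟨h1, h2, -⟩ | ⟨h1, h2, -⟩ | ⟨h1, h2, -⟩ | ⟨h1, h2, -⟩ | ⟨h1, h2, -⟩ | ⟨h1, h2, -⟩) <;>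
        simp_all only [true_and, and_true, not_true_eq_false]
      have q2 : ¬ Per b y d v u x := by
        rintro (⟨h1, h2, -⟩ | ⟨h1, h2, -⟩ | ⟨h1, h2, -⟩ | ⟨h1, h2, -⟩ | ⟨h1, h2, -⟩ | ⟨h1, h2, -⟩) <;>
        simp_all only [true_and, and_true, not_true_eq_false]
      have q3 : ¬ Per a y b v u x := by
        rintro (⟨h1, h2, -⟩ | ⟨h1, h2, -⟩ | ⟨h1, h2, -⟩ | ⟨h1, h2, -⟩ | ⟨h1, h2, -⟩ | ⟨h1, h2, -⟩) <;>
        simp_all only [true_and, and_true, not_true_eq_false]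
      have q4 : ¬ PenFlag a b y c d v u x := by
        rintro (⟨h1, h2, -⟩ | ⟨h1, h2, -⟩ | ⟨h1, h2, -⟩ | ⟨h1, h2, -⟩ | ⟨h1, h2, -⟩ | ⟨h1, h2, -⟩ |
          ⟨h1, h2, -⟩ | ⟨h1, h2, -⟩ | ⟨h1, h2, -⟩ | ⟨h1, h2, -⟩) <;>
        simp_all only [true_and, and_true, not_true_eq_false]
      simp [C, TriFlag, q1, q2, q3, q4]
    obtain ⟨w, w', h1, h2, h3, h4⟩ := h.two v u ⟨huv.symm, h_ab, h_ba⟩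
    exact ⟨w, w', h1, (hCT _).2 h2, (hCT _).2 h3, fun x hx => h4 x ((hCT _).1 hx)⟩
  have symC : ∀ v, Std.Symm (C v) := fun v => ⟨C23 v⟩
  have conn1 : ∀ v e, e ≠ v → (∀ u, u ≠ v → Relation.ReflTransGen (C v) u e) →
      ∀ u u', u ≠ v → u' ≠ v → Relation.ReflTransGen (C v) u u' := by
    intro v e _ hr u u' hu hu'
    have := symC v
    exact (hr u hu).trans (Std.Symm.symm _ _ (hr u' hu'))
  have stepgen : ∀ v u u', (∀ x x', T v x x' → Relation.ReflTransGen (C v) x x') →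
      Relation.ReflTransGen (T v) u u' → Relation.ReflTransGen (C v) u u' := by
    intro v u u' hs hr
    induction hr with
    | refl => exact .refl
    | tail _ hbc ih => exact ih.trans (hs _ _ hbc)
  have Cyab : C y a b := Or.inl (Or.inr (by simp [Per]))
  have connY : ∀ u, u ≠ y → Relation.ReflTransGen (C y) u b := by
    have nd2 := nd
    simp only [List.cons_append, List.nodup_cons, List.nodup_append, List.mem_append, List.mem_cons,
      not_or, List.nodup_cons] at nd2
    have k1 : (c :: (l1 ++ [b])).IsChain (C y) := by
      refine ch1.imp_of_mem_imp ?_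
      intro p q hp hq hT
      have e1 : ∀ p, p ∈ c :: (l1 ++ [b]) → p ≠ a ∧ p ≠ d := by
        intro p hp
        simp only [List.mem_cons, List.mem_append, List.not_mem_nil, or_false] at hp
        rcases hp with rfl | hp | rfl
        · exact ⟨hac.symm, hcd⟩
        · exact ⟨fun h => nd2.1.2.1 (h ▸ hp), fun h => nd2.2.2.2.2 p hp d (by simp) h⟩
        · exact ⟨hab.symm, hbd⟩
      obtain ⟨p1, p2⟩ := e1 p hp
      obtain ⟨q1, q2⟩ := e1 q hq
      exact TC _ _ _ hT (by simp [Per, p1, q1, hya]) (by simp [Per, p2, q2, hyd])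
    have e2 : ∀ p, p ∈ d :: l2 → p ≠ a ∧ p ≠ b ∧ p ≠ c := by
      intro p hp
      simp only [List.mem_cons] at hp
      rcases hp with rfl | hp
      · exact ⟨had.symm, hbd.symm, hcd.symm⟩
      · exact ⟨fun h => nd2.1.2.2.2.2 (h ▸ hp), fun h => nd2.2.2.2.1.1.2 (h ▸ hp),
          fun h => nd2.2.1.2.2.2 (h ▸ hp)⟩
    have k2 : (d :: l2).IsChain (C y) := by
      refine ch2.imp_of_mem_imp ?_
      intro p q hp hq hT
      obtain ⟨p1, p2, _⟩ := e2 p hp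
      obtain ⟨q1, q2, _⟩ := e2 q hq
      exact TC _ _ _ hT (by simp [Per, p1, q1, hya]) (by simp [Per, p2, q2, hyb])
    have k3 : C y ((d :: l2).getLast (by simp)) a := by
      obtain ⟨p1, p2, p3⟩ := e2 _ (List.getLast_mem (l := d :: l2) (by simp))
      exact TC _ _ _ hlast' (by simp [Per, p1, p3, hya, hyc, hac]) (by simp [Per, p2, hyb, hab])
    intro u hu
    have := hmem u hu
    rcases List.mem_cons.1 this with hu | this
    · rw [hu]; exact .single Cyab
    rcases List.mem_append.1 this with hu | this
    · refine chain_last _ _ _ k1 ?_ u ?_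
      · rw [← List.cons_append, List.getLast?_append]; rfl
      · rw [← List.cons_append]; exact List.mem_append_left _ hu
    rcases List.mem_cons.1 this with hu | hu
    · rw [hu]
    · refine (chain_last _ _ _ k2 (List.getLast?_eq_some_getLast (by simp)) u hu).trans ?_
      exact .head k3 (.single Cyab)
  have cconn : ∀ v u u', u ≠ v → u' ≠ v → Relation.ReflTransGen (C v) u u' := by
    intro v
    by_cases hvy : v = y
    · subst hvy
      exact conn1 v b (Ne.symm hyb) connY
    by_cases hva : v = a
    · rw [hva]
      have c1 : C a y b := Or.inl (Or.inr (by simp [Per]))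
      have c2 : C a b c := Or.inr (by simp [PenFlag])
      refine conn1 a y hya ?_
      intro u hu
      by_cases huw : u = b
      · rw [huw]; exact .single (C23 _ _ _ c1)
      have hk : ∀ x, x ≠ a → x ≠ b → KMinus a b a x :=
        fun x hx hx' => ⟨hx.symm, fun h => hx' h.2, fun h => hab h.1⟩
      refine stepgen a u y ?_ (h.conn (hk u hu huw) (hk y hya hyb))
      intro x x' hT
      by_cases q1 : x = y ∧ x' = c
      · rw [q1.1, q1.2]; exact .head c1 (.single c2)
      by_cases q2 : x = c ∧ x' = y
      · rw [q2.1, q2.2]; exact .head (C23 _ _ _ c2) (.single (C23 _ _ _ c1))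
      refine .single (TC _ _ _ hT ?_ ?_)
      · rintro (⟨h0, h1, h2⟩ | ⟨h0, h1, h2⟩ | ⟨h0, h1, h2⟩ | ⟨h0, h1, h2⟩ | ⟨h0, h1, h2⟩ | ⟨h0, h1, h2⟩) <;>
        first | exact q1 ⟨h1, h2⟩ | exact q2 ⟨h1, h2⟩ | exact absurd h0 (by assumption) | exact absurd h0.symm (by assumption)
      · rintro (⟨h0, h1, h2⟩ | ⟨h0, h1, h2⟩ | ⟨h0, h1, h2⟩ | ⟨h0, h1, h2⟩ | ⟨h0, h1, h2⟩ | ⟨h0, h1, h2⟩) <;>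
        first | exact q1 ⟨h1, h2⟩ | exact q2 ⟨h1, h2⟩ | exact absurd h0 (by assumption) | exact absurd h0.symm (by assumption)
    by_cases hvb : v = b
    · rw [hvb]
      have c1 : C b y a := Or.inl (Or.inr (by simp [Per]))
      have c2 : C b a d := Or.inr (by simp [PenFlag])
      refine conn1 b y hyb ?_
      intro u hu
      by_cases huw : u = a
      · rw [huw]; exact .single (C23 _ _ _ c1)
      have hk : ∀ x, x ≠ b → x ≠ a → KMinus a b b x :=
        fun x hx hx' => ⟨hx.symm, fun h => hab h.1.symm, fun h => hx' h.2⟩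
      refine stepgen b u y ?_ (h.conn (hk u hu huw) (hk y hyb hya))
      intro x x' hT
      by_cases q1 : x = y ∧ x' = d
      · rw [q1.1, q1.2]; exact .head c1 (.single c2)
      by_cases q2 : x = d ∧ x' = y
      · rw [q2.1, q2.2]; exact .head (C23 _ _ _ c2) (.single (C23 _ _ _ c1))
      refine .single (TC _ _ _ hT ?_ ?_)
      · rintro (⟨h0, h1, h2⟩ | ⟨h0, h1, h2⟩ | ⟨h0, h1, h2⟩ | ⟨h0, h1, h2⟩ | ⟨h0, h1, h2⟩ | ⟨h0, h1, h2⟩) <;>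
        first | exact q1 ⟨h1, h2⟩ | exact q2 ⟨h1, h2⟩ | exact absurd h0 (by assumption) | exact absurd h0.symm (by assumption)
      · rintro (⟨h0, h1, h2⟩ | ⟨h0, h1, h2⟩ | ⟨h0, h1, h2⟩ | ⟨h0, h1, h2⟩ | ⟨h0, h1, h2⟩ | ⟨h0, h1, h2⟩) <;>
        first | exact q1 ⟨h1, h2⟩ | exact q2 ⟨h1, h2⟩ | exact absurd h0 (by assumption) | exact absurd h0.symm (by assumption)
    · intro u u' hu hu'
      have hk : ∀ x, x ≠ v → KMinus a b v x := fun x hx => ⟨hx.symm, fun h => hva h.1, fun h => hvb h.1⟩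
      refine stepgen v u u' ?_ (h.conn (hk u hu) (hk u' hu'))
      intro x x' hT
      refine .single ?_
      by_cases q1 : Per a y c v x x'
      · exact Or.inr (q1.pen1 hva hvy)
      by_cases q2 : Per b y d v x x'
      · exact Or.inr (q2.pen2 hvb hvy)
      exact TC _ _ _ hT q1 q2
  refine good_of_corners V t ht hcard C (penz a b y c d) C23 ?_ ctwo cconn ?_
    (Finset.univ.filter (fun p => PenFlag a b y c d p.1 p.2.1 p.2.2)) ?_ ?_ ?_
  · rintro v u w ((⟨hT, _⟩ | hC) | hC)
    · exact ⟨(Tne _ _ _ hT).symm, Tne _ _ _ (Ts23 _ _ _ (Ts12 _ _ _ hT))⟩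
    · rcases hC with ⟨rfl, rfl, rfl⟩ | ⟨rfl, rfl, rfl⟩ | ⟨rfl, rfl, rfl⟩ | ⟨rfl, rfl, rfl⟩ |
        ⟨rfl, rfl, rfl⟩ | ⟨rfl, rfl, rfl⟩ <;> constructor <;>
        first | assumption | (apply Ne.symm; assumption)
    · rcases hC with ⟨rfl, rfl, rfl⟩ | ⟨rfl, rfl, rfl⟩ | ⟨rfl, rfl, rfl⟩ | ⟨rfl, rfl, rfl⟩ |
        ⟨rfl, rfl, rfl⟩ | ⟨rfl, rfl, rfl⟩ | ⟨rfl, rfl, rfl⟩ | ⟨rfl, rfl, rfl⟩ | ⟨rfl, rfl, rfl⟩ |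
        ⟨rfl, rfl, rfl⟩ <;> constructor <;> first | assumption | (apply Ne.symm; assumption)
  · rintro v u w (hW | hP)
    · rw [zW _ _ _ (Wd _ _ _ hW)]
      exact ⟨Or.inl (W12 _ _ _ hW), zW _ _ _ (Wd _ _ _ (W12 _ _ _ hW))⟩
    · exact ⟨Or.inr (zP _ _ _ hP).1, (zP _ _ _ hP).2⟩
  · refine le_trans (Finset.card_le_card (t := {(a, c, b), (a, b, c), (c, a, y), (c, y, a), (y, c, d),
      (y, d, c), (d, y, b), (d, b, y), (b, d, a), (b, a, d)}) ?_) ?_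
    · rintro ⟨v, u, w⟩ hp
      simp only [Finset.mem_filter, Finset.mem_univ, true_and] at hp
      simp only [Finset.mem_insert, Finset.mem_singleton, Prod.mk.injEq]
      exact hp
    · have := Finset.card_le_six (a := (d, y, b)) (b := (d, b, y)) (c := (b, d, a)) (d := (b, a, d)) (e := (b, a, d)) (f := (b, a, d))
      exact List.toFinset_card_le [(a, c, b), (a, b, c), (c, a, y), (c, y, a), (y, c, d),
        (y, d, c), (d, y, b), (d, b, y), (b, d, a), (b, a, d)] |>.trans' (by simp)
  · intro v u w hC hS
    simp only [Finset.mem_filter, Finset.mem_univ, true_and] at hS ⊢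
    exact ⟨P23 _ _ _ hS, (zP _ _ _ hS).1⟩
  · intro v u w hC hS
    simp only [Finset.mem_filter, Finset.mem_univ, true_and] at hS
    have hW : TriFlag T a b y c d v u w := hC.resolve_right hS
    refine ⟨{(v, u, w), (v, w, u), (u, v, w), (u, w, v), (w, u, v), (w, v, u)}, by simp,
      Finset.card_le_six, ?_⟩
    intro v' u' w' hC' hm
    have hW' : TriFlag T a b y c d v' u' w' := by
      simp only [Finset.mem_insert, Finset.mem_singleton, Prod.mk.injEq] at hm
      rcases hm with ⟨rfl, rfl, rfl⟩ | ⟨rfl, rfl, rfl⟩ | ⟨rfl, rfl, rfl⟩ | ⟨rfl, rfl, rfl⟩ |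
        ⟨rfl, rfl, rfl⟩ | ⟨rfl, rfl, rfl⟩ <;>
      first
        | exact hW
        | exact W23 _ _ _ hW
        | exact W12 _ _ _ hW
        | exact W23 _ _ _ (W12 _ _ _ hW)
        | exact W12 _ _ _ (W23 _ _ _ hW)
        | exact W23 _ _ _ (W12 _ _ _ (W23 _ _ _ hW))
    rw [zW _ _ _ (Wd _ _ _ hW')]
    simp only [Finset.mem_insert, Finset.mem_singleton, Prod.mk.injEq] at hm ⊢
    rcases hm with ⟨rfl, rfl, rfl⟩ | ⟨rfl, rfl, rfl⟩ | ⟨rfl, rfl, rfl⟩ | ⟨rfl, rfl, rfl⟩ |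
      ⟨rfl, rfl, rfl⟩ | ⟨rfl, rfl, rfl⟩ <;> simp
end AddEdge

/-- the node of `ZMod m ⊕ Fin r` given by an integer -/
def ZN (m r : ℕ) (z : ℤ) : ZMod m ⊕ Fin r := Sum.inl (z : ZMod m)

theorem ZN_eq {m r : ℕ} {u v : ℤ} (t : ℤ) (h : u = v + m * t) : ZN m r u = ZN m r v := by
  subst h
  simp [ZN]

/-- zigzag sequence -/
def zigx (a N : ℤ) (i : ℕ) : ℤ := if i % 2 = 0 then a + (i / 2 : ℕ) else a + N - 1 - (i / 2 : ℕ)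

theorem zigx_even (a N : ℤ) (s : ℕ) : zigx a N (2 * s) = a + s := by
  unfold zigx
  rw [if_pos (by omega)]; congr 2; omega

theorem zigx_odd (a N : ℤ) (s : ℕ) : zigx a N (2 * s + 1) = a + N - 1 - s := by
  unfold zigx
  rw [if_neg (by omega)]; congr 2; omega

/-- the two mixed paths -/
def zigP (a c N : ℤ) (j : ℕ) : ℤ :=
  if j % 2 = 1 then -(N - (j / 2 : ℕ) - 1) else
    if (j / 2) % 2 = 0 then zigx a N (j / 2) else -(zigx a N (j / 2) + c)

def zigQ (a c N : ℤ) (j : ℕ) : ℤ :=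
  if j % 2 = 1 then (N - (j / 2 : ℕ) - 1) else
    if (j / 2) % 2 = 1 then zigx a N (j / 2) else -(zigx a N (j / 2) + c)

theorem zigP_odd (a c N : ℤ) (i : ℕ) : zigP a c N (2 * i + 1) = -(N - i - 1) := by
  unfold zigP
  rw [if_pos (by omega)]; congr 4; omega

theorem zigQ_odd (a c N : ℤ) (i : ℕ) : zigQ a c N (2 * i + 1) = (N - i - 1) := by
  unfold zigQ
  rw [if_pos (by omega)]; congr 3; omega

theorem zigP_e (a c N : ℤ) (s : ℕ) : zigP a c N (2 * (2 * s)) = a + s := by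
  unfold zigP
  rw [if_neg (by omega), if_pos (by omega), show 2 * (2 * s) / 2 = 2 * s by omega, zigx_even]

theorem zigP_o (a c N : ℤ) (s : ℕ) : zigP a c N (2 * (2 * s + 1)) = -(a + N - 1 - s + c) := by
  unfold zigP
  rw [if_neg (by omega), if_neg (by omega), show 2 * (2 * s + 1) / 2 = 2 * s + 1 by omega, zigx_odd]

theorem zigQ_e (a c N : ℤ) (s : ℕ) : zigQ a c N (2 * (2 * s)) = -(a + s + c) := by
  unfold zigQ
  rw [if_neg (by omega), if_neg (by omega), show 2 * (2 * s) / 2 = 2 * s by omega, zigx_even]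

theorem zigQ_o (a c N : ℤ) (s : ℕ) : zigQ a c N (2 * (2 * s + 1)) = a + N - 1 - s := by
  unfold zigQ
  rw [if_neg (by omega), if_pos (by omega), show 2 * (2 * s + 1) / 2 = 2 * s + 1 by omega, zigx_odd]

theorem even_or_odd4 (j : ℕ) : ∃ s, j = 2 * (2 * s) ∨ j = 2 * (2 * s) + 1 ∨ j = 2 * (2 * s + 1) ∨
    j = 2 * (2 * s + 1) + 1 := ⟨j / 4, by omega⟩

theorem Tcg {m r : ℕ} {T : ZMod m ⊕ Fin r → ZMod m ⊕ Fin r → ZMod m ⊕ Fin r → Prop}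
    {u v w u' v' w' : ℤ} (h : T (ZN m r u) (ZN m r v) (ZN m r w)) (hu : u = u') (hv : v = v')
    (hw : w = w') : T (ZN m r u') (ZN m r v') (ZN m r w') := by
  subst hu hv hw; exact h

section
variable {m r : ℕ} {T : ZMod m ⊕ Fin r → ZMod m ⊕ Fin r → ZMod m ⊕ Fin r → Prop}
  (s12 : ∀ u v w, T u v w → T v u w) (s23 : ∀ u v w, T u v w → T u w v)
  {a c N : ℤ} {L : ℕ}
  (top : ∀ i < L, ∀ z, T (ZN m r z) (ZN m r (z + zigx a N i))
    (ZN m r (z + zigx a N i - zigx a N (i + 1))))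
  (bot : ∀ i < L, ∀ z, T (ZN m r z) (ZN m r (z + zigx a N i + c))
    (ZN m r (z + zigx a N (i + 1) + c)))

include s12 s23 in
/-- link edges of a triangle seen from any of its corners -/
theorem corner3 {z α β : ℤ} (h : T (ZN m r z) (ZN m r α) (ZN m r β)) :
    T (ZN m r α) (ZN m r z) (ZN m r β) ∧ T (ZN m r α) (ZN m r β) (ZN m r z) ∧
    T (ZN m r β) (ZN m r z) (ZN m r α) ∧ T (ZN m r β) (ZN m r α) (ZN m r z) ∧
    T (ZN m r z) (ZN m r β) (ZN m r α) :=
  ⟨s12 _ _ _ h, s23 _ _ _ (s12 _ _ _ h), s12 _ _ _ (s23 _ _ _ h),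
    s23 _ _ _ (s12 _ _ _ (s23 _ _ _ h)), s23 _ _ _ h⟩

include s12 s23 top in
theorem arcX (z : ℤ) : Arc (T (ZN m r z)) (ZN m r (z - zigx a N 0)) (ZN m r (z - zigx a N L)) (L + 1)
    {u | ∃ i ≤ L, u = ZN m r (z - zigx a N i)} := by
  refine Arc.range (fun i => ZN m r (z - zigx a N i)) L ?_
  intro i hi
  have := (corner3 s12 s23 (top i hi (z - zigx a N i))).1
  simpa using this

include bot in
theorem arcY (z : ℤ) : Arc (T (ZN m r z)) (ZN m r (z + zigx a N 0 + c)) (ZN m r (z + zigx a N L + c))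
    (L + 1) {u | ∃ i ≤ L, u = ZN m r (z + zigx a N i + c)} :=
  Arc.range (fun i => ZN m r (z + zigx a N i + c)) L (fun i hi => bot i hi z)

include s12 s23 top bot in
theorem arcP (z : ℤ) : Arc (T (ZN m r z)) (ZN m r (z + zigP a c N 0)) (ZN m r (z + zigP a c N (2 * L)))
    (2 * L + 1) {u | ∃ i ≤ 2 * L, u = ZN m r (z + zigP a c N i)} := by
  refine Arc.range (fun i => ZN m r (z + zigP a c N i)) (2 * L) ?_
  intro j hj
  obtain ⟨s, rfl | rfl | rfl | rfl⟩ := even_or_odd4 j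
  · rw [zigP_e, zigP_odd]
    have := top (2 * s) (by omega) z
    rw [zigx_even, zigx_odd] at this
    exact Tcg this (by push_cast; ring) (by push_cast; ring) (by push_cast; ring)
  · rw [show 2 * (2 * s) + 1 + 1 = 2 * (2 * s + 1) by ring, zigP_o, zigP_odd]
    have h := bot (2 * s) (by omega) (z - (a + N - 1 - s + c))
    rw [zigx_even, zigx_odd] at h
    have := (corner3 s12 s23 h).2.2.2.1
    exact Tcg this (by push_cast; ring) (by push_cast; ring) (by push_cast; ring)
  · rw [zigP_o, zigP_odd]
    have h := bot (2 * s + 1) (by omega) (z - (a + N - 1 - s + c))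
    rw [show 2 * s + 1 + 1 = 2 * (s + 1) by ring, zigx_even, zigx_odd] at h
    have := (corner3 s12 s23 h).1
    exact Tcg this (by push_cast; ring) (by push_cast; ring) (by push_cast; ring)
  · rw [show 2 * (2 * s + 1) + 1 + 1 = 2 * (2 * (s + 1)) by ring, zigP_e, zigP_odd]
    have h := top (2 * s + 1) (by omega) (z + (a + (s + 1)) - (a + N - 1 - s))
    rw [show 2 * s + 1 + 1 = 2 * (s + 1) by ring, zigx_even, zigx_odd] at h
    have := (corner3 s12 s23 h).2.2.1
    exact Tcg this (by push_cast; ring) (by push_cast; ring) (by push_cast; ring)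

include s12 s23 top bot in
theorem arcQ (z : ℤ) : Arc (T (ZN m r z)) (ZN m r (z + zigQ a c N 0)) (ZN m r (z + zigQ a c N (2 * L)))
    (2 * L + 1) {u | ∃ i ≤ 2 * L, u = ZN m r (z + zigQ a c N i)} := by
  refine Arc.range (fun i => ZN m r (z + zigQ a c N i)) (2 * L) ?_
  intro j hj
  obtain ⟨s, rfl | rfl | rfl | rfl⟩ := even_or_odd4 j
  · rw [zigQ_e, zigQ_odd]
    have h := bot (2 * s) (by omega) (z - (a + s + c))
    rw [zigx_even, zigx_odd] at h
    have := (corner3 s12 s23 h).1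
    exact Tcg this (by push_cast; ring) (by push_cast; ring) (by push_cast; ring)
  · rw [show 2 * (2 * s) + 1 + 1 = 2 * (2 * s + 1) by ring, zigQ_o, zigQ_odd]
    have h := top (2 * s) (by omega) (z + (a + N - 1 - s) - (a + s))
    rw [zigx_even, zigx_odd] at h
    have := (corner3 s12 s23 h).2.2.1
    exact Tcg this (by push_cast; ring) (by push_cast; ring) (by push_cast; ring)
  · rw [zigQ_o, zigQ_odd]
    have := top (2 * s + 1) (by omega) z
    rw [show 2 * s + 1 + 1 = 2 * (s + 1) by ring, zigx_even, zigx_odd] at this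
    exact Tcg this (by push_cast; ring) (by push_cast; ring) (by push_cast; ring)
  · rw [show 2 * (2 * s + 1) + 1 + 1 = 2 * (2 * (s + 1)) by ring, zigQ_e, zigQ_odd]
    have h := bot (2 * s + 1) (by omega) (z - (a + (s + 1) + c))
    rw [show 2 * s + 1 + 1 = 2 * (s + 1) by ring, zigx_even, zigx_odd] at h
    have := (corner3 s12 s23 h).2.2.2.1
    exact Tcg this (by push_cast; ring) (by push_cast; ring) (by push_cast; ring)
end

/-- parity data for the ends of the ladder -/
def EndData (L : ℕ) (a c N xL eP eQ : ℤ) : Prop :=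
  ∃ l : ℕ, (L = 2 * l ∧ xL = a + l ∧ eP = xL ∧ eQ = -(xL + c)) ∨
    (L = 2 * l + 1 ∧ xL = a + N - 1 - l ∧ eP = -(xL + c) ∧ eQ = xL)

/-- the four arcs of the ladder at the vertex `z` -/
structure FourArcs (m r : ℕ) (T : ZMod m ⊕ Fin r → ZMod m ⊕ Fin r → ZMod m ⊕ Fin r → Prop)
    (L : ℕ) (a c N xL eP eQ : ℤ) (z : ℤ) (SX SY SP SQ : Set (ZMod m ⊕ Fin r)) : Prop where
  X : Arc (T (ZN m r z)) (ZN m r (z - a)) (ZN m r (z - xL)) (L + 1) SX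
  Y : Arc (T (ZN m r z)) (ZN m r (z + (a + c))) (ZN m r (z + (xL + c))) (L + 1) SY
  P : Arc (T (ZN m r z)) (ZN m r (z + a)) (ZN m r (z + eP)) (2 * L + 1) SP
  Q : Arc (T (ZN m r z)) (ZN m r (z - (a + c))) (ZN m r (z + eQ)) (2 * L + 1) SQ
  cX1 : ∀ p : ℤ, a ≤ -p → 2 * (-p - a) ≤ L → ZN m r (z + p) ∈ SX
  cX2 : ∀ p : ℤ, -p ≤ a + N - 1 → 2 * (a + N - 1 + p) + 1 ≤ L → ZN m r (z + p) ∈ SX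
  cY1 : ∀ p : ℤ, a + c ≤ p → 2 * (p - a - c) ≤ L → ZN m r (z + p) ∈ SY
  cY2 : ∀ p : ℤ, p ≤ a + c + N - 1 → 2 * (a + c + N - 1 - p) + 1 ≤ L → ZN m r (z + p) ∈ SY
  cP1 : ∀ p : ℤ, a ≤ p → 2 * (p - a) ≤ L → ZN m r (z + p) ∈ SP
  cP2 : ∀ p : ℤ, -p ≤ a + c + N - 1 → 2 * (a + c + N - 1 + p) + 1 ≤ L → ZN m r (z + p) ∈ SP
  cP3 : ∀ p : ℤ, N - L ≤ -p → -p ≤ N - 1 → ZN m r (z + p) ∈ SP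
  cQ1 : ∀ p : ℤ, a + c ≤ -p → 2 * (-p - a - c) ≤ L → ZN m r (z + p) ∈ SQ
  cQ2 : ∀ p : ℤ, p ≤ a + N - 1 → 2 * (a + N - 1 - p) + 1 ≤ L → ZN m r (z + p) ∈ SQ
  cQ3 : ∀ p : ℤ, N - L ≤ p → p ≤ N - 1 → ZN m r (z + p) ∈ SQ

theorem fourArcs {m r : ℕ} {T : ZMod m ⊕ Fin r → ZMod m ⊕ Fin r → ZMod m ⊕ Fin r → Prop}
    (s12 : ∀ u v w, T u v w → T v u w) (s23 : ∀ u v w, T u v w → T u w v)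
    {a c N : ℤ} {L : ℕ}
    (top : ∀ i < L, ∀ z, T (ZN m r z) (ZN m r (z + zigx a N i))
      (ZN m r (z + zigx a N i - zigx a N (i + 1))))
    (bot : ∀ i < L, ∀ z, T (ZN m r z) (ZN m r (z + zigx a N i + c))
      (ZN m r (z + zigx a N (i + 1) + c))) {xL eP eQ : ℤ} (hE : EndData L a c N xL eP eQ) (z : ℤ) :
    ∃ SX SY SP SQ, FourArcs m r T L a c N xL eP eQ z SX SY SP SQ := by
  have hx0 : zigx a N 0 = a := by simpa using zigx_even a N 0
  have hp0 : zigP a c N 0 = a := by simpa using zigP_e a c N 0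
  have hq0 : zigQ a c N 0 = -(a + c) := by simpa using zigQ_e a c N 0
  have hxL : zigx a N L = xL := by
    obtain ⟨l, ⟨rfl, rfl, _⟩ | ⟨rfl, rfl, _⟩⟩ := hE
    · exact zigx_even a N l
    · exact zigx_odd a N l
  have hpL : zigP a c N (2 * L) = eP := by
    obtain ⟨l, ⟨rfl, rfl, rfl, _⟩ | ⟨rfl, rfl, rfl, _⟩⟩ := hE
    · exact zigP_e a c N l
    · exact zigP_o a c N l
  have hqL : zigQ a c N (2 * L) = eQ := by
    obtain ⟨l, ⟨rfl, rfl, _, rfl⟩ | ⟨rfl, rfl, _, rfl⟩⟩ := hE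
    · exact zigQ_e a c N l
    · exact zigQ_o a c N l
  have X := arcX s12 s23 top z
  have Y := arcY bot z
  have P := arcP s12 s23 top bot z
  have Q := arcQ s12 s23 top bot z
  rw [hx0, hxL] at X
  rw [hx0, hxL, add_assoc, add_assoc] at Y
  rw [hp0, hpL] at P
  rw [hq0, hqL, ← sub_eq_add_neg] at Q
  refine ⟨_, _, _, _, ⟨X, Y, P, Q, ?_, ?_, ?_, ?_, ?_, ?_, ?_, ?_, ?_, ?_⟩⟩
  · intro p h1 h2
    refine ⟨2 * (-p - a).toNat, by omega, ?_⟩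
    rw [zigx_even]; congr 1; omega
  · intro p h1 h2
    refine ⟨2 * (a + N - 1 + p).toNat + 1, by omega, ?_⟩
    rw [zigx_odd]; congr 1; omega
  · intro p h1 h2
    refine ⟨2 * (p - a - c).toNat, by omega, ?_⟩
    rw [zigx_even]; congr 1; omega
  · intro p h1 h2
    refine ⟨2 * (a + c + N - 1 - p).toNat + 1, by omega, ?_⟩
    rw [zigx_odd]; congr 1; omega
  · intro p h1 h2
    refine ⟨2 * (2 * (p - a).toNat), by omega, ?_⟩
    rw [zigP_e]; congr 1; omega
  · intro p h1 h2
    refine ⟨2 * (2 * (a + c + N - 1 + p).toNat + 1), by omega, ?_⟩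
    rw [zigP_o]; congr 1; omega
  · intro p h1 h2
    refine ⟨2 * (N - 1 + p).toNat + 1, by omega, ?_⟩
    rw [zigP_odd]; congr 1; omega
  · intro p h1 h2
    refine ⟨2 * (2 * (-p - a - c).toNat), by omega, ?_⟩
    rw [zigQ_e]; congr 1; omega
  · intro p h1 h2
    refine ⟨2 * (2 * (a + N - 1 - p).toNat + 1), by omega, ?_⟩
    rw [zigQ_o]; congr 1; omega
  · intro p h1 h2
    refine ⟨2 * (N - 1 - p).toNat + 1, by omega, ?_⟩
    rw [zigQ_odd]; congr 1; omega

/-- existence of a good map on `t` vertices -/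
def Good (t : ℕ) : Prop :=
  ∃ M : FlagSystem, M.Realizes (⊤ : SimpleGraph (Fin t)) ∧ 2 * (t * (t - 1)) ≤ 6 * M.nF + 4

/-- closed link of a cyclic vertex -/
def LinkZ (m r : ℕ) (T : ZMod m ⊕ Fin r → ZMod m ⊕ Fin r → ZMod m ⊕ Fin r → Prop) (z : ℤ) : Prop :=
  ∃ a b n S, Arc (T (ZN m r z)) a b n S ∧ T (ZN m r z) b a ∧ n + 1 ≤ m + r ∧
    (∀ e : ℤ, 0 < e → e < m → ZN m r (z + e) ∈ S) ∧ ∀ i : Fin r, Sum.inr i ∈ S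

/-- closed link of an extra vertex -/
def LinkX (m r : ℕ) (T : ZMod m ⊕ Fin r → ZMod m ⊕ Fin r → ZMod m ⊕ Fin r → Prop) (i : Fin r) :
    Prop :=
  ∃ f : ℕ → ℤ, (∀ j, T (Sum.inr i) (ZN m r (f j)) (ZN m r (f (j + 1)))) ∧
    ZN m r (f m) = ZN m r (f 0) ∧ ∀ z, ∃ j < m, ZN m r (f j) = ZN m r z

theorem exists_ZN (m r : ℕ) (v : ZMod m) : ∃ z : ℤ, (Sum.inl v : ZMod m ⊕ Fin r) = ZN m r z :=
  ⟨v.cast, by simp [ZN]⟩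

theorem exists_diff {m : ℕ} (hm : 0 < m) (r : ℕ) (z : ℤ) (v : ZMod m)
    (h : ZN m r z ≠ Sum.inl v) : ∃ e : ℤ, 0 < e ∧ e < m ∧ (Sum.inl v : ZMod m ⊕ Fin r) = ZN m r (z + e) := by
  haveI : NeZero m := ⟨by omega⟩
  refine ⟨(v - (z : ZMod m)).val, ?_, ?_, ?_⟩
  · have : (v - (z : ZMod m)).val ≠ 0 := by
      rw [Ne, ZMod.val_eq_zero, sub_eq_zero]
      rintro rfl
      exact h rfl
    omega
  · exact_mod_cast ZMod.val_lt _
  · simp [ZN]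

open Classical in
theorem good_of_links {m r : ℕ} (hm : 4 ≤ m) (hr : r ≤ 2) {ι : Type} [Fintype ι]
    (tri : ι → (ZMod m ⊕ Fin r) × (ZMod m ⊕ Fin r) × (ZMod m ⊕ Fin r))
    (hcount : 3 * Fintype.card ι ≤ m * (m - 1 + 2 * r))
    (hZ : ∀ z, LinkZ m r (TriOf tri) z) (hX : ∀ i, LinkX m r (TriOf tri) i) : Good (m + r) := by
  haveI : NeZero m := ⟨by omega⟩
  have hcV : Fintype.card (ZMod m ⊕ Fin r) = m + r := by simp [ZMod.card]
  have hXarc : ∀ i : Fin r, ∃ a b n S, Arc (TriOf tri (Sum.inr i)) a b n S ∧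
      TriOf tri (Sum.inr i) b a ∧ n ≤ m ∧ ∀ v : ZMod m, Sum.inl v ∈ S := by
    intro i
    obtain ⟨f, h1, h2, h3⟩ := hX i
    refine ⟨_, _, _, _, Arc.range (fun j => ZN m r (f j)) (m - 1) (fun j _ => h1 j), ?_, by omega, ?_⟩
    · have := h1 (m - 1)
      rwa [Nat.sub_add_cancel (by omega), h2] at this
    · intro v
      obtain ⟨z, hz⟩ := exists_ZN m r v
      obtain ⟨j, hj, hj'⟩ := h3 z
      exact ⟨j, by omega, by rw [hz, hj']⟩
  have hdegne : ∀ v : ZMod m ⊕ Fin r, (Finset.univ.filter (fun u => v ≠ u)).card = m + r - 1 := by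
    intro v
    rw [← hcV, Finset.filter_ne, Finset.card_erase_of_mem (Finset.mem_univ _), Finset.card_univ]
  by_cases hr2 : r = 2
  · subst hr2
    have hKl : ∀ v : ZMod m, ∀ u, KMinus (Sum.inr (0 : Fin 2)) (Sum.inr 1) (Sum.inl v) u ↔ Sum.inl v ≠ u := by
      intro v u; simp [KMinus]
    have hKr : ∀ i : Fin 2, ∀ u : ZMod m ⊕ Fin 2, KMinus (Sum.inr (0 : Fin 2)) (Sum.inr 1) (Sum.inr i) u ↔
        ∃ v, u = Sum.inl v := by
      intro i u
      rcases u with u | u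
      · simp [KMinus]
      · fin_cases i <;> fin_cases u <;> simp [KMinus]
    have hdl : ∀ v : ZMod m, (Finset.univ.filter
        (KMinus (Sum.inr (0 : Fin 2)) (Sum.inr 1) (Sum.inl v))).card = m + 1 := by
      intro v
      refine Eq.trans ?_ (hdegne (Sum.inl v))
      congr 1; ext u; simp only [Finset.mem_filter, Finset.mem_univ, true_and]; exact hKl v u
    have hdr : ∀ i : Fin 2, (Finset.univ.filter
        (KMinus (Sum.inr (0 : Fin 2)) (Sum.inr 1) (Sum.inr i : ZMod m ⊕ Fin 2))).card = m := by
      intro i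
      have : (Finset.univ.filter
        (KMinus (Sum.inr (0 : Fin 2)) (Sum.inr 1) (Sum.inr i : ZMod m ⊕ Fin 2))) =
        Finset.univ.image (fun v : ZMod m => (Sum.inl v : ZMod m ⊕ Fin 2)) := by
        ext u; simp only [Finset.mem_filter, Finset.mem_univ, true_and, Finset.mem_image]
        rw [hKr]; simp [eq_comm]
      rw [this, Finset.card_image_of_injective _ Sum.inl_injective, Finset.card_univ, ZMod.card]
    refine good_of_addEdge (m + 2) (by omega) hcV (TriOf tri) (Sum.inr 0) (Sum.inr 1) (by simp)
      (isTriang_of_count _ tri ?_ ?_ ?_)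
    · have : (Finset.univ.filter (fun p : (ZMod m ⊕ Fin 2) × (ZMod m ⊕ Fin 2) =>
          KMinus (Sum.inr 0) (Sum.inr 1) p.1 p.2)).card = m * (m + 1) + 2 * m := by
        rw [← Finset.univ_product_univ, Finset.card_filter, Finset.sum_product]
        simp only [← Finset.card_filter]
        rw [Fintype.sum_sum_type]
        have e1 : ∀ v : ZMod m, (Finset.univ.filter
          (fun u => KMinus (Sum.inr (0 : Fin 2)) (Sum.inr 1) (Sum.inl v) u)).card = m + 1 := hdl
        have e2 : ∀ i : Fin 2, (Finset.univ.filter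
          (fun u => KMinus (Sum.inr (0 : Fin 2)) (Sum.inr 1) (Sum.inr i : ZMod m ⊕ Fin 2) u)).card = m := hdr
        simp only [e1, e2]
        simp [ZMod.card]
      rw [this]
      have : m - 1 + 2 * 2 = m + 3 := by omega
      rw [this] at hcount
      linarith
    · rintro (v | i)
      · rw [hdl]; omega
      · rw [hdr]; omega
    · rintro (v | i)
      · obtain ⟨z, hz⟩ := exists_ZN m 2 v
        obtain ⟨a, b, n, S, h1, h2, h3, h4, h5⟩ := hZ z
        rw [← hz] at h1 h2
        refine ⟨a, b, n, S, h1, h2, by rw [hdl]; omega, ?_⟩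
        intro u hu
        rw [hKl] at hu
        rcases u with u | u
        · obtain ⟨e, he, he', h⟩ := exists_diff (by omega) 2 z u (by rw [← hz]; exact hu)
          rw [h]; exact h4 e he he'
        · exact h5 u
      · obtain ⟨a, b, n, S, h1, h2, h3, h4⟩ := hXarc i
        refine ⟨a, b, n, S, h1, h2, by rw [hdr]; omega, ?_⟩
        intro u hu
        rw [hKr] at hu
        obtain ⟨v, rfl⟩ := hu
        exact h4 v
  · obtain ⟨A, hA⟩ : ∃ A : ZMod m ⊕ Fin r → ZMod m ⊕ Fin r → Prop, A = fun u v => u ≠ v := ⟨_, rfl⟩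
    have hA' : ∀ u v, A u v ↔ u ≠ v := by intro u v; rw [hA]
    have hdA : ∀ v, (Finset.univ.filter (A v)).card = m + r - 1 := by
      intro v
      refine Eq.trans ?_ (hdegne v)
      congr 1; ext u; simp only [Finset.mem_filter, Finset.mem_univ, true_and]; exact hA' v u
    refine good_of_triang (ZMod m ⊕ Fin r) (m + r) (by omega) hcV (TriOf tri) (hA ▸ ?_)
    refine isTriang_of_count A tri ?_ ?_ ?_
    · have : (Finset.univ.filter (fun p : (ZMod m ⊕ Fin r) × (ZMod m ⊕ Fin r) =>
          A p.1 p.2)).card = (m + r) * (m + r - 1) := by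
        rw [← Finset.univ_product_univ, Finset.card_filter, Finset.sum_product]
        simp only [← Finset.card_filter]
        have e1 : ∀ v, (Finset.univ.filter (fun u => A v u)).card = m + r - 1 := hdA
        simp only [e1]
        rw [Finset.sum_const, Finset.card_univ, hcV, smul_eq_mul]
      rw [this]
      have h01 : r = 0 ∨ r = 1 := by omega
      obtain ⟨m, rfl⟩ : ∃ k, m = k + 1 := ⟨m - 1, by omega⟩
      rcases h01 with rfl | rfl
      · simp only [Nat.add_sub_cancel] at hcount ⊢; simp at *; linarith
      · simp only [Nat.add_sub_cancel] at hcount ⊢; linarith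
    · intro v; rw [hdA]; omega
    · rintro (v | i)
      · obtain ⟨z, hz⟩ := exists_ZN m r v
        obtain ⟨a, b, n, S, h1, h2, h3, h4, h5⟩ := hZ z
        rw [← hz] at h1 h2
        refine ⟨a, b, n, S, h1, h2, by rw [hdA]; omega, ?_⟩
        intro u hu
        rw [hA'] at hu
        rcases u with u | u
        · obtain ⟨e, he, he', h⟩ := exists_diff (by omega) r z u (by rw [← hz]; exact hu)
          rw [h]; exact h4 e he he'
        · exact h5 u
      · obtain ⟨a, b, n, S, h1, h2, h3, h4⟩ := hXarc i
        refine ⟨a, b, n, S, h1, h2, by rw [hdA]; have := i.isLt; omega, ?_⟩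
        intro u hu
        rw [hA'] at hu
        rcases u with u | u
        · exact h4 u
        · exact absurd (congrArg Sum.inr (by apply Fin.ext; omega)) hu

/-- the list of triangles of a ladder with gadgets -/
def ladTri {m r L g r' h w : ℕ} (a c N : ℤ) (gd : Fin g → ℤ × ℤ) (ex : Fin r' → Fin r × ℤ)
    (oth : Fin h × Fin w → (ZMod m ⊕ Fin r) × (ZMod m ⊕ Fin r) × (ZMod m ⊕ Fin r)) :
    (((Fin L × Bool × ZMod m) ⊕ (Fin g × ZMod m)) ⊕ (Fin r' × ZMod m)) ⊕ (Fin h × Fin w) →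
      (ZMod m ⊕ Fin r) × (ZMod m ⊕ Fin r) × (ZMod m ⊕ Fin r)
  | .inl (.inl (.inl (i, true, b))) => (.inl b, .inl (b + (zigx a N i : ℤ)),
      .inl (b + (zigx a N i : ℤ) - (zigx a N (i + 1) : ℤ)))
  | .inl (.inl (.inl (i, false, b))) => (.inl b, .inl (b + (zigx a N i : ℤ) + (c : ℤ)),
      .inl (b + (zigx a N (i + 1) : ℤ) + (c : ℤ)))
  | .inl (.inl (.inr (i, b))) => (.inl b, .inl (b + ((gd i).1 : ℤ)),
      .inl (b + ((gd i).1 : ℤ) + ((gd i).2 : ℤ)))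
  | .inl (.inr (i, b)) => (.inr (ex i).1, .inl b, .inl (b + ((ex i).2 : ℤ)))
  | .inr p => oth p

/-- Ladder constructions. -/
theorem good_of_ladder {m r L g r' h w : ℕ} (hm : 4 ≤ m) (hr : r ≤ 2) (a c N xL eP eQ : ℤ)
    (gd : Fin g → ℤ × ℤ) (ex : Fin r' → Fin r × ℤ)
    (oth : Fin h × Fin w → (ZMod m ⊕ Fin r) × (ZMod m ⊕ Fin r) × (ZMod m ⊕ Fin r))
    (hE : EndData L a c N xL eP eQ)
    (hcount : 3 * ((2 * L + g + r') * m + h * w) + m = m * (m + 2 * r))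
    (H : ∀ T : ZMod m ⊕ Fin r → ZMod m ⊕ Fin r → ZMod m ⊕ Fin r → Prop,
      (∀ u v w, T u v w → T v u w) → (∀ u v w, T u v w → T u w v) →
      (∀ z, ∃ SX SY SP SQ, FourArcs m r T L a c N xL eP eQ z SX SY SP SQ) →
      (∀ i z, T (ZN m r z) (ZN m r (z + (gd i).1)) (ZN m r (z + (gd i).1 + (gd i).2))) →
      (∀ i z, T (.inr (ex i).1) (ZN m r z) (ZN m r (z + (ex i).2))) →
      (∀ p, T (oth p).1 (oth p).2.1 (oth p).2.2) →
      (∀ z, LinkZ m r T z) ∧ ∀ i, LinkX m r T i) : Good (m + r) := by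
  haveI : NeZero m := ⟨by omega⟩
  have key := H (TriOf (ladTri (L := L) a c N gd ex oth)) (fun _ _ _ => TriOf.s12) (fun _ _ _ => TriOf.s23)
    (fourArcs (T := TriOf (ladTri (L := L) a c N gd ex oth)) (fun _ _ _ => TriOf.s12) (fun _ _ _ => TriOf.s23)
      (fun i hi z => TriOf.mk (.inl (.inl (.inl (⟨i, hi⟩, true, (z : ZMod m))))) (by simp [ladTri, ZN]))
      (fun i hi z => TriOf.mk (.inl (.inl (.inl (⟨i, hi⟩, false, (z : ZMod m))))) (by simp [ladTri, ZN])) hE)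
    (fun i z => TriOf.mk (.inl (.inl (.inr (i, (z : ZMod m))))) (by simp [ladTri, ZN]))
    (fun i z => TriOf.mk (.inl (.inr (i, (z : ZMod m)))) (by simp [ladTri, ZN]))
    (fun p => TriOf.mk (.inr p) (by simp [ladTri]))
  refine good_of_links hm hr (ladTri (L := L) a c N gd ex oth) ?_ key.1 key.2
  simp only [Fintype.card_sum, Fintype.card_prod, Fintype.card_fin, Fintype.card_bool, ZMod.card]
  calc _ = 3 * ((2 * L + g + r') * m + h * w) := by ring
    _ ≤ _ := by
      obtain ⟨k, rfl⟩ : ∃ k, m = k + 1 := ⟨m - 1, by omega⟩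
      rw [Nat.add_sub_cancel]
      have : (k + 1) * (k + 1 + 2 * r) = (k + 1) * (k + 2 * r) + (k + 1) := by ring
      omega

/-- links of extra vertices with a single step -/
theorem linkX_of_step {m r : ℕ} (hm : 0 < m)
    {T : ZMod m ⊕ Fin r → ZMod m ⊕ Fin r → ZMod m ⊕ Fin r → Prop} {i : Fin r} {d u v : ℤ}
    (hd : d * u + m * v = 1) (h : ∀ z, T (.inr i) (ZN m r z) (ZN m r (z + d))) : LinkX m r T i := by
  refine ⟨fun j => j * d, fun j => ?_, ?_, fun z => ?_⟩
  · have := h (j * d)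
    convert this using 2
    push_cast; ring
  · exact ZN_eq d (by push_cast; ring)
  · have h1 := Int.emod_nonneg (z * u) (by omega : (m : ℤ) ≠ 0)
    have h2 := Int.emod_lt_of_pos (z * u) (by omega : (0 : ℤ) < m)
    refine ⟨((z * u) % m).toNat, by omega, ?_⟩
    have h3 := Int.emod_add_mul_ediv (z * u) m
    refine ZN_eq (-(z * v) - d * (z * u / m)) ?_
    show (((z * u) % m).toNat : ℤ) * d = _
    rw [Int.toNat_of_nonneg h1]
    linear_combination d * h3 + z * hd

theorem EndData.even {L : ℕ} {a c N xL eP eQ : ℤ} (l : ℕ) (h1 : L = 2 * l) (h2 : xL = a + l)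
    (h3 : eP = xL) (h4 : eQ = -(xL + c)) : EndData L a c N xL eP eQ :=
  ⟨l, Or.inl ⟨h1, h2, h3, h4⟩⟩

theorem EndData.odd {L : ℕ} {a c N xL eP eQ : ℤ} (l : ℕ) (h1 : L = 2 * l + 1)
    (h2 : xL = a + N - 1 - l) (h3 : eP = -(xL + c)) (h4 : eQ = xL) : EndData L a c N xL eP eQ :=
  ⟨l, Or.inr ⟨h1, h2, h3, h4⟩⟩

theorem Arc.cgr {m r : ℕ} {R : ZMod m ⊕ Fin r → ZMod m ⊕ Fin r → Prop} {u v u' v' : ℤ} {n : ℕ}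
    {S : Set (ZMod m ⊕ Fin r)} (h : Arc R (ZN m r u) (ZN m r v) n S) (hu : u = u') (hv : v = v') :
    Arc R (ZN m r u') (ZN m r v') n S := by
  subst hu hv; exact h

theorem mem_shift {m r : ℕ} {S : Set (ZMod m ⊕ Fin r)} {z p e : ℤ} (t : ℤ)
    (h : ZN m r (z + p) ∈ S) (he : e = p + m * t) : ZN m r (z + e) ∈ S := by
  rwa [ZN_eq (u := z + e) (v := z + p) t (by rw [he]; ring)]

theorem mem_node {m r : ℕ} {z p e : ℤ} (t : ℤ) (he : e = p + m * t) :
    ZN m r (z + e) ∈ ({ZN m r (z + p)} : Set (ZMod m ⊕ Fin r)) :=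
  mem_shift t rfl he

section
variable {m r : ℕ} {T : ZMod m ⊕ Fin r → ZMod m ⊕ Fin r → ZMod m ⊕ Fin r → Prop}
  (s12 : ∀ u v w, T u v w → T v u w) (s23 : ∀ u v w, T u v w → T u w v)

include s12 s23

theorem gedge {q e α β : ℤ}
    (hG : ∀ z, z % q = e → T (ZN m r z) (ZN m r (z + α)) (ZN m r (z + α + β)))
    (z p p' t t' : ℤ) :
    (z % q = e → p = α + m * t → p' = α + β + m * t' → T (ZN m r z) (ZN m r (z + p)) (ZN m r (z + p'))) ∧
    ((z - α) % q = e → p = -α + m * t → p' = β + m * t' →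
      T (ZN m r z) (ZN m r (z + p)) (ZN m r (z + p'))) ∧
    ((z - α - β) % q = e → p = -α - β + m * t → p' = -β + m * t' →
      T (ZN m r z) (ZN m r (z + p)) (ZN m r (z + p'))) := by
  refine ⟨fun h hp hp' => ?_, fun h hp hp' => ?_, fun h hp hp' => ?_⟩
  · rw [ZN_eq (u := z + p) (v := z + α) t (by rw [hp]; ring),
      ZN_eq (u := z + p') (v := z + α + β) t' (by rw [hp']; ring)]
    exact hG z h
  · rw [ZN_eq (u := z + p) (v := z - α) t (by rw [hp]; ring),
      ZN_eq (u := z + p') (v := z - α + α + β) t' (by rw [hp']; ring)]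
    have := s12 _ _ _ (hG _ h)
    rwa [sub_add_cancel] at this ⊢
  · rw [ZN_eq (u := z + p) (v := z - α - β) t (by rw [hp]; ring),
      ZN_eq (u := z + p') (v := z - α - β + α) t' (by rw [hp']; ring)]
    have := s12 _ _ _ (s23 _ _ _ (hG _ h))
    rwa [show z - α - β + α + β = z by ring] at this

theorem xedge {q e d : ℤ} {i : Fin r}
    (hG : ∀ z, z % q = e → T (.inr i) (ZN m r z) (ZN m r (z + d))) (z p t : ℤ) :
    (z % q = e → p = d + m * t → T (ZN m r z) (.inr i) (ZN m r (z + p))) ∧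
    ((z - d) % q = e → p = -d + m * t → T (ZN m r z) (.inr i) (ZN m r (z + p))) := by
  refine ⟨fun h hp => ?_, fun h hp => ?_⟩
  · rw [ZN_eq (u := z + p) (v := z + d) t (by rw [hp]; ring)]
    exact s12 _ _ _ (hG z h)
  · rw [ZN_eq (u := z + p) (v := z - d) t (by rw [hp]; ring)]
    have := s12 _ _ _ (s23 _ _ _ (hG _ h))
    rwa [sub_add_cancel] at this
end

/-- triangles whose base point runs over a residue class -/
def idxTri (m r : ℕ) (q e α β : ℤ) (j : ℕ) :
    (ZMod m ⊕ Fin r) × (ZMod m ⊕ Fin r) × (ZMod m ⊕ Fin r) :=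
  (ZN m r (q * j + e), ZN m r (q * j + e + α), ZN m r (q * j + e + α + β))

def idxExt (m r : ℕ) (i : Fin r) (q e d : ℤ) (j : ℕ) :
    (ZMod m ⊕ Fin r) × (ZMod m ⊕ Fin r) × (ZMod m ⊕ Fin r) :=
  (.inr i, ZN m r (q * j + e), ZN m r (q * j + e + d))

theorem idx_exists {m w : ℕ} {q e : ℤ} (hq : 0 < q) (hw : (m : ℤ) = q * w) (hm : 0 < m) {z : ℤ} (hz : z % q = e) :
    ∃ j : Fin w, ∃ t : ℤ, z = q * (j : ℕ) + e + m * t := by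
  have hw' : (0 : ℤ) < w := by
    by_contra hh
    have : (w : ℤ) = 0 := by omega
    rw [this] at hw; omega
  have a1 := Int.emod_nonneg (z / q) (by omega : (w : ℤ) ≠ 0)
  have a2 := Int.emod_lt_of_pos (z / q) hw'
  have a3 := Int.emod_add_mul_ediv z q
  have a4 := Int.emod_add_mul_ediv (z / q) w
  refine ⟨⟨((z / q) % w).toNat, by omega⟩, z / q / w, ?_⟩
  show z = q * ((((z / q) % w).toNat : ℕ) : ℤ) + e + m * (z / q / w)
  rw [Int.toNat_of_nonneg a1, hw]
  linear_combination -a3 - q * a4 + hz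

theorem idxTri_all {m r w : ℕ} {T : ZMod m ⊕ Fin r → ZMod m ⊕ Fin r → ZMod m ⊕ Fin r → Prop}
    {q e α β : ℤ} (hq : 0 < q) (hw : (m : ℤ) = q * w) (hm : 0 < m)
    (h : ∀ j : Fin w, T (idxTri m r q e α β j).1 (idxTri m r q e α β j).2.1 (idxTri m r q e α β j).2.2) :
    ∀ z, z % q = e → T (ZN m r z) (ZN m r (z + α)) (ZN m r (z + α + β)) := by
  intro z hz
  obtain ⟨j, t, ht⟩ := idx_exists hq hw hm hz
  have := h j
  rw [ZN_eq (u := z) (v := q * (j : ℕ) + e) t ht,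
    ZN_eq (u := z + α) (v := q * (j : ℕ) + e + α) t (by rw [ht]; ring),
    ZN_eq (u := z + α + β) (v := q * (j : ℕ) + e + α + β) t (by rw [ht]; ring)]
  exact this

theorem idxExt_all {m r w : ℕ} {T : ZMod m ⊕ Fin r → ZMod m ⊕ Fin r → ZMod m ⊕ Fin r → Prop}
    {q e d : ℤ} {i : Fin r} (hq : 0 < q) (hw : (m : ℤ) = q * w) (hm : 0 < m)
    (h : ∀ j : Fin w, T (idxExt m r i q e d j).1 (idxExt m r i q e d j).2.1 (idxExt m r i q e d j).2.2) :
    ∀ z, z % q = e → T (.inr i) (ZN m r z) (ZN m r (z + d)) := by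
  intro z hz
  obtain ⟨j, t, ht⟩ := idx_exists hq hw hm hz
  have := h j
  rw [ZN_eq (u := z) (v := q * (j : ℕ) + e) t ht,
    ZN_eq (u := z + d) (v := q * (j : ℕ) + e + d) t (by rw [ht]; ring)]
  exact this

/-- triangles invariant under a translation of order three -/
theorem order3_all {m r w : ℕ} {T : ZMod m ⊕ Fin r → ZMod m ⊕ Fin r → ZMod m ⊕ Fin r → Prop}
    (s12 : ∀ u v w, T u v w → T v u w) (s23 : ∀ u v w, T u v w → T u w v)
    (hw : (m : ℤ) = 3 * w) (hm : 0 < m)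
    (h : ∀ j : Fin w, T (idxTri m r 1 0 w w j).1 (idxTri m r 1 0 w w j).2.1 (idxTri m r 1 0 w w j).2.2) :
    ∀ z, z % 1 = 0 → T (ZN m r z) (ZN m r (z + w)) (ZN m r (z + w + w)) := by
  intro z _
  have a1 := Int.emod_nonneg z (by omega : (w : ℤ) ≠ 0)
  have a2 := Int.emod_lt_of_pos z (by omega : (0 : ℤ) < w)
  have a3 := Int.emod_add_mul_ediv z w
  have b1 := Int.emod_nonneg (z / w) (by omega : (3 : ℤ) ≠ 0)
  have b2 := Int.emod_lt_of_pos (z / w) (by omega : (0 : ℤ) < 3)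
  have b3 := Int.emod_add_mul_ediv (z / w) 3
  obtain ⟨b, hb⟩ : ∃ b : ℤ, b = z % w := ⟨_, rfl⟩
  obtain ⟨t, ht⟩ : ∃ t : ℤ, t = z / w / 3 := ⟨_, rfl⟩
  have key : T (ZN m r b) (ZN m r (b + w)) (ZN m r (b + w + w)) := by
    have := h ⟨b.toNat, by omega⟩
    unfold idxTri at this
    simp only at this
    rw [Int.toNat_of_nonneg (by omega)] at this
    exact Tcg this (by ring) (by ring) (by ring)
  have hz : z = b + (z / w % 3) * w + m * t := by
    rw [hw, ht, hb]
    linear_combination -a3 - w * b3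
  have h3 : z / w % 3 = 0 ∨ z / w % 3 = 1 ∨ z / w % 3 = 2 := by omega
  rcases h3 with h3 | h3 | h3 <;> rw [h3] at hz
  · rw [ZN_eq (u := z) (v := b) t (by rw [hz]; ring), ZN_eq (u := z + w) (v := b + w) t (by rw [hz]; ring),
      ZN_eq (u := z + w + w) (v := b + w + w) t (by rw [hz]; ring)]
    exact key
  · rw [ZN_eq (u := z) (v := b + w) t (by rw [hz]; ring),
      ZN_eq (u := z + w) (v := b + w + w) t (by rw [hz]; ring),
      ZN_eq (u := z + w + w) (v := b) (t + 1) (by rw [hz, hw]; ring)]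
    exact s23 _ _ _ (s12 _ _ _ key)
  · rw [ZN_eq (u := z) (v := b + w + w) t (by rw [hz]; ring),
      ZN_eq (u := z + w) (v := b) (t + 1) (by rw [hz, hw]; ring),
      ZN_eq (u := z + w + w) (v := b + w) (t + 1) (by rw [hz, hw]; ring)]
    exact s12 _ _ _ (s23 _ _ _ key)

/-- links of extra vertices with two alternating steps -/
theorem linkX_of_two {m r w : ℕ} (hm : 0 < m) (hw : m = 2 * w)
    {T : ZMod m ⊕ Fin r → ZMod m ⊕ Fin r → ZMod m ⊕ Fin r → Prop} {i : Fin r} {α β d u v : ℤ}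
    (hα : α % 2 = 1) (hs : α + β = 2 * d) (hd : d * u + w * v = 1)
    (h0 : ∀ z, z % 2 = 0 → T (.inr i) (ZN m r z) (ZN m r (z + α)))
    (h1 : ∀ z, z % 2 = 1 → T (.inr i) (ZN m r z) (ZN m r (z + β))) : LinkX m r T i := by
  have hf : ∀ y : ℤ, y % 2 = 0 → ∃ s : ℕ, s < w ∧ ∃ t : ℤ, (s : ℤ) * (2 * d) = y + m * t := by
    intro y hy
    obtain ⟨y, rfl⟩ : ∃ x, y = 2 * x := ⟨y / 2, by omega⟩
    have h1 := Int.emod_nonneg (y * u) (by omega : (w : ℤ) ≠ 0)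
    have h2 := Int.emod_lt_of_pos (y * u) (by omega : (0 : ℤ) < w)
    have h3 := Int.emod_add_mul_ediv (y * u) w
    refine ⟨((y * u) % w).toNat, by omega, -(y * v) - d * (y * u / w), ?_⟩
    rw [Int.toNat_of_nonneg h1, hw]
    push_cast
    linear_combination 2 * d * h3 + 2 * y * hd
  refine ⟨fun j => if j % 2 = 0 then ((j / 2 : ℕ) : ℤ) * (2 * d) else ((j / 2 : ℕ) : ℤ) * (2 * d) + α,
    fun j => ?_, ?_, fun z => ?_⟩
  · obtain ⟨s, rfl | rfl⟩ : ∃ s, j = 2 * s ∨ j = 2 * s + 1 := ⟨j / 2, by omega⟩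
    · simp only [show 2 * s % 2 = 0 by omega, show (2 * s + 1) % 2 = 1 by omega, if_true,
        show 2 * s / 2 = s by omega, show (2 * s + 1) / 2 = s by omega, one_ne_zero, if_false]
      refine h0 _ ?_
      rw [show (s : ℤ) * (2 * d) = 2 * (s * d) by ring]; omega
    · simp only [show (2 * s + 1) % 2 = 1 by omega, show (2 * s + 1 + 1) % 2 = 0 by omega, if_true,
        show (2 * s + 1) / 2 = s by omega, show (2 * s + 1 + 1) / 2 = s + 1 by omega, one_ne_zero,
        if_false]
      have := h1 (s * (2 * d) + α) (by
        rw [show (s : ℤ) * (2 * d) = 2 * (s * d) by ring]; omega)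
      rw [show (s : ℤ) * (2 * d) + α + β = ((s + 1 : ℕ) : ℤ) * (2 * d) by
        push_cast; linear_combination hs] at this
      exact this
  · simp only [hw, show 2 * w % 2 = 0 by omega, if_true, show 2 * w / 2 = w by omega]
    simp only [Nat.zero_mod, if_true, Nat.zero_div]
    refine ZN_eq d ?_
    rw [hw]
    push_cast; ring
  · rcases Int.emod_two_eq_zero_or_one z with hz | hz
    · obtain ⟨s, hs', t, ht⟩ := hf z hz
      refine ⟨2 * s, by omega, ?_⟩
      simp only [show 2 * s % 2 = 0 by omega, if_true, show 2 * s / 2 = s by omega]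
      exact ZN_eq t ht
    · obtain ⟨s, hs', t, ht⟩ := hf (z - α) (by omega)
      refine ⟨2 * s + 1, by omega, ?_⟩
      simp only [show (2 * s + 1) % 2 = 1 by omega, one_ne_zero, if_false,
        show (2 * s + 1) / 2 = s by omega]
      exact ZN_eq t (by rw [ht]; ring)

section
variable {m r : ℕ} (T : ZMod m ⊕ Fin r → ZMod m ⊕ Fin r → ZMod m ⊕ Fin r → Prop)

/-- an edge of the link of `z`, given by displacements -/
abbrev LkE (z u v : ℤ) : Prop := T (ZN m r z) (ZN m r (z + u)) (ZN m r (z + v))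

/-- an arc of the link of `z`, given by displacements -/
abbrev LkA (z u v : ℤ) (n : ℕ) (S : Set (ZMod m ⊕ Fin r)) : Prop :=
  Arc (T (ZN m r z)) (ZN m r (z + u)) (ZN m r (z + v)) n S

/-- an orbit of triangles -/
abbrev OrbT (q e α β : ℤ) : Prop :=
  ∀ z : ℤ, z % q = e → T (ZN m r z) (ZN m r (z + α)) (ZN m r (z + α + β))

/-- an orbit of triangles at an extra vertex -/
abbrev OrbX (i : Fin r) (q e d : ℤ) : Prop :=
  ∀ z : ℤ, z % q = e → T (.inr i) (ZN m r z) (ZN m r (z + d))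
end

theorem Arc.fit {m r : ℕ} {R : ZMod m ⊕ Fin r → ZMod m ⊕ Fin r → Prop} {u v u' v' : ℤ} {n : ℕ}
    {S : Set (ZMod m ⊕ Fin r)} (h : Arc R (ZN m r u) (ZN m r v) n S)
    (hu : u = u' := by omega) (hv : v = v' := by omega) :
    Arc R (ZN m r u') (ZN m r v') n S := h.cgr hu hv

theorem in_left {p q : Prop} (h : p) : p ∨ q := Or.inl h
theorem in_right {p q : Prop} (h : q) : p ∨ q := Or.inr h

theorem in_left4 {p a b c d : Prop} (h : p) : (((p ∨ a) ∨ b) ∨ c) ∨ d :=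
  in_left (in_left (in_left (in_left h)))

theorem mem_iv {m r : ℕ} {S : Set (ZMod m ⊕ Fin r)} {z e : ℤ} {A B : ℤ → Prop} (t : ℤ)
    (h : ∀ p : ℤ, A p → B p → ZN m r (z + p) ∈ S) (h1 : A (e - m * t)) (h2 : B (e - m * t)) :
    ZN m r (z + e) ∈ S := mem_shift t (h _ h1 h2) (by ring)

theorem mem_nd {m r : ℕ} {z p e : ℤ} (t : ℤ) (he : e = p + m * t := by omega) :
    ZN m r (z + e) ∈ ({ZN m r (z + p)} : Set (ZMod m ⊕ Fin r)) := mem_node t he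

section
variable {m r : ℕ} {T : ZMod m ⊕ Fin r → ZMod m ⊕ Fin r → ZMod m ⊕ Fin r → Prop}
  (s12 : ∀ u v w, T u v w → T v u w) (s23 : ∀ u v w, T u v w → T u w v)

include s12 s23

theorem gedge0 {q e α β z p p' : ℤ} (hG : OrbT T q e α β) (t t' : ℤ) (h : z % q = e := by omega)
    (h1 : p = α + m * t := by omega) (h2 : p' = α + β + m * t' := by omega) : LkE T z p p' :=
  (gedge s12 s23 hG z p p' t t').1 h h1 h2

theorem gedge1 {q e α β z p p' : ℤ} (hG : OrbT T q e α β) (t t' : ℤ) (h : (z - α) % q = e := by omega)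
    (h1 : p = -α + m * t := by omega) (h2 : p' = β + m * t' := by omega) : LkE T z p p' :=
  (gedge s12 s23 hG z p p' t t').2.1 h h1 h2

theorem gedge2 {q e α β z p p' : ℤ} (hG : OrbT T q e α β) (t t' : ℤ)
    (h : (z - α - β) % q = e := by omega)
    (h1 : p = -α - β + m * t := by omega) (h2 : p' = -β + m * t' := by omega) : LkE T z p p' :=
  (gedge s12 s23 hG z p p' t t').2.2 h h1 h2

theorem xedge0 {q e d z p : ℤ} {i : Fin r} (hG : OrbX T i q e d) (t : ℤ) (h : z % q = e := by omega)
    (h1 : p = d + m * t := by omega) : T (ZN m r z) (.inr i) (ZN m r (z + p)) :=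
  (xedge s12 s23 hG z p t).1 h h1

theorem xedge1 {q e d z p : ℤ} {i : Fin r} (hG : OrbX T i q e d) (t : ℤ)
    (h : (z - d) % q = e := by omega)
    (h1 : p = -d + m * t := by omega) : T (ZN m r z) (.inr i) (ZN m r (z + p)) :=
  (xedge s12 s23 hG z p t).2 h h1
end

theorem fam1e (j : ℕ) : Good ((12 * j + 13) + 0) := by
  refine good_of_ladder (m := (12 * j + 13)) (r := 0) (L := (2 * j)) (g := 4) (r' := 0) (h := 0) (w := 0) (by omega) (by omega)
    (-6 * j - 5) (-4 * j - 6) (2 * j + 2) (-5 * j - 5) (-5 * j - 5) (9 * j + 11)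
    ![((-6 * j - 5), (-1)), ((-10 * j - 11), (-9 * j - 11)), ((-5 * j - 5), 1), ((3 * j + 3), (3 * j + 3))]
    Fin.elim0
    (fun p => p.1.elim0) ?_ ?_ ?_
  · exact EndData.even (1 * j) (by omega) (by omega) (by omega) (by omega)
  · ring
  intro T s12 s23 hA hG hE hO
  have G0 : OrbT T 1 0 (-6 * j - 5) (-1) := fun z _ => hG 0 z
  have G1 : OrbT T 1 0 (-10 * j - 11) (-9 * j - 11) := fun z _ => hG 1 z
  have G2 : OrbT T 1 0 (-5 * j - 5) 1 := fun z _ => hG 2 z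
  have G3 : OrbT T 1 0 (3 * j + 3) (3 * j + 3) := fun z _ => hG 3 z
  refine ⟨fun z => ?_, ?_⟩
  · obtain ⟨SX, SY, SP, SQ, F⟩ := hA z
    have AX : LkA T z (6 * j + 5) (5 * j + 5) ((2 * j) + 1) SX := F.X.fit
    have AY : LkA T z (-10 * j - 11) (-9 * j - 11) ((2 * j) + 1) SY := F.Y.fit
    have AP : LkA T z (-6 * j - 5) (-5 * j - 5) (2 * (2 * j) + 1) SP := F.P.fit
    have AQ : LkA T z (10 * j + 11) (9 * j + 11) (2 * (2 * j) + 1) SQ := F.Q.fit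
    have E0 : LkE T z (5 * j + 5) 1 := gedge1 s12 s23 G2 0 0
    have E1 : LkE T z 1 (6 * j + 6) := s23 _ _ _ (gedge2 s12 s23 G0 0 0)
    have E2 : LkE T z (6 * j + 6) (3 * j + 3) := s23 _ _ _ (gedge0 s12 s23 G3 0 0)
    have E3 : LkE T z (3 * j + 3) (-3 * j - 3) := s23 _ _ _ (gedge1 s12 s23 G3 0 0)
    have E4 : LkE T z (-3 * j - 3) (-6 * j - 6) := s23 _ _ _ (gedge2 s12 s23 G3 0 0)
    have E5 : LkE T z (-6 * j - 6) (-6 * j - 5) := s23 _ _ _ (gedge0 s12 s23 G0 0 0)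
    have E6 : LkE T z (-5 * j - 5) (19 * j + 22) := gedge0 s12 s23 G2 0 2
    have E7 : LkE T z (19 * j + 22) (9 * j + 11) := gedge2 s12 s23 G1 0 0
    have E8 : LkE T z (10 * j + 11) (-9 * j - 11) := gedge1 s12 s23 G1 0 0
    have E9 : LkE T z (-10 * j - 11) (5 * j + 4) := gedge0 s12 s23 G1 0 2
    have E10 : LkE T z (5 * j + 4) (-1) := gedge2 s12 s23 G2 0 0
    have E11 : LkE T z (-1) (6 * j + 5) := s23 _ _ _ (gedge1 s12 s23 G0 0 0)
    have B0 := AX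
    have B1 := B0.app E0 (Arc.single _)
    have B2 := B1.app E1 (Arc.single _)
    have B3 := B2.app E2 (Arc.single _)
    have B4 := B3.app E3 (Arc.single _)
    have B5 := B4.app E4 (Arc.single _)
    have B6 := B5.app E5 AP
    have B7 := B6.app E6 (Arc.single _)
    have B8 := B7.app E7 (AQ.rev (s23 _))
    have B9 := B8.app E8 (AY.rev (s23 _))
    have B10 := B9.app E9 (Arc.single _)
    have B11 := B10.app E10 (Arc.single _)
    refine ⟨_, _, _, _, B11, E11, by omega, ?_, ?_⟩
    · intro e he0 he1
      by_cases c0 : e ≤ 1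
      · exact in_left (in_left (in_left4 (in_left4 (in_right (mem_nd 0)))))
      by_cases c1 : e ≤ (2 * j + 1)
      · exact in_left (in_left (in_left (in_right (mem_iv 0 F.cQ3 (by omega) (by omega)))))
      by_cases c2 : e ≤ (3 * j + 2)
      · exact in_left (in_left (in_right (mem_iv 1 F.cY1 (by omega) (by omega))))
      by_cases c3 : e ≤ (3 * j + 3)
      · exact in_left4 (in_left4 (in_right (mem_nd 0)))
      by_cases c4 : e ≤ (4 * j + 3)
      · exact in_left (in_left (in_right (mem_iv 1 F.cY2 (by omega) (by omega))))
      by_cases c5 : e ≤ (5 * j + 3)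
      · exact in_left (in_left (in_left (in_left4 (in_left4 (mem_iv 0 F.cX2 (by omega) (by omega))))))
      by_cases c6 : e ≤ (5 * j + 4)
      · exact in_left (in_right (mem_nd 0))
      by_cases c7 : e ≤ (6 * j + 5)
      · exact in_left (in_left (in_left (in_left4 (in_left4 (mem_iv 0 F.cX1 (by omega) (by omega))))))
      by_cases c8 : e ≤ (6 * j + 6)
      · exact in_left (in_left4 (in_left4 (in_right (mem_nd 0))))
      by_cases c9 : e ≤ (6 * j + 7)
      · exact in_left (in_left (in_left4 (in_right (mem_nd 1))))
      by_cases c10 : e ≤ (7 * j + 8)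
      · exact in_left (in_left4 (in_right (mem_iv 1 F.cP1 (by omega) (by omega))))
      by_cases c11 : e ≤ (7 * j + 9)
      · exact in_left4 (in_right (mem_nd (-1)))
      by_cases c12 : e ≤ (8 * j + 9)
      · exact in_left (in_left (in_left (in_right (mem_iv 1 F.cQ2 (by omega) (by omega)))))
      by_cases c13 : e ≤ (9 * j + 9)
      · exact in_left (in_left4 (in_right (mem_iv 0 F.cP2 (by omega) (by omega))))
      by_cases c14 : e ≤ (9 * j + 10)
      · exact in_left (in_left (in_left (in_left4 (in_right (mem_nd 1)))))
      by_cases c15 : e ≤ (10 * j + 11)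
      · exact in_left (in_left (in_left (in_right (mem_iv 0 F.cQ1 (by omega) (by omega)))))
      by_cases c16 : e ≤ (12 * j + 11)
      · exact in_left (in_left4 (in_right (mem_iv 1 F.cP3 (by omega) (by omega))))
      exact in_right (mem_nd 1)
    · exact fun i => i.elim0
  · exact fun i => i.elim0

theorem fam1o (j : ℕ) : Good ((12 * j + 7) + 0) := by
  refine good_of_ladder (m := (12 * j + 7)) (r := 0) (L := (2 * j)) (g := 2) (r' := 0) (h := 0) (w := 0) (by omega) (by omega)
    (-6 * j - 3) (2 * j + 1) (2 * j + 1) (-5 * j - 3) (-5 * j - 3) (3 * j + 2)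
    ![((-6 * j - 3), (4 * j + 2)), ((-5 * j - 3), (2 * j + 1))]
    Fin.elim0
    (fun p => p.1.elim0) ?_ ?_ ?_
  · exact EndData.even (1 * j) (by omega) (by omega) (by omega) (by omega)
  · ring
  intro T s12 s23 hA hG hE hO
  have G0 : OrbT T 1 0 (-6 * j - 3) (4 * j + 2) := fun z _ => hG 0 z
  have G1 : OrbT T 1 0 (-5 * j - 3) (2 * j + 1) := fun z _ => hG 1 z
  refine ⟨fun z => ?_, ?_⟩
  · obtain ⟨SX, SY, SP, SQ, F⟩ := hA z
    have AX : LkA T z (6 * j + 3) (5 * j + 3) ((2 * j) + 1) SX := F.X.fit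
    have AY : LkA T z (-4 * j - 2) (-3 * j - 2) ((2 * j) + 1) SY := F.Y.fit
    have AP : LkA T z (-6 * j - 3) (-5 * j - 3) (2 * (2 * j) + 1) SP := F.P.fit
    have AQ : LkA T z (4 * j + 2) (3 * j + 2) (2 * (2 * j) + 1) SQ := F.Q.fit
    have E0 : LkE T z (5 * j + 3) (2 * j + 1) := gedge1 s12 s23 G1 0 0
    have E1 : LkE T z (2 * j + 1) (-4 * j - 2) := gedge2 s12 s23 G0 0 0
    have E2 : LkE T z (-3 * j - 2) (-5 * j - 3) := s23 _ _ _ (gedge0 s12 s23 G1 0 0)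
    have E3 : LkE T z (-6 * j - 3) (-2 * j - 1) := gedge0 s12 s23 G0 0 0
    have E4 : LkE T z (-2 * j - 1) (3 * j + 2) := s23 _ _ _ (gedge2 s12 s23 G1 0 0)
    have E5 : LkE T z (4 * j + 2) (6 * j + 3) := s23 _ _ _ (gedge1 s12 s23 G0 0 0)
    have B0 := AX
    have B1 := B0.app E0 (Arc.single _)
    have B2 := B1.app E1 AY
    have B3 := B2.app E2 (AP.rev (s23 _))
    have B4 := B3.app E3 (Arc.single _)
    have B5 := B4.app E4 (AQ.rev (s23 _))
    refine ⟨_, _, _, _, B5, E5, by omega, ?_, ?_⟩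
    · intro e he0 he1
      by_cases c0 : e ≤ (2 * j)
      · exact in_right (mem_iv 0 F.cQ3 (by omega) (by omega))
      by_cases c1 : e ≤ (2 * j + 1)
      · exact in_left4 (in_right (mem_nd 0))
      by_cases c2 : e ≤ (3 * j + 1)
      · exact in_left (in_left (in_right (mem_iv 0 F.cP2 (by omega) (by omega))))
      by_cases c3 : e ≤ (4 * j + 2)
      · exact in_right (mem_iv 0 F.cQ1 (by omega) (by omega))
      by_cases c4 : e ≤ (5 * j + 2)
      · exact in_left (in_left4 (mem_iv 0 F.cX2 (by omega) (by omega)))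
      by_cases c5 : e ≤ (6 * j + 3)
      · exact in_left (in_left4 (mem_iv 0 F.cX1 (by omega) (by omega)))
      by_cases c6 : e ≤ (7 * j + 4)
      · exact in_left (in_left (in_right (mem_iv 1 F.cP1 (by omega) (by omega))))
      by_cases c7 : e ≤ (8 * j + 4)
      · exact in_right (mem_iv 1 F.cQ2 (by omega) (by omega))
      by_cases c8 : e ≤ (9 * j + 5)
      · exact in_left (in_left (in_left (in_right (mem_iv 1 F.cY1 (by omega) (by omega)))))
      by_cases c9 : e ≤ (10 * j + 5)
      · exact in_left (in_left (in_left (in_right (mem_iv 1 F.cY2 (by omega) (by omega)))))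
      by_cases c10 : e ≤ (10 * j + 6)
      · exact in_left (in_right (mem_nd 1))
      exact in_left (in_left (in_right (mem_iv 1 F.cP3 (by omega) (by omega))))
    · exact fun i => i.elim0
  · exact fun i => i.elim0

theorem fam3e (j : ℕ) : Good ((12 * j + 14) + 1) := by
  refine good_of_ladder (m := (12 * j + 14)) (r := 1) (L := (2 * j + 1)) (g := 2) (r' := 1) (h := 0) (w := 0) (by omega) (by omega)
    (2 * j + 3) (2 * j + 2) (2 * j + 2) (3 * j + 4) (-5 * j - 6) (3 * j + 4)
    ![((4 * j + 5), (2 * j + 2)), ((3 * j + 4), (2 * j + 2))]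
    ![(0, (2 * j + 3))]
    (fun p => p.1.elim0) ?_ ?_ ?_
  · exact EndData.odd (1 * j) (by omega) (by omega) (by omega) (by omega)
  · ring
  intro T s12 s23 hA hG hE hO
  have G0 : OrbT T 1 0 (4 * j + 5) (2 * j + 2) := fun z _ => hG 0 z
  have G1 : OrbT T 1 0 (3 * j + 4) (2 * j + 2) := fun z _ => hG 1 z
  have X0 : OrbX T 0 1 0 (2 * j + 3) := fun z _ => hE 0 z
  refine ⟨fun z => ?_, ?_⟩
  · obtain ⟨SX, SY, SP, SQ, F⟩ := hA z
    have AX : LkA T z (-2 * j - 3) (-3 * j - 4) ((2 * j + 1) + 1) SX := F.X.fit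
    have AY : LkA T z (4 * j + 5) (5 * j + 6) ((2 * j + 1) + 1) SY := F.Y.fit
    have AP : LkA T z (2 * j + 3) (-5 * j - 6) (2 * (2 * j + 1) + 1) SP := F.P.fit
    have AQ : LkA T z (-4 * j - 5) (3 * j + 4) (2 * (2 * j + 1) + 1) SQ := F.Q.fit
    have E0 : LkE T z (-3 * j - 4) (2 * j + 2) := gedge1 s12 s23 G1 0 0
    have E1 : LkE T z (2 * j + 2) (-4 * j - 5) := s23 _ _ _ (gedge1 s12 s23 G0 0 0)
    have E2 : LkE T z (3 * j + 4) (5 * j + 6) := gedge0 s12 s23 G1 0 0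
    have E3 : LkE T z (4 * j + 5) (-6 * j - 7) := gedge0 s12 s23 G0 0 (-1)
    have E4 : LkE T z (-6 * j - 7) (-2 * j - 2) := gedge2 s12 s23 G0 0 0
    have E5 : LkE T z (-2 * j - 2) (-5 * j - 6) := s23 _ _ _ (gedge2 s12 s23 G1 0 0)
    have E6 : T (ZN (12 * j + 14) 1 z) (ZN (12 * j + 14) 1 (z + (2 * j + 3))) (.inr 0) := s23 _ _ _ (xedge0 s12 s23 X0 0)
    have E7 : T (ZN (12 * j + 14) 1 z) (.inr 0) (ZN (12 * j + 14) 1 (z + (-2 * j - 3))) := xedge1 s12 s23 X0 0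
    have B0 := AX
    have B1 := B0.app E0 (Arc.single _)
    have B2 := B1.app E1 AQ
    have B3 := B2.app E2 (AY.rev (s23 _))
    have B4 := B3.app E3 (Arc.single _)
    have B5 := B4.app E4 (Arc.single _)
    have B6 := B5.app E5 (AP.rev (s23 _))
    have B7 := B6.app E6 (Arc.single _)
    refine ⟨_, _, _, _, B7, E7, by omega, ?_, ?_⟩
    · intro e he0 he1
      by_cases c0 : e ≤ (2 * j + 1)
      · exact in_left (in_left4 (in_right (mem_iv 0 F.cQ3 (by omega) (by omega))))
      by_cases c1 : e ≤ (2 * j + 2)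
      · exact in_left (in_left (in_left4 (in_right (mem_nd 0))))
      by_cases c2 : e ≤ (3 * j + 3)
      · exact in_left (in_right (mem_iv 0 F.cP1 (by omega) (by omega)))
      by_cases c3 : e ≤ (4 * j + 4)
      · exact in_left (in_left4 (in_right (mem_iv 0 F.cQ2 (by omega) (by omega))))
      by_cases c4 : e ≤ (5 * j + 5)
      · exact in_left4 (in_right (mem_iv 0 F.cY1 (by omega) (by omega)))
      by_cases c5 : e ≤ (6 * j + 6)
      · exact in_left4 (in_right (mem_iv 0 F.cY2 (by omega) (by omega)))
      by_cases c6 : e ≤ (6 * j + 7)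
      · exact in_left (in_left (in_left (in_right (mem_nd 1))))
      by_cases c7 : e ≤ (7 * j + 8)
      · exact in_left (in_right (mem_iv 1 F.cP2 (by omega) (by omega)))
      by_cases c8 : e ≤ (8 * j + 9)
      · exact in_left (in_left4 (in_right (mem_iv 1 F.cQ1 (by omega) (by omega))))
      by_cases c9 : e ≤ (9 * j + 10)
      · exact in_left (in_left (in_left (in_left4 (mem_iv 1 F.cX2 (by omega) (by omega)))))
      by_cases c10 : e ≤ (10 * j + 11)
      · exact in_left (in_left (in_left (in_left4 (mem_iv 1 F.cX1 (by omega) (by omega)))))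
      by_cases c11 : e ≤ (10 * j + 12)
      · exact in_left (in_left (in_right (mem_nd 1)))
      exact in_left (in_right (mem_iv 1 F.cP3 (by omega) (by omega)))
    · exact Fin.forall_fin_one.2 (in_right (rfl))
  · exact Fin.forall_fin_one.2 (linkX_of_step (u := ((-9) + (-16) * (j : ℤ)^1 + (-6) * (j : ℤ)^2)) (v := ((2) + (3) * (j : ℤ)^1 + (1) * (j : ℤ)^2)) (by omega) (by push_cast; ring) (fun z => hE 0 z))

theorem fam3o (j : ℕ) : Good ((12 * j + 21) + 0) := by
  refine good_of_ladder (m := (12 * j + 21)) (r := 0) (L := (2 * j + 1)) (g := 3) (r' := 0) (h := 5) (w := (4 * j + 7)) (by omega) (by omega)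
    (2 * j + 4) (2 * j + 3) (2 * j + 3) (3 * j + 6) (-5 * j - 9) (3 * j + 6)
    ![((2 * j + 4), (-4 * j - 7)), ((2 * j + 3), (-5 * j - 8)), ((5 * j + 9), (-1))]
    Fin.elim0
    (fun p => (![idxTri (12 * j + 21) 0 3 0 (3 * j + 6) (-1),
      idxTri (12 * j + 21) 0 3 0 1 (6 * j + 10),
      idxTri (12 * j + 21) 0 3 1 1 (6 * j + 10),
      idxTri (12 * j + 21) 0 3 1 (3 * j + 6) (3 * j + 5),
      idxTri (12 * j + 21) 0 3 2 (3 * j + 6) (3 * j + 5)] : Fin 5 → ℕ → _) p.1 (p.2 : ℕ)) ?_ ?_ ?_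
  · exact EndData.odd (1 * j) (by omega) (by omega) (by omega) (by omega)
  · ring
  intro T s12 s23 hA hG hE hO
  have G0 : OrbT T 1 0 (2 * j + 4) (-4 * j - 7) := fun z _ => hG 0 z
  have G1 : OrbT T 1 0 (2 * j + 3) (-5 * j - 8) := fun z _ => hG 1 z
  have G2 : OrbT T 1 0 (5 * j + 9) (-1) := fun z _ => hG 2 z
  have I0 : OrbT T 3 0 (3 * j + 6) (-1) :=
    idxTri_all (w := (4 * j + 7)) (by omega) (by push_cast; ring) (by omega) (fun t => hO (0, t))
  have I1 : OrbT T 3 0 1 (6 * j + 10) :=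
    idxTri_all (w := (4 * j + 7)) (by omega) (by push_cast; ring) (by omega) (fun t => hO (1, t))
  have I2 : OrbT T 3 1 1 (6 * j + 10) :=
    idxTri_all (w := (4 * j + 7)) (by omega) (by push_cast; ring) (by omega) (fun t => hO (2, t))
  have I3 : OrbT T 3 1 (3 * j + 6) (3 * j + 5) :=
    idxTri_all (w := (4 * j + 7)) (by omega) (by push_cast; ring) (by omega) (fun t => hO (3, t))
  have I4 : OrbT T 3 2 (3 * j + 6) (3 * j + 5) :=
    idxTri_all (w := (4 * j + 7)) (by omega) (by push_cast; ring) (by omega) (fun t => hO (4, t))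
  refine ⟨fun z => ?_, ?_⟩
  · obtain ⟨SX, SY, SP, SQ, F⟩ := hA z
    have AX : LkA T z (-2 * j - 4) (-3 * j - 6) ((2 * j + 1) + 1) SX := F.X.fit
    have AY : LkA T z (4 * j + 7) (5 * j + 9) ((2 * j + 1) + 1) SY := F.Y.fit
    have AP : LkA T z (2 * j + 4) (-5 * j - 9) (2 * (2 * j + 1) + 1) SP := F.P.fit
    have AQ : LkA T z (-4 * j - 7) (3 * j + 6) (2 * (2 * j + 1) + 1) SQ := F.Q.fit
    have hz : z % 3 = 0 ∨ z % 3 = 1 ∨ z % 3 = 2 := by omega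
    rcases hz with hz | hz | hz
    · have hzz := hz
      have E0 : LkE T z (-3 * j - 6) (-1) := gedge1 s12 s23 I0 0 0
      have E1 : LkE T z (-1) (-5 * j - 9) := s23 _ _ _ (gedge1 s12 s23 G2 0 0)
      have E2 : LkE T z (2 * j + 4) (-2 * j - 3) := gedge0 s12 s23 G0 0 0
      have E3 : LkE T z (-2 * j - 3) (-5 * j - 8) := gedge1 s12 s23 G1 0 0
      have E4 : LkE T z (-5 * j - 8) 1 := gedge2 s12 s23 G2 0 0
      have E5 : LkE T z 1 (-6 * j - 10) := gedge0 s12 s23 I1 0 (-1)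
      have E6 : LkE T z (-6 * j - 10) (-6 * j - 11) := s23 _ _ _ (gedge2 s12 s23 I2 0 0)
      have E7 : LkE T z (-6 * j - 11) (-3 * j - 5) := gedge2 s12 s23 I3 0 0
      have E8 : LkE T z (-3 * j - 5) (2 * j + 3) := s23 _ _ _ (gedge0 s12 s23 G1 0 0)
      have E9 : LkE T z (2 * j + 3) (4 * j + 7) := gedge2 s12 s23 G0 0 0
      have E10 : LkE T z (5 * j + 9) (5 * j + 8) := gedge0 s12 s23 G2 0 0
      have E11 : LkE T z (5 * j + 8) (3 * j + 5) := s23 _ _ _ (gedge2 s12 s23 G1 0 0)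
      have E12 : LkE T z (3 * j + 5) (3 * j + 6) := s23 _ _ _ (gedge0 s12 s23 I0 0 0)
      have E13 : LkE T z (-4 * j - 7) (-2 * j - 4) := s23 _ _ _ (gedge1 s12 s23 G0 0 0)
      have B0 := AX
      have B1 := B0.app E0 (Arc.single _)
      have B2 := B1.app E1 (AP.rev (s23 _))
      have B3 := B2.app E2 (Arc.single _)
      have B4 := B3.app E3 (Arc.single _)
      have B5 := B4.app E4 (Arc.single _)
      have B6 := B5.app E5 (Arc.single _)
      have B7 := B6.app E6 (Arc.single _)
      have B8 := B7.app E7 (Arc.single _)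
      have B9 := B8.app E8 (Arc.single _)
      have B10 := B9.app E9 AY
      have B11 := B10.app E10 (Arc.single _)
      have B12 := B11.app E11 (Arc.single _)
      have B13 := B12.app E12 (AQ.rev (s23 _))
      refine ⟨_, _, _, _, B13, E13, by omega, ?_, ?_⟩
      · intro e he0 he1
        by_cases c0 : e ≤ 1
        · exact in_left4 (in_left4 (in_right (mem_nd 0)))
        by_cases c1 : e ≤ (2 * j + 2)
        · exact in_right (mem_iv 0 F.cQ3 (by omega) (by omega))
        by_cases c2 : e ≤ (2 * j + 3)
        · exact in_left4 (in_right (mem_nd 0))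
        by_cases c3 : e ≤ (3 * j + 4)
        · exact in_left (in_left (in_left (in_left4 (in_left4 (in_right (mem_iv 0 F.cP1 (by omega) (by omega)))))))
        by_cases c4 : e ≤ (3 * j + 5)
        · exact in_left (in_right (mem_nd 0))
        by_cases c5 : e ≤ (4 * j + 6)
        · exact in_right (mem_iv 0 F.cQ2 (by omega) (by omega))
        by_cases c6 : e ≤ (5 * j + 7)
        · exact in_left (in_left (in_left (in_right (mem_iv 0 F.cY1 (by omega) (by omega)))))
        by_cases c7 : e ≤ (5 * j + 8)
        · exact in_left (in_left (in_right (mem_nd 0)))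
        by_cases c8 : e ≤ (6 * j + 9)
        · exact in_left (in_left (in_left (in_right (mem_iv 0 F.cY2 (by omega) (by omega)))))
        by_cases c9 : e ≤ (6 * j + 10)
        · exact in_left (in_left (in_left4 (in_right (mem_nd 1))))
        by_cases c10 : e ≤ (6 * j + 11)
        · exact in_left (in_left (in_left (in_left4 (in_right (mem_nd 1)))))
        by_cases c11 : e ≤ (7 * j + 12)
        · exact in_left (in_left (in_left (in_left4 (in_left4 (in_right (mem_iv 1 F.cP2 (by omega) (by omega)))))))
        by_cases c12 : e ≤ (7 * j + 13)
        · exact in_left (in_left4 (in_left4 (in_right (mem_nd 1))))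
        by_cases c13 : e ≤ (8 * j + 14)
        · exact in_right (mem_iv 1 F.cQ1 (by omega) (by omega))
        by_cases c14 : e ≤ (9 * j + 15)
        · exact in_left (in_left4 (in_left4 (in_left4 (mem_iv 1 F.cX2 (by omega) (by omega)))))
        by_cases c15 : e ≤ (9 * j + 16)
        · exact in_left (in_left4 (in_right (mem_nd 1)))
        by_cases c16 : e ≤ (10 * j + 17)
        · exact in_left (in_left4 (in_left4 (in_left4 (mem_iv 1 F.cX1 (by omega) (by omega)))))
        by_cases c17 : e ≤ (10 * j + 18)
        · exact in_left (in_left (in_left4 (in_left4 (in_right (mem_nd 1)))))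
        by_cases c18 : e ≤ (12 * j + 19)
        · exact in_left (in_left (in_left (in_left4 (in_left4 (in_right (mem_iv 1 F.cP3 (by omega) (by omega)))))))
        exact in_left4 (in_left4 (in_left4 (in_right (mem_nd 1))))
      · exact fun i => i.elim0
    · have hzz := hz
      have E0 : LkE T z (-3 * j - 6) (3 * j + 5) := gedge1 s12 s23 I3 0 0
      have E1 : LkE T z (3 * j + 5) (5 * j + 8) := gedge2 s12 s23 G1 0 0
      have E2 : LkE T z (5 * j + 8) (5 * j + 9) := s23 _ _ _ (gedge0 s12 s23 G2 0 0)
      have E3 : LkE T z (4 * j + 7) (2 * j + 3) := s23 _ _ _ (gedge2 s12 s23 G0 0 0)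
      have E4 : LkE T z (2 * j + 3) (-3 * j - 5) := gedge0 s12 s23 G1 0 0
      have E5 : LkE T z (-3 * j - 5) (6 * j + 10) := s23 _ _ _ (gedge2 s12 s23 I4 1 0)
      have E6 : LkE T z (6 * j + 10) (-1) := s23 _ _ _ (gedge1 s12 s23 I1 0 0)
      have E7 : LkE T z (-1) (-5 * j - 9) := s23 _ _ _ (gedge1 s12 s23 G2 0 0)
      have E8 : LkE T z (2 * j + 4) (-2 * j - 3) := gedge0 s12 s23 G0 0 0
      have E9 : LkE T z (-2 * j - 3) (-5 * j - 8) := gedge1 s12 s23 G1 0 0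
      have E10 : LkE T z (-5 * j - 8) 1 := gedge2 s12 s23 G2 0 0
      have E11 : LkE T z 1 (6 * j + 11) := gedge0 s12 s23 I2 0 0
      have E12 : LkE T z (6 * j + 11) (3 * j + 6) := s23 _ _ _ (gedge0 s12 s23 I3 0 0)
      have E13 : LkE T z (-4 * j - 7) (-2 * j - 4) := s23 _ _ _ (gedge1 s12 s23 G0 0 0)
      have B0 := AX
      have B1 := B0.app E0 (Arc.single _)
      have B2 := B1.app E1 (Arc.single _)
      have B3 := B2.app E2 (AY.rev (s23 _))
      have B4 := B3.app E3 (Arc.single _)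
      have B5 := B4.app E4 (Arc.single _)
      have B6 := B5.app E5 (Arc.single _)
      have B7 := B6.app E6 (Arc.single _)
      have B8 := B7.app E7 (AP.rev (s23 _))
      have B9 := B8.app E8 (Arc.single _)
      have B10 := B9.app E9 (Arc.single _)
      have B11 := B10.app E10 (Arc.single _)
      have B12 := B11.app E11 (Arc.single _)
      have B13 := B12.app E12 (AQ.rev (s23 _))
      refine ⟨_, _, _, _, B13, E13, by omega, ?_, ?_⟩
      · intro e he0 he1
        by_cases c0 : e ≤ 1
        · exact in_left (in_left (in_right (mem_nd 0)))
        by_cases c1 : e ≤ (2 * j + 2)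
        · exact in_right (mem_iv 0 F.cQ3 (by omega) (by omega))
        by_cases c2 : e ≤ (2 * j + 3)
        · exact in_left (in_left4 (in_left4 (in_right (mem_nd 0))))
        by_cases c3 : e ≤ (3 * j + 4)
        · exact in_left (in_left4 (in_right (mem_iv 0 F.cP1 (by omega) (by omega))))
        by_cases c4 : e ≤ (3 * j + 5)
        · exact in_left4 (in_left4 (in_left4 (in_right (mem_nd 0))))
        by_cases c5 : e ≤ (4 * j + 6)
        · exact in_right (mem_iv 0 F.cQ2 (by omega) (by omega))
        by_cases c6 : e ≤ (5 * j + 7)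
        · exact in_left (in_left (in_left4 (in_left4 (in_right (mem_iv 0 F.cY1 (by omega) (by omega))))))
        by_cases c7 : e ≤ (5 * j + 8)
        · exact in_left (in_left (in_left (in_left4 (in_left4 (in_right (mem_nd 0))))))
        by_cases c8 : e ≤ (6 * j + 9)
        · exact in_left (in_left (in_left4 (in_left4 (in_right (mem_iv 0 F.cY2 (by omega) (by omega))))))
        by_cases c9 : e ≤ (6 * j + 10)
        · exact in_left (in_left (in_left (in_left4 (in_right (mem_nd 0)))))
        by_cases c10 : e ≤ (6 * j + 11)
        · exact in_left (in_right (mem_nd 0))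
        by_cases c11 : e ≤ (7 * j + 12)
        · exact in_left (in_left4 (in_right (mem_iv 1 F.cP2 (by omega) (by omega))))
        by_cases c12 : e ≤ (7 * j + 13)
        · exact in_left (in_left (in_left (in_right (mem_nd 1))))
        by_cases c13 : e ≤ (8 * j + 14)
        · exact in_right (mem_iv 1 F.cQ1 (by omega) (by omega))
        by_cases c14 : e ≤ (9 * j + 15)
        · exact in_left (in_left4 (in_left4 (in_left4 (mem_iv 1 F.cX2 (by omega) (by omega)))))
        by_cases c15 : e ≤ (9 * j + 16)
        · exact in_left4 (in_left4 (in_right (mem_nd 1)))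
        by_cases c16 : e ≤ (10 * j + 17)
        · exact in_left (in_left4 (in_left4 (in_left4 (mem_iv 1 F.cX1 (by omega) (by omega)))))
        by_cases c17 : e ≤ (10 * j + 18)
        · exact in_left4 (in_right (mem_nd 1))
        by_cases c18 : e ≤ (12 * j + 19)
        · exact in_left (in_left4 (in_right (mem_iv 1 F.cP3 (by omega) (by omega))))
        exact in_left (in_left (in_left4 (in_right (mem_nd 1))))
      · exact fun i => i.elim0
    · have hzz := hz
      have E0 : LkE T z (-3 * j - 6) (3 * j + 5) := gedge1 s12 s23 I4 0 0
      have E1 : LkE T z (3 * j + 5) (5 * j + 8) := gedge2 s12 s23 G1 0 0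
      have E2 : LkE T z (5 * j + 8) (5 * j + 9) := s23 _ _ _ (gedge0 s12 s23 G2 0 0)
      have E3 : LkE T z (4 * j + 7) (2 * j + 3) := s23 _ _ _ (gedge2 s12 s23 G0 0 0)
      have E4 : LkE T z (2 * j + 3) (-3 * j - 5) := gedge0 s12 s23 G1 0 0
      have E5 : LkE T z (-3 * j - 5) 1 := gedge2 s12 s23 I0 0 0
      have E6 : LkE T z 1 (-5 * j - 8) := s23 _ _ _ (gedge2 s12 s23 G2 0 0)
      have E7 : LkE T z (-5 * j - 8) (-2 * j - 3) := s23 _ _ _ (gedge1 s12 s23 G1 0 0)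
      have E8 : LkE T z (-2 * j - 3) (2 * j + 4) := s23 _ _ _ (gedge0 s12 s23 G0 0 0)
      have E9 : LkE T z (-5 * j - 9) (-1) := gedge1 s12 s23 G2 0 0
      have E10 : LkE T z (-1) (-6 * j - 11) := gedge1 s12 s23 I2 0 (-1)
      have E11 : LkE T z (-6 * j - 11) (6 * j + 11) := gedge2 s12 s23 I1 0 1
      have E12 : LkE T z (6 * j + 11) (3 * j + 6) := s23 _ _ _ (gedge0 s12 s23 I4 0 0)
      have E13 : LkE T z (-4 * j - 7) (-2 * j - 4) := s23 _ _ _ (gedge1 s12 s23 G0 0 0)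
      have B0 := AX
      have B1 := B0.app E0 (Arc.single _)
      have B2 := B1.app E1 (Arc.single _)
      have B3 := B2.app E2 (AY.rev (s23 _))
      have B4 := B3.app E3 (Arc.single _)
      have B5 := B4.app E4 (Arc.single _)
      have B6 := B5.app E5 (Arc.single _)
      have B7 := B6.app E6 (Arc.single _)
      have B8 := B7.app E7 (Arc.single _)
      have B9 := B8.app E8 AP
      have B10 := B9.app E9 (Arc.single _)
      have B11 := B10.app E10 (Arc.single _)
      have B12 := B11.app E11 (Arc.single _)
      have B13 := B12.app E12 (AQ.rev (s23 _))
      refine ⟨_, _, _, _, B13, E13, by omega, ?_, ?_⟩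
      · intro e he0 he1
        by_cases c0 : e ≤ 1
        · exact in_left (in_left (in_left (in_left4 (in_right (mem_nd 0)))))
        by_cases c1 : e ≤ (2 * j + 2)
        · exact in_right (mem_iv 0 F.cQ3 (by omega) (by omega))
        by_cases c2 : e ≤ (2 * j + 3)
        · exact in_left (in_left4 (in_left4 (in_right (mem_nd 0))))
        by_cases c3 : e ≤ (3 * j + 4)
        · exact in_left4 (in_right (mem_iv 0 F.cP1 (by omega) (by omega)))
        by_cases c4 : e ≤ (3 * j + 5)
        · exact in_left4 (in_left4 (in_left4 (in_right (mem_nd 0))))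
        by_cases c5 : e ≤ (4 * j + 6)
        · exact in_right (mem_iv 0 F.cQ2 (by omega) (by omega))
        by_cases c6 : e ≤ (5 * j + 7)
        · exact in_left (in_left (in_left4 (in_left4 (in_right (mem_iv 0 F.cY1 (by omega) (by omega))))))
        by_cases c7 : e ≤ (5 * j + 8)
        · exact in_left (in_left (in_left (in_left4 (in_left4 (in_right (mem_nd 0))))))
        by_cases c8 : e ≤ (6 * j + 9)
        · exact in_left (in_left (in_left4 (in_left4 (in_right (mem_iv 0 F.cY2 (by omega) (by omega))))))
        by_cases c9 : e ≤ (6 * j + 10)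
        · exact in_left (in_left (in_right (mem_nd 1)))
        by_cases c10 : e ≤ (6 * j + 11)
        · exact in_left (in_right (mem_nd 0))
        by_cases c11 : e ≤ (7 * j + 12)
        · exact in_left4 (in_right (mem_iv 1 F.cP2 (by omega) (by omega)))
        by_cases c12 : e ≤ (7 * j + 13)
        · exact in_left (in_left (in_left4 (in_right (mem_nd 1))))
        by_cases c13 : e ≤ (8 * j + 14)
        · exact in_right (mem_iv 1 F.cQ1 (by omega) (by omega))
        by_cases c14 : e ≤ (9 * j + 15)
        · exact in_left (in_left4 (in_left4 (in_left4 (mem_iv 1 F.cX2 (by omega) (by omega)))))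
        by_cases c15 : e ≤ (9 * j + 16)
        · exact in_left4 (in_left4 (in_right (mem_nd 1)))
        by_cases c16 : e ≤ (10 * j + 17)
        · exact in_left (in_left4 (in_left4 (in_left4 (mem_iv 1 F.cX1 (by omega) (by omega)))))
        by_cases c17 : e ≤ (10 * j + 18)
        · exact in_left (in_left4 (in_right (mem_nd 1)))
        by_cases c18 : e ≤ (12 * j + 19)
        · exact in_left4 (in_right (mem_iv 1 F.cP3 (by omega) (by omega)))
        exact in_left (in_left (in_left (in_right (mem_nd 1))))
      · exact fun i => i.elim0
  · exact fun i => i.elim0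

theorem fam5e (j : ℕ) : Good ((12 * j + 15) + 2) := by
  refine good_of_ladder (m := (12 * j + 15)) (r := 2) (L := (2 * j)) (g := 4) (r' := 2) (h := 0) (w := 0) (by omega) (by omega)
    (-6 * j - 7) (-4 * j - 5) (2 * j + 2) (-5 * j - 7) (-5 * j - 7) (9 * j + 12)
    ![((-10 * j - 12), (-1)), ((-5 * j - 7), (9 * j + 12)), ((2 * j + 2), (3 * j + 4)), ((3 * j + 4), (5 * j + 6))]
    ![(0, (-6 * j - 7)), (1, 1)]
    (fun p => p.1.elim0) ?_ ?_ ?_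
  · exact EndData.even (1 * j) (by omega) (by omega) (by omega) (by omega)
  · ring
  intro T s12 s23 hA hG hE hO
  have G0 : OrbT T 1 0 (-10 * j - 12) (-1) := fun z _ => hG 0 z
  have G1 : OrbT T 1 0 (-5 * j - 7) (9 * j + 12) := fun z _ => hG 1 z
  have G2 : OrbT T 1 0 (2 * j + 2) (3 * j + 4) := fun z _ => hG 2 z
  have G3 : OrbT T 1 0 (3 * j + 4) (5 * j + 6) := fun z _ => hG 3 z
  have X0 : OrbX T 0 1 0 (-6 * j - 7) := fun z _ => hE 0 z
  have X1 : OrbX T 1 1 0 1 := fun z _ => hE 1 z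
  refine ⟨fun z => ?_, ?_⟩
  · obtain ⟨SX, SY, SP, SQ, F⟩ := hA z
    have AX : LkA T z (6 * j + 7) (5 * j + 7) ((2 * j) + 1) SX := F.X.fit
    have AY : LkA T z (-10 * j - 12) (-9 * j - 12) ((2 * j) + 1) SY := F.Y.fit
    have AP : LkA T z (-6 * j - 7) (-5 * j - 7) (2 * (2 * j) + 1) SP := F.P.fit
    have AQ : LkA T z (10 * j + 12) (9 * j + 12) (2 * (2 * j) + 1) SQ := F.Q.fit
    have E0 : LkE T z (5 * j + 7) (9 * j + 12) := gedge1 s12 s23 G1 0 0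
    have E1 : LkE T z (10 * j + 12) (-1) := gedge1 s12 s23 G0 0 0
    have E2 : T (ZN (12 * j + 15) 2 z) (ZN (12 * j + 15) 2 (z + (-1))) (.inr 1) := s23 _ _ _ (xedge1 s12 s23 X1 0)
    have E3 : T (ZN (12 * j + 15) 2 z) (.inr 1) (ZN (12 * j + 15) 2 (z + 1)) := xedge0 s12 s23 X1 0
    have E4 : LkE T z 1 (-2 * j - 2) := s23 _ _ _ (gedge2 s12 s23 G0 (-1) 0)
    have E5 : LkE T z (-2 * j - 2) (3 * j + 4) := gedge1 s12 s23 G2 0 0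
    have E6 : LkE T z (3 * j + 4) (-4 * j - 5) := gedge0 s12 s23 G3 0 (-1)
    have E7 : LkE T z (-4 * j - 5) (-9 * j - 12) := gedge2 s12 s23 G1 0 0
    have E8 : LkE T z (-10 * j - 12) (2 * j + 2) := gedge0 s12 s23 G0 0 1
    have E9 : LkE T z (2 * j + 2) (5 * j + 6) := gedge0 s12 s23 G2 0 0
    have E10 : LkE T z (5 * j + 6) (-3 * j - 4) := s23 _ _ _ (gedge1 s12 s23 G3 0 0)
    have E11 : LkE T z (-3 * j - 4) (-5 * j - 6) := s23 _ _ _ (gedge2 s12 s23 G2 0 0)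
    have E12 : LkE T z (-5 * j - 6) (4 * j + 5) := s23 _ _ _ (gedge2 s12 s23 G3 1 0)
    have E13 : LkE T z (4 * j + 5) (-5 * j - 7) := s23 _ _ _ (gedge0 s12 s23 G1 0 0)
    have E14 : T (ZN (12 * j + 15) 2 z) (ZN (12 * j + 15) 2 (z + (-6 * j - 7))) (.inr 0) := s23 _ _ _ (xedge0 s12 s23 X0 0)
    have E15 : T (ZN (12 * j + 15) 2 z) (.inr 0) (ZN (12 * j + 15) 2 (z + (6 * j + 7))) := xedge1 s12 s23 X0 0
    have B0 := AX
    have B1 := B0.app E0 (AQ.rev (s23 _))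
    have B2 := B1.app E1 (Arc.single _)
    have B3 := B2.app E2 (Arc.single _)
    have B4 := B3.app E3 (Arc.single _)
    have B5 := B4.app E4 (Arc.single _)
    have B6 := B5.app E5 (Arc.single _)
    have B7 := B6.app E6 (Arc.single _)
    have B8 := B7.app E7 (AY.rev (s23 _))
    have B9 := B8.app E8 (Arc.single _)
    have B10 := B9.app E9 (Arc.single _)
    have B11 := B10.app E10 (Arc.single _)
    have B12 := B11.app E11 (Arc.single _)
    have B13 := B12.app E12 (Arc.single _)
    have B14 := B13.app E13 (AP.rev (s23 _))
    have B15 := B14.app E14 (Arc.single _)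
    refine ⟨_, _, _, _, B15, E15, by omega, ?_, ?_⟩
    · intro e he0 he1
      by_cases c0 : e ≤ 1
      · exact in_left (in_left (in_left (in_left4 (in_left4 (in_right (mem_nd 0))))))
      by_cases c1 : e ≤ (2 * j + 1)
      · exact in_left (in_left (in_left4 (in_left4 (in_left4 (in_right (mem_iv 0 F.cQ3 (by omega) (by omega)))))))
      by_cases c2 : e ≤ (2 * j + 2)
      · exact in_left (in_left (in_left4 (in_right (mem_nd 0))))
      by_cases c3 : e ≤ (3 * j + 3)
      · exact in_left (in_left (in_left (in_left4 (in_right (mem_iv 1 F.cY1 (by omega) (by omega))))))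
      by_cases c4 : e ≤ (3 * j + 4)
      · exact in_left (in_left4 (in_left4 (in_right (mem_nd 0))))
      by_cases c5 : e ≤ (4 * j + 4)
      · exact in_left (in_left (in_left (in_left4 (in_right (mem_iv 1 F.cY2 (by omega) (by omega))))))
      by_cases c6 : e ≤ (4 * j + 5)
      · exact in_left (in_left (in_right (mem_nd 0)))
      by_cases c7 : e ≤ (5 * j + 5)
      · exact in_left (in_left (in_left (in_left4 (in_left4 (in_left4 (mem_iv 0 F.cX2 (by omega) (by omega)))))))
      by_cases c8 : e ≤ (5 * j + 6)
      · exact in_left (in_left4 (in_right (mem_nd 0)))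
      by_cases c9 : e ≤ (6 * j + 7)
      · exact in_left (in_left (in_left (in_left4 (in_left4 (in_left4 (mem_iv 0 F.cX1 (by omega) (by omega)))))))
      by_cases c10 : e ≤ (7 * j + 8)
      · exact in_left (in_right (mem_iv 1 F.cP1 (by omega) (by omega)))
      by_cases c11 : e ≤ (7 * j + 9)
      · exact in_left (in_left (in_left (in_right (mem_nd 1))))
      by_cases c12 : e ≤ (8 * j + 9)
      · exact in_left (in_left (in_left4 (in_left4 (in_left4 (in_right (mem_iv 1 F.cQ2 (by omega) (by omega)))))))
      by_cases c13 : e ≤ (8 * j + 10)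
      · exact in_left4 (in_left4 (in_right (mem_nd 1)))
      by_cases c14 : e ≤ (9 * j + 10)
      · exact in_left (in_right (mem_iv 0 F.cP2 (by omega) (by omega)))
      by_cases c15 : e ≤ (9 * j + 11)
      · exact in_left4 (in_right (mem_nd 1))
      by_cases c16 : e ≤ (10 * j + 12)
      · exact in_left (in_left (in_left4 (in_left4 (in_left4 (in_right (mem_iv 0 F.cQ1 (by omega) (by omega)))))))
      by_cases c17 : e ≤ (10 * j + 13)
      · exact in_left (in_left (in_left4 (in_left4 (in_right (mem_nd 1)))))
      by_cases c18 : e ≤ (12 * j + 13)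
      · exact in_left (in_right (mem_iv 1 F.cP3 (by omega) (by omega)))
      exact in_left (in_left4 (in_left4 (in_left4 (in_right (mem_nd 1)))))
    · exact Fin.forall_fin_two.2 ⟨in_right (rfl), in_left4 (in_left4 (in_left4 (in_right (rfl))))⟩
  · exact Fin.forall_fin_two.2 ⟨linkX_of_step (u := ((2))) (v := ((1))) (by omega) (by push_cast; ring) (fun z => hE 0 z),
      linkX_of_step (u := ((1))) (v := 0) (by omega) (by push_cast; ring) (fun z => hE 1 z)⟩

theorem fam5o (j : ℕ) : Good ((12 * j + 21) + 2) := by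
  refine good_of_ladder (m := (12 * j + 21)) (r := 2) (L := (2 * j + 1)) (g := 4) (r' := 2) (h := 0) (w := 0) (by omega) (by omega)
    (-6 * j - 10) (2 * j + 3) (2 * j + 3) (-5 * j - 8) (3 * j + 5) (-5 * j - 8)
    ![((-4 * j - 7), (2 * j + 3)), ((-5 * j - 8), (-5 * j - 9)), ((-3 * j - 5), (-1)), ((2 * j + 3), (3 * j + 6))]
    ![(0, (-6 * j - 10)), (1, 1)]
    (fun p => p.1.elim0) ?_ ?_ ?_
  · exact EndData.odd (1 * j) (by omega) (by omega) (by omega) (by omega)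
  · ring
  intro T s12 s23 hA hG hE hO
  have G0 : OrbT T 1 0 (-4 * j - 7) (2 * j + 3) := fun z _ => hG 0 z
  have G1 : OrbT T 1 0 (-5 * j - 8) (-5 * j - 9) := fun z _ => hG 1 z
  have G2 : OrbT T 1 0 (-3 * j - 5) (-1) := fun z _ => hG 2 z
  have G3 : OrbT T 1 0 (2 * j + 3) (3 * j + 6) := fun z _ => hG 3 z
  have X0 : OrbX T 0 1 0 (-6 * j - 10) := fun z _ => hE 0 z
  have X1 : OrbX T 1 1 0 1 := fun z _ => hE 1 z
  refine ⟨fun z => ?_, ?_⟩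
  · obtain ⟨SX, SY, SP, SQ, F⟩ := hA z
    have AX : LkA T z (6 * j + 10) (5 * j + 8) ((2 * j + 1) + 1) SX := F.X.fit
    have AY : LkA T z (-4 * j - 7) (-3 * j - 5) ((2 * j + 1) + 1) SY := F.Y.fit
    have AP : LkA T z (-6 * j - 10) (3 * j + 5) (2 * (2 * j + 1) + 1) SP := F.P.fit
    have AQ : LkA T z (4 * j + 7) (-5 * j - 8) (2 * (2 * j + 1) + 1) SQ := F.Q.fit
    have E0 : LkE T z (5 * j + 8) (-5 * j - 9) := gedge1 s12 s23 G1 0 0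
    have E1 : LkE T z (-5 * j - 9) (-3 * j - 6) := gedge2 s12 s23 G3 0 0
    have E2 : LkE T z (-3 * j - 6) (-3 * j - 5) := s23 _ _ _ (gedge0 s12 s23 G2 0 0)
    have E3 : LkE T z (-4 * j - 7) (10 * j + 17) := gedge0 s12 s23 G0 0 1
    have E4 : LkE T z (10 * j + 17) (5 * j + 9) := gedge2 s12 s23 G1 0 0
    have E5 : LkE T z (5 * j + 9) (2 * j + 3) := s23 _ _ _ (gedge0 s12 s23 G3 0 0)
    have E6 : LkE T z (2 * j + 3) (4 * j + 7) := s23 _ _ _ (gedge1 s12 s23 G0 0 0)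
    have E7 : LkE T z (-5 * j - 8) (2 * j + 4) := gedge0 s12 s23 G1 0 1
    have E8 : LkE T z (2 * j + 4) (-2 * j - 3) := gedge2 s12 s23 G0 0 0
    have E9 : LkE T z (-2 * j - 3) (3 * j + 6) := gedge1 s12 s23 G3 0 0
    have E10 : LkE T z (3 * j + 6) 1 := gedge2 s12 s23 G2 0 0
    have E11 : T (ZN (12 * j + 21) 2 z) (ZN (12 * j + 21) 2 (z + 1)) (.inr 1) := s23 _ _ _ (xedge0 s12 s23 X1 0)
    have E12 : T (ZN (12 * j + 21) 2 z) (.inr 1) (ZN (12 * j + 21) 2 (z + (-1))) := xedge1 s12 s23 X1 0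
    have E13 : LkE T z (-1) (3 * j + 5) := s23 _ _ _ (gedge1 s12 s23 G2 0 0)
    have E14 : T (ZN (12 * j + 21) 2 z) (ZN (12 * j + 21) 2 (z + (-6 * j - 10))) (.inr 0) := s23 _ _ _ (xedge0 s12 s23 X0 0)
    have E15 : T (ZN (12 * j + 21) 2 z) (.inr 0) (ZN (12 * j + 21) 2 (z + (6 * j + 10))) := xedge1 s12 s23 X0 0
    have B0 := AX
    have B1 := B0.app E0 (Arc.single _)
    have B2 := B1.app E1 (Arc.single _)
    have B3 := B2.app E2 (AY.rev (s23 _))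
    have B4 := B3.app E3 (Arc.single _)
    have B5 := B4.app E4 (Arc.single _)
    have B6 := B5.app E5 (Arc.single _)
    have B7 := B6.app E6 AQ
    have B8 := B7.app E7 (Arc.single _)
    have B9 := B8.app E8 (Arc.single _)
    have B10 := B9.app E9 (Arc.single _)
    have B11 := B10.app E10 (Arc.single _)
    have B12 := B11.app E11 (Arc.single _)
    have B13 := B12.app E12 (Arc.single _)
    have B14 := B13.app E13 (AP.rev (s23 _))
    have B15 := B14.app E14 (Arc.single _)
    refine ⟨_, _, _, _, B15, E15, by omega, ?_, ?_⟩
    · intro e he0 he1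
      by_cases c0 : e ≤ 1
      · exact in_left4 (in_right (mem_nd 0))
      by_cases c1 : e ≤ (2 * j + 2)
      · exact in_left4 (in_left4 (in_right (mem_iv 0 F.cQ3 (by omega) (by omega))))
      by_cases c2 : e ≤ (2 * j + 3)
      · exact in_left (in_left4 (in_left4 (in_right (mem_nd 0))))
      by_cases c3 : e ≤ (2 * j + 4)
      · exact in_left (in_left (in_left (in_left4 (in_right (mem_nd 0)))))
      by_cases c4 : e ≤ (3 * j + 5)
      · exact in_left (in_right (mem_iv 0 F.cP2 (by omega) (by omega)))
      by_cases c5 : e ≤ (3 * j + 6)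
      · exact in_left (in_left4 (in_right (mem_nd 0)))
      by_cases c6 : e ≤ (4 * j + 7)
      · exact in_left4 (in_left4 (in_right (mem_iv 0 F.cQ1 (by omega) (by omega))))
      by_cases c7 : e ≤ (5 * j + 8)
      · exact in_left (in_left (in_left (in_left4 (in_left4 (in_left4 (mem_iv 0 F.cX2 (by omega) (by omega)))))))
      by_cases c8 : e ≤ (5 * j + 9)
      · exact in_left (in_left (in_left4 (in_left4 (in_right (mem_nd 0)))))
      by_cases c9 : e ≤ (6 * j + 10)
      · exact in_left (in_left (in_left (in_left4 (in_left4 (in_left4 (mem_iv 0 F.cX1 (by omega) (by omega)))))))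
      by_cases c10 : e ≤ (7 * j + 11)
      · exact in_left (in_right (mem_iv 1 F.cP1 (by omega) (by omega)))
      by_cases c11 : e ≤ (7 * j + 12)
      · exact in_left (in_left (in_left4 (in_left4 (in_left4 (in_right (mem_nd 1))))))
      by_cases c12 : e ≤ (8 * j + 13)
      · exact in_left4 (in_left4 (in_right (mem_iv 1 F.cQ2 (by omega) (by omega))))
      by_cases c13 : e ≤ (9 * j + 14)
      · exact in_left4 (in_left4 (in_left4 (in_right (mem_iv 1 F.cY1 (by omega) (by omega)))))
      by_cases c14 : e ≤ (9 * j + 15)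
      · exact in_left (in_left4 (in_left4 (in_left4 (in_right (mem_nd 1)))))
      by_cases c15 : e ≤ (10 * j + 16)
      · exact in_left4 (in_left4 (in_left4 (in_right (mem_iv 1 F.cY2 (by omega) (by omega)))))
      by_cases c16 : e ≤ (10 * j + 17)
      · exact in_left (in_left (in_left (in_left4 (in_left4 (in_right (mem_nd 0))))))
      by_cases c17 : e ≤ (10 * j + 18)
      · exact in_left (in_left (in_left4 (in_right (mem_nd 1))))
      by_cases c18 : e ≤ (12 * j + 19)
      · exact in_left (in_right (mem_iv 1 F.cP3 (by omega) (by omega)))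
      exact in_left (in_left (in_right (mem_nd 1)))
    · exact Fin.forall_fin_two.2 ⟨in_right (rfl), in_left (in_left (in_left (in_right (rfl))))⟩
  · exact Fin.forall_fin_two.2 ⟨linkX_of_step (u := ((2))) (v := ((1))) (by omega) (by push_cast; ring) (fun z => hE 0 z),
      linkX_of_step (u := ((1))) (v := 0) (by omega) (by push_cast; ring) (fun z => hE 1 z)⟩

theorem fam4e (j : ℕ) : Good ((12 * j + 16) + 0) := by
  refine good_of_ladder (m := (12 * j + 16)) (r := 0) (L := (2 * j + 1)) (g := 3) (r' := 0) (h := 0) (w := 0) (by omega) (by omega)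
    (-6 * j - 7) (-4 * j - 6) (2 * j + 2) (-5 * j - 6) (9 * j + 12) (-5 * j - 6)
    ![((-6 * j - 7), (4 * j + 5)), ((-10 * j - 13), (4 * j + 5)), ((-5 * j - 6), (-9 * j - 12))]
    Fin.elim0
    (fun p => p.1.elim0) ?_ ?_ ?_
  · exact EndData.odd (1 * j) (by omega) (by omega) (by omega) (by omega)
  · ring
  intro T s12 s23 hA hG hE hO
  have G0 : OrbT T 1 0 (-6 * j - 7) (4 * j + 5) := fun z _ => hG 0 z
  have G1 : OrbT T 1 0 (-10 * j - 13) (4 * j + 5) := fun z _ => hG 1 z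
  have G2 : OrbT T 1 0 (-5 * j - 6) (-9 * j - 12) := fun z _ => hG 2 z
  refine ⟨fun z => ?_, ?_⟩
  · obtain ⟨SX, SY, SP, SQ, F⟩ := hA z
    have AX : LkA T z (6 * j + 7) (5 * j + 6) ((2 * j + 1) + 1) SX := F.X.fit
    have AY : LkA T z (-10 * j - 13) (-9 * j - 12) ((2 * j + 1) + 1) SY := F.Y.fit
    have AP : LkA T z (-6 * j - 7) (9 * j + 12) (2 * (2 * j + 1) + 1) SP := F.P.fit
    have AQ : LkA T z (10 * j + 13) (-5 * j - 6) (2 * (2 * j + 1) + 1) SQ := F.Q.fit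
    have E0 : LkE T z (5 * j + 6) (-9 * j - 12) := gedge1 s12 s23 G2 0 0
    have E1 : LkE T z (-10 * j - 13) (6 * j + 8) := gedge0 s12 s23 G1 0 1
    have E2 : LkE T z (6 * j + 8) (-4 * j - 5) := gedge2 s12 s23 G1 0 0
    have E3 : LkE T z (-4 * j - 5) (14 * j + 18) := s23 _ _ _ (gedge2 s12 s23 G0 1 0)
    have E4 : LkE T z (14 * j + 18) (9 * j + 12) := gedge2 s12 s23 G2 0 0
    have E5 : LkE T z (-6 * j - 7) (-14 * j - 18) := gedge0 s12 s23 G0 0 (-1)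
    have E6 : LkE T z (-14 * j - 18) (-5 * j - 6) := s23 _ _ _ (gedge0 s12 s23 G2 0 0)
    have E7 : LkE T z (10 * j + 13) (4 * j + 5) := gedge1 s12 s23 G1 0 0
    have E8 : LkE T z (4 * j + 5) (6 * j + 7) := s23 _ _ _ (gedge1 s12 s23 G0 0 0)
    have B0 := AX
    have B1 := B0.app E0 (AY.rev (s23 _))
    have B2 := B1.app E1 (Arc.single _)
    have B3 := B2.app E2 (Arc.single _)
    have B4 := B3.app E3 (Arc.single _)
    have B5 := B4.app E4 (AP.rev (s23 _))
    have B6 := B5.app E5 (Arc.single _)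
    have B7 := B6.app E6 (AQ.rev (s23 _))
    have B8 := B7.app E7 (Arc.single _)
    refine ⟨_, _, _, _, B8, E8, by omega, ?_, ?_⟩
    · intro e he0 he1
      by_cases c0 : e ≤ (2 * j + 1)
      · exact in_left (in_right (mem_iv 0 F.cQ3 (by omega) (by omega)))
      by_cases c1 : e ≤ (2 * j + 2)
      · exact in_left4 (in_right (mem_nd (-1)))
      by_cases c2 : e ≤ (3 * j + 3)
      · exact in_left (in_left (in_left (in_left4 (in_right (mem_iv 1 F.cY1 (by omega) (by omega))))))
      by_cases c3 : e ≤ (4 * j + 4)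
      · exact in_left (in_left (in_left (in_left4 (in_right (mem_iv 1 F.cY2 (by omega) (by omega))))))
      by_cases c4 : e ≤ (4 * j + 5)
      · exact in_right (mem_nd 0)
      by_cases c5 : e ≤ (5 * j + 6)
      · exact in_left4 (in_left4 (mem_iv 0 F.cX2 (by omega) (by omega)))
      by_cases c6 : e ≤ (6 * j + 7)
      · exact in_left4 (in_left4 (mem_iv 0 F.cX1 (by omega) (by omega)))
      by_cases c7 : e ≤ (6 * j + 8)
      · exact in_left (in_left (in_left4 (in_right (mem_nd 0))))
      by_cases c8 : e ≤ (7 * j + 9)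
      · exact in_left (in_left (in_left (in_right (mem_iv 1 F.cP1 (by omega) (by omega)))))
      by_cases c9 : e ≤ (8 * j + 10)
      · exact in_left (in_right (mem_iv 1 F.cQ2 (by omega) (by omega)))
      by_cases c10 : e ≤ (8 * j + 11)
      · exact in_left (in_left4 (in_right (mem_nd 1)))
      by_cases c11 : e ≤ (9 * j + 12)
      · exact in_left (in_left (in_left (in_right (mem_iv 0 F.cP2 (by omega) (by omega)))))
      by_cases c12 : e ≤ (10 * j + 13)
      · exact in_left (in_right (mem_iv 0 F.cQ1 (by omega) (by omega)))
      by_cases c13 : e ≤ (10 * j + 14)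
      · exact in_left (in_left (in_right (mem_nd 2)))
      exact in_left (in_left (in_left (in_right (mem_iv 1 F.cP3 (by omega) (by omega)))))
    · exact fun i => i.elim0
  · exact fun i => i.elim0

theorem fam4o (j : ℕ) : Good ((12 * j + 9) + 1) := by
  refine good_of_ladder (m := (12 * j + 9)) (r := 1) (L := (2 * j)) (g := 2) (r' := 1) (h := 1) (w := (4 * j + 3)) (by omega) (by omega)
    (-6 * j - 4) (2 * j + 2) (2 * j + 1) (-5 * j - 4) (-5 * j - 4) (3 * j + 2)
    ![((-4 * j - 2), (2 * j + 1)), ((-5 * j - 4), (-3 * j - 2))]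
    ![(0, (-6 * j - 4))]
    (fun p => (![idxTri (12 * j + 9) 1 1 0 (((4 * j + 3) : ℕ) : ℤ) (((4 * j + 3) : ℕ) : ℤ)] : Fin 1 → ℕ → _) p.1 (p.2 : ℕ)) ?_ ?_ ?_
  · exact EndData.even (1 * j) (by omega) (by omega) (by omega) (by omega)
  · ring
  intro T s12 s23 hA hG hE hO
  have G0 : OrbT T 1 0 (-4 * j - 2) (2 * j + 1) := fun z _ => hG 0 z
  have G1 : OrbT T 1 0 (-5 * j - 4) (-3 * j - 2) := fun z _ => hG 1 z
  have X0 : OrbX T 0 1 0 (-6 * j - 4) := fun z _ => hE 0 z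
  have O := order3_all (w := (4 * j + 3)) s12 s23 (by push_cast; ring) (by omega) (fun t => hO (0, t))
  refine ⟨fun z => ?_, ?_⟩
  · obtain ⟨SX, SY, SP, SQ, F⟩ := hA z
    have AX : LkA T z (6 * j + 4) (5 * j + 4) ((2 * j) + 1) SX := F.X.fit
    have AY : LkA T z (-4 * j - 2) (-3 * j - 2) ((2 * j) + 1) SY := F.Y.fit
    have AP : LkA T z (-6 * j - 4) (-5 * j - 4) (2 * (2 * j) + 1) SP := F.P.fit
    have AQ : LkA T z (4 * j + 2) (3 * j + 2) (2 * (2 * j) + 1) SQ := F.Q.fit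
    have E0 : LkE T z (5 * j + 4) (-3 * j - 2) := gedge1 s12 s23 G1 0 0
    have E1 : LkE T z (-4 * j - 2) (-2 * j - 1) := gedge0 s12 s23 G0 0 0
    have E2 : LkE T z (-2 * j - 1) (2 * j + 1) := s23 _ _ _ (gedge2 s12 s23 G0 0 0)
    have E3 : LkE T z (2 * j + 1) (4 * j + 2) := s23 _ _ _ (gedge1 s12 s23 G0 0 0)
    have E4 : LkE T z (3 * j + 2) (8 * j + 6) := s23 _ _ _ (gedge2 s12 s23 G1 0 0)
    have E5 : LkE T z (8 * j + 6) (-8 * j - 6) := s23 _ _ _ (gedge0 s12 s23 O (-1) 0)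
    have E6 : LkE T z (-8 * j - 6) (-5 * j - 4) := s23 _ _ _ (gedge0 s12 s23 G1 0 0)
    have E7 : T (ZN (12 * j + 9) 1 z) (ZN (12 * j + 9) 1 (z + (-6 * j - 4))) (.inr 0) := s23 _ _ _ (xedge0 s12 s23 X0 0)
    have E8 : T (ZN (12 * j + 9) 1 z) (.inr 0) (ZN (12 * j + 9) 1 (z + (6 * j + 4))) := xedge1 s12 s23 X0 0
    have B0 := AX
    have B1 := B0.app E0 (AY.rev (s23 _))
    have B2 := B1.app E1 (Arc.single _)
    have B3 := B2.app E2 (Arc.single _)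
    have B4 := B3.app E3 AQ
    have B5 := B4.app E4 (Arc.single _)
    have B6 := B5.app E5 (Arc.single _)
    have B7 := B6.app E6 (AP.rev (s23 _))
    have B8 := B7.app E7 (Arc.single _)
    refine ⟨_, _, _, _, B8, E8, by omega, ?_, ?_⟩
    · intro e he0 he1
      by_cases c0 : e ≤ (2 * j)
      · exact in_left4 (in_right (mem_iv 0 F.cQ3 (by omega) (by omega)))
      by_cases c1 : e ≤ (2 * j + 1)
      · exact in_left (in_left4 (in_right (mem_nd 0)))
      by_cases c2 : e ≤ (3 * j + 1)
      · exact in_left (in_right (mem_iv 0 F.cP2 (by omega) (by omega)))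
      by_cases c3 : e ≤ (4 * j + 2)
      · exact in_left4 (in_right (mem_iv 0 F.cQ1 (by omega) (by omega)))
      by_cases c4 : e ≤ (4 * j + 3)
      · exact in_left (in_left (in_right (mem_nd 1)))
      by_cases c5 : e ≤ (5 * j + 3)
      · exact in_left4 (in_left4 (mem_iv 0 F.cX2 (by omega) (by omega)))
      by_cases c6 : e ≤ (6 * j + 4)
      · exact in_left4 (in_left4 (mem_iv 0 F.cX1 (by omega) (by omega)))
      by_cases c7 : e ≤ (7 * j + 5)
      · exact in_left (in_right (mem_iv 1 F.cP1 (by omega) (by omega)))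
      by_cases c8 : e ≤ (8 * j + 5)
      · exact in_left4 (in_right (mem_iv 1 F.cQ2 (by omega) (by omega)))
      by_cases c9 : e ≤ (8 * j + 6)
      · exact in_left (in_left (in_left (in_right (mem_nd 0))))
      by_cases c10 : e ≤ (9 * j + 7)
      · exact in_left (in_left (in_left (in_left4 (in_right (mem_iv 1 F.cY1 (by omega) (by omega))))))
      by_cases c11 : e ≤ (10 * j + 7)
      · exact in_left (in_left (in_left (in_left4 (in_right (mem_iv 1 F.cY2 (by omega) (by omega))))))
      by_cases c12 : e ≤ (10 * j + 8)
      · exact in_left (in_left (in_left4 (in_right (mem_nd 1))))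
      exact in_left (in_right (mem_iv 1 F.cP3 (by omega) (by omega)))
    · exact Fin.forall_fin_one.2 (in_right (rfl))
  · exact Fin.forall_fin_one.2 (linkX_of_step (u := ((2))) (v := ((1))) (by omega) (by push_cast; ring) (fun z => hE 0 z))

theorem fam6e (j : ℕ) : Good ((12 * j + 5) + 1) := by
  refine good_of_ladder (m := (12 * j + 5)) (r := 1) (L := (2 * j)) (g := 1) (r' := 1) (h := 0) (w := 0) (by omega) (by omega)
    (2 * j + 1) (2 * j + 1) (2 * j + 1) (3 * j + 1) (3 * j + 1) (-5 * j - 2)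
    ![((2 * j + 1), (3 * j + 1))]
    ![(0, (4 * j + 2))]
    (fun p => p.1.elim0) ?_ ?_ ?_
  · exact EndData.even (1 * j) (by omega) (by omega) (by omega) (by omega)
  · ring
  intro T s12 s23 hA hG hE hO
  have G0 : OrbT T 1 0 (2 * j + 1) (3 * j + 1) := fun z _ => hG 0 z
  have X0 : OrbX T 0 1 0 (4 * j + 2) := fun z _ => hE 0 z
  refine ⟨fun z => ?_, ?_⟩
  · obtain ⟨SX, SY, SP, SQ, F⟩ := hA z
    have AX : LkA T z (-2 * j - 1) (-3 * j - 1) ((2 * j) + 1) SX := F.X.fit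
    have AY : LkA T z (4 * j + 2) (5 * j + 2) ((2 * j) + 1) SY := F.Y.fit
    have AP : LkA T z (2 * j + 1) (3 * j + 1) (2 * (2 * j) + 1) SP := F.P.fit
    have AQ : LkA T z (-4 * j - 2) (-5 * j - 2) (2 * (2 * j) + 1) SQ := F.Q.fit
    have E0 : LkE T z (-3 * j - 1) (-5 * j - 2) := s23 _ _ _ (gedge2 s12 s23 G0 0 0)
    have E1 : T (ZN (12 * j + 5) 1 z) (ZN (12 * j + 5) 1 (z + (-4 * j - 2))) (.inr 0) := s23 _ _ _ (xedge1 s12 s23 X0 0)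
    have E2 : T (ZN (12 * j + 5) 1 z) (.inr 0) (ZN (12 * j + 5) 1 (z + (4 * j + 2))) := xedge0 s12 s23 X0 0
    have E3 : LkE T z (5 * j + 2) (2 * j + 1) := s23 _ _ _ (gedge0 s12 s23 G0 0 0)
    have E4 : LkE T z (3 * j + 1) (-2 * j - 1) := s23 _ _ _ (gedge1 s12 s23 G0 0 0)
    have B0 := AX
    have B1 := B0.app E0 (AQ.rev (s23 _))
    have B2 := B1.app E1 (Arc.single _)
    have B3 := B2.app E2 AY
    have B4 := B3.app E3 AP
    refine ⟨_, _, _, _, B4, E4, by omega, ?_, ?_⟩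
    · intro e he0 he1
      by_cases c0 : e ≤ (2 * j)
      · exact in_left (in_left (in_left (in_right (mem_iv 0 F.cQ3 (by omega) (by omega)))))
      by_cases c1 : e ≤ (3 * j + 1)
      · exact in_right (mem_iv 0 F.cP1 (by omega) (by omega))
      by_cases c2 : e ≤ (4 * j + 1)
      · exact in_left (in_left (in_left (in_right (mem_iv 0 F.cQ2 (by omega) (by omega)))))
      by_cases c3 : e ≤ (5 * j + 2)
      · exact in_left (in_right (mem_iv 0 F.cY1 (by omega) (by omega)))
      by_cases c4 : e ≤ (6 * j + 2)
      · exact in_left (in_right (mem_iv 0 F.cY2 (by omega) (by omega)))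
      by_cases c5 : e ≤ (7 * j + 2)
      · exact in_right (mem_iv 1 F.cP2 (by omega) (by omega))
      by_cases c6 : e ≤ (8 * j + 3)
      · exact in_left (in_left (in_left (in_right (mem_iv 1 F.cQ1 (by omega) (by omega)))))
      by_cases c7 : e ≤ (9 * j + 3)
      · exact in_left4 (mem_iv 1 F.cX2 (by omega) (by omega))
      by_cases c8 : e ≤ (10 * j + 4)
      · exact in_left4 (mem_iv 1 F.cX1 (by omega) (by omega))
      exact in_right (mem_iv 1 F.cP3 (by omega) (by omega))
    · exact Fin.forall_fin_one.2 (in_left (in_left (in_right (rfl))))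
  · exact Fin.forall_fin_one.2 (linkX_of_step (u := ((3))) (v := ((-1))) (by omega) (by push_cast; ring) (fun z => hE 0 z))

theorem fam6o (j : ℕ) : Good ((12 * j + 11) + 1) := by
  refine good_of_ladder (m := (12 * j + 11)) (r := 1) (L := (2 * j + 1)) (g := 1) (r' := 1) (h := 0) (w := 0) (by omega) (by omega)
    (2 * j + 2) (2 * j + 2) (2 * j + 2) (3 * j + 3) (-5 * j - 5) (3 * j + 3)
    ![((2 * j + 2), (3 * j + 3))]
    ![(0, (4 * j + 4))]
    (fun p => p.1.elim0) ?_ ?_ ?_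
  · exact EndData.odd (1 * j) (by omega) (by omega) (by omega) (by omega)
  · ring
  intro T s12 s23 hA hG hE hO
  have G0 : OrbT T 1 0 (2 * j + 2) (3 * j + 3) := fun z _ => hG 0 z
  have X0 : OrbX T 0 1 0 (4 * j + 4) := fun z _ => hE 0 z
  refine ⟨fun z => ?_, ?_⟩
  · obtain ⟨SX, SY, SP, SQ, F⟩ := hA z
    have AX : LkA T z (-2 * j - 2) (-3 * j - 3) ((2 * j + 1) + 1) SX := F.X.fit
    have AY : LkA T z (4 * j + 4) (5 * j + 5) ((2 * j + 1) + 1) SY := F.Y.fit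
    have AP : LkA T z (2 * j + 2) (-5 * j - 5) (2 * (2 * j + 1) + 1) SP := F.P.fit
    have AQ : LkA T z (-4 * j - 4) (3 * j + 3) (2 * (2 * j + 1) + 1) SQ := F.Q.fit
    have E0 : LkE T z (-3 * j - 3) (-5 * j - 5) := s23 _ _ _ (gedge2 s12 s23 G0 0 0)
    have E1 : LkE T z (2 * j + 2) (5 * j + 5) := gedge0 s12 s23 G0 0 0
    have E2 : T (ZN (12 * j + 11) 1 z) (ZN (12 * j + 11) 1 (z + (4 * j + 4))) (.inr 0) := s23 _ _ _ (xedge0 s12 s23 X0 0)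
    have E3 : T (ZN (12 * j + 11) 1 z) (.inr 0) (ZN (12 * j + 11) 1 (z + (-4 * j - 4))) := xedge1 s12 s23 X0 0
    have E4 : LkE T z (3 * j + 3) (-2 * j - 2) := s23 _ _ _ (gedge1 s12 s23 G0 0 0)
    have B0 := AX
    have B1 := B0.app E0 (AP.rev (s23 _))
    have B2 := B1.app E1 (AY.rev (s23 _))
    have B3 := B2.app E2 (Arc.single _)
    have B4 := B3.app E3 AQ
    refine ⟨_, _, _, _, B4, E4, by omega, ?_, ?_⟩
    · intro e he0 he1
      by_cases c0 : e ≤ (2 * j + 1)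
      · exact in_right (mem_iv 0 F.cQ3 (by omega) (by omega))
      by_cases c1 : e ≤ (3 * j + 2)
      · exact in_left (in_left (in_left (in_right (mem_iv 0 F.cP1 (by omega) (by omega)))))
      by_cases c2 : e ≤ (4 * j + 3)
      · exact in_right (mem_iv 0 F.cQ2 (by omega) (by omega))
      by_cases c3 : e ≤ (5 * j + 4)
      · exact in_left (in_left (in_right (mem_iv 0 F.cY1 (by omega) (by omega))))
      by_cases c4 : e ≤ (6 * j + 5)
      · exact in_left (in_left (in_right (mem_iv 0 F.cY2 (by omega) (by omega))))
      by_cases c5 : e ≤ (7 * j + 6)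
      · exact in_left (in_left (in_left (in_right (mem_iv 1 F.cP2 (by omega) (by omega)))))
      by_cases c6 : e ≤ (8 * j + 7)
      · exact in_right (mem_iv 1 F.cQ1 (by omega) (by omega))
      by_cases c7 : e ≤ (9 * j + 8)
      · exact in_left4 (mem_iv 1 F.cX2 (by omega) (by omega))
      by_cases c8 : e ≤ (10 * j + 9)
      · exact in_left4 (mem_iv 1 F.cX1 (by omega) (by omega))
      exact in_left (in_left (in_left (in_right (mem_iv 1 F.cP3 (by omega) (by omega)))))
    · exact Fin.forall_fin_one.2 (in_left (in_right (rfl)))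
  · exact Fin.forall_fin_one.2 (linkX_of_step (u := ((3))) (v := ((-1))) (by omega) (by push_cast; ring) (fun z => hE 0 z))

theorem fam2e (j : ℕ) : Good ((12 * j + 24) + 2) := by
  refine good_of_ladder (m := (12 * j + 24)) (r := 2) (L := (2 * j + 1)) (g := 5) (r' := 2) (h := 0) (w := 0) (by omega) (by omega)
    (-6 * j - 11) (-4 * j - 8) (2 * j + 3) (-5 * j - 9) (9 * j + 17) (-5 * j - 9)
    ![((-10 * j - 19), (2 * j + 3)), ((-5 * j - 9), (3 * j + 6)), ((-9 * j - 17), (-1)), ((2 * j + 4), (4 * j + 8)), ((2 * j + 4), (5 * j + 10))]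
    ![(0, (-6 * j - 11)), (1, 1)]
    (fun p => p.1.elim0) ?_ ?_ ?_
  · exact EndData.odd (1 * j) (by omega) (by omega) (by omega) (by omega)
  · ring
  intro T s12 s23 hA hG hE hO
  have G0 : OrbT T 1 0 (-10 * j - 19) (2 * j + 3) := fun z _ => hG 0 z
  have G1 : OrbT T 1 0 (-5 * j - 9) (3 * j + 6) := fun z _ => hG 1 z
  have G2 : OrbT T 1 0 (-9 * j - 17) (-1) := fun z _ => hG 2 z
  have G3 : OrbT T 1 0 (2 * j + 4) (4 * j + 8) := fun z _ => hG 3 z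
  have G4 : OrbT T 1 0 (2 * j + 4) (5 * j + 10) := fun z _ => hG 4 z
  have X0 : OrbX T 0 1 0 (-6 * j - 11) := fun z _ => hE 0 z
  have X1 : OrbX T 1 1 0 1 := fun z _ => hE 1 z
  refine ⟨fun z => ?_, ?_⟩
  · obtain ⟨SX, SY, SP, SQ, F⟩ := hA z
    have AX : LkA T z (6 * j + 11) (5 * j + 9) ((2 * j + 1) + 1) SX := F.X.fit
    have AY : LkA T z (-10 * j - 19) (-9 * j - 17) ((2 * j + 1) + 1) SY := F.Y.fit
    have AP : LkA T z (-6 * j - 11) (9 * j + 17) (2 * (2 * j + 1) + 1) SP := F.P.fit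
    have AQ : LkA T z (10 * j + 19) (-5 * j - 9) (2 * (2 * j + 1) + 1) SQ := F.Q.fit
    have E0 : LkE T z (5 * j + 9) (-9 * j - 18) := gedge1 s12 s23 G1 0 (-1)
    have E1 : LkE T z (-9 * j - 18) (-9 * j - 17) := s23 _ _ _ (gedge0 s12 s23 G2 0 0)
    have E2 : LkE T z (-10 * j - 19) (4 * j + 8) := gedge0 s12 s23 G0 0 1
    have E3 : LkE T z (4 * j + 8) (-2 * j - 4) := s23 _ _ _ (gedge1 s12 s23 G3 0 0)
    have E4 : LkE T z (-2 * j - 4) (-7 * j - 14) := gedge1 s12 s23 G4 0 (-1)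
    have E5 : LkE T z (-7 * j - 14) (7 * j + 14) := gedge2 s12 s23 G4 0 1
    have E6 : LkE T z (7 * j + 14) (2 * j + 4) := s23 _ _ _ (gedge0 s12 s23 G4 0 0)
    have E7 : LkE T z (2 * j + 4) (-6 * j - 12) := gedge0 s12 s23 G3 0 (-1)
    have E8 : LkE T z (-6 * j - 12) (8 * j + 16) := gedge2 s12 s23 G3 0 1
    have E9 : LkE T z (8 * j + 16) (-2 * j - 3) := gedge2 s12 s23 G0 0 0
    have E10 : LkE T z (-2 * j - 3) (-5 * j - 9) := s23 _ _ _ (gedge0 s12 s23 G1 0 0)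
    have E11 : LkE T z (10 * j + 19) (2 * j + 3) := gedge1 s12 s23 G0 0 0
    have E12 : LkE T z (2 * j + 3) (9 * j + 18) := gedge2 s12 s23 G1 0 1
    have E13 : LkE T z (9 * j + 18) 1 := gedge2 s12 s23 G2 0 0
    have E14 : T (ZN (12 * j + 24) 2 z) (ZN (12 * j + 24) 2 (z + 1)) (.inr 1) := s23 _ _ _ (xedge0 s12 s23 X1 0)
    have E15 : T (ZN (12 * j + 24) 2 z) (.inr 1) (ZN (12 * j + 24) 2 (z + (-1))) := xedge1 s12 s23 X1 0
    have E16 : LkE T z (-1) (9 * j + 17) := s23 _ _ _ (gedge1 s12 s23 G2 0 0)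
    have E17 : T (ZN (12 * j + 24) 2 z) (ZN (12 * j + 24) 2 (z + (-6 * j - 11))) (.inr 0) := s23 _ _ _ (xedge0 s12 s23 X0 0)
    have E18 : T (ZN (12 * j + 24) 2 z) (.inr 0) (ZN (12 * j + 24) 2 (z + (6 * j + 11))) := xedge1 s12 s23 X0 0
    have B0 := AX
    have B1 := B0.app E0 (Arc.single _)
    have B2 := B1.app E1 (AY.rev (s23 _))
    have B3 := B2.app E2 (Arc.single _)
    have B4 := B3.app E3 (Arc.single _)
    have B5 := B4.app E4 (Arc.single _)
    have B6 := B5.app E5 (Arc.single _)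
    have B7 := B6.app E6 (Arc.single _)
    have B8 := B7.app E7 (Arc.single _)
    have B9 := B8.app E8 (Arc.single _)
    have B10 := B9.app E9 (Arc.single _)
    have B11 := B10.app E10 (AQ.rev (s23 _))
    have B12 := B11.app E11 (Arc.single _)
    have B13 := B12.app E12 (Arc.single _)
    have B14 := B13.app E13 (Arc.single _)
    have B15 := B14.app E14 (Arc.single _)
    have B16 := B15.app E15 (Arc.single _)
    have B17 := B16.app E16 (AP.rev (s23 _))
    have B18 := B17.app E17 (Arc.single _)
    refine ⟨_, _, _, _, B18, E18, by omega, ?_, ?_⟩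
    · intro e he0 he1
      by_cases c0 : e ≤ 1
      · exact in_left4 (in_right (mem_nd 0))
      by_cases c1 : e ≤ (2 * j + 2)
      · exact in_left (in_left (in_left (in_left4 (in_right (mem_iv 0 F.cQ3 (by omega) (by omega))))))
      by_cases c2 : e ≤ (2 * j + 3)
      · exact in_left (in_left (in_left4 (in_right (mem_nd 0))))
      by_cases c3 : e ≤ (2 * j + 4)
      · exact in_left (in_left (in_left (in_left4 (in_left4 (in_right (mem_nd 0))))))
      by_cases c4 : e ≤ (3 * j + 5)
      · exact in_left4 (in_left4 (in_left4 (in_left4 (in_right (mem_iv 1 F.cY1 (by omega) (by omega))))))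
      by_cases c5 : e ≤ (3 * j + 6)
      · exact in_left (in_left4 (in_left4 (in_left4 (in_left4 (in_right (mem_nd 1))))))
      by_cases c6 : e ≤ (4 * j + 7)
      · exact in_left4 (in_left4 (in_left4 (in_left4 (in_right (mem_iv 1 F.cY2 (by omega) (by omega))))))
      by_cases c7 : e ≤ (4 * j + 8)
      · exact in_left (in_left (in_left (in_left4 (in_left4 (in_left4 (in_right (mem_nd 0)))))))
      by_cases c8 : e ≤ (5 * j + 9)
      · exact in_left (in_left (in_left4 (in_left4 (in_left4 (in_left4 (mem_iv 0 F.cX2 (by omega) (by omega)))))))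
      by_cases c9 : e ≤ (5 * j + 10)
      · exact in_left (in_left4 (in_left4 (in_left4 (in_right (mem_nd 1)))))
      by_cases c10 : e ≤ (6 * j + 11)
      · exact in_left (in_left (in_left4 (in_left4 (in_left4 (in_left4 (mem_iv 0 F.cX1 (by omega) (by omega)))))))
      by_cases c11 : e ≤ (6 * j + 12)
      · exact in_left (in_left (in_left4 (in_left4 (in_right (mem_nd 1)))))
      by_cases c12 : e ≤ (7 * j + 13)
      · exact in_left (in_right (mem_iv 1 F.cP1 (by omega) (by omega)))
      by_cases c13 : e ≤ (7 * j + 14)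
      · exact in_left4 (in_left4 (in_left4 (in_right (mem_nd 0))))
      by_cases c14 : e ≤ (8 * j + 15)
      · exact in_left (in_left (in_left (in_left4 (in_right (mem_iv 1 F.cQ2 (by omega) (by omega))))))
      by_cases c15 : e ≤ (8 * j + 16)
      · exact in_left (in_left4 (in_left4 (in_right (mem_nd 0))))
      by_cases c16 : e ≤ (9 * j + 17)
      · exact in_left (in_right (mem_iv 0 F.cP2 (by omega) (by omega)))
      by_cases c17 : e ≤ (9 * j + 18)
      · exact in_left (in_left4 (in_right (mem_nd 0)))
      by_cases c18 : e ≤ (10 * j + 19)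
      · exact in_left (in_left (in_left (in_left4 (in_right (mem_iv 0 F.cQ1 (by omega) (by omega))))))
      by_cases c19 : e ≤ (10 * j + 20)
      · exact in_left (in_left (in_left4 (in_left4 (in_left4 (in_right (mem_nd 1))))))
      by_cases c20 : e ≤ (10 * j + 21)
      · exact in_left4 (in_left4 (in_right (mem_nd 1)))
      by_cases c21 : e ≤ (12 * j + 22)
      · exact in_left (in_right (mem_iv 1 F.cP3 (by omega) (by omega)))
      exact in_left (in_left (in_right (mem_nd 1)))
    · exact Fin.forall_fin_two.2 ⟨in_right (rfl), in_left (in_left (in_left (in_right (rfl))))⟩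
  · exact Fin.forall_fin_two.2 ⟨linkX_of_step (u := ((13) + (6) * (j : ℤ)^1)) (v := ((6) + (3) * (j : ℤ)^1)) (by omega) (by push_cast; ring) (fun z => hE 0 z),
      linkX_of_step (u := ((1))) (v := 0) (by omega) (by push_cast; ring) (fun z => hE 1 z)⟩

theorem fam2oA (j : ℕ) : Good ((12 * j + 18) + 2) := by
  refine good_of_ladder (m := (12 * j + 18)) (r := 2) (L := (2 * j)) (g := 3) (r' := 0) (h := 8) (w := (6 * j + 9)) (by omega) (by omega)
    (2 * j + 4) (2 * j + 4) (2 * j + 1) (3 * j + 4) (3 * j + 4) (-5 * j - 8)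
    ![((4 * j + 8), (2 * j + 1)), ((3 * j + 4), (5 * j + 8)), ((2 * j + 2), (-4 * j - 5))]
    Fin.elim0
    (fun p => (![idxTri (12 * j + 18) 2 2 0 (2 * j + 2) (2 * j + 3),
      idxTri (12 * j + 18) 2 2 1 (4 * j + 5) (4 * j + 6),
      idxTri (12 * j + 18) 2 2 0 (2 * j + 4) (-4 * j - 7),
      idxTri (12 * j + 18) 2 2 1 (2 * j + 4) (2 * j + 2),
      idxExt (12 * j + 18) 2 0 2 0 (2 * j + 1),
      idxExt (12 * j + 18) 2 0 2 1 (4 * j + 7),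
      idxExt (12 * j + 18) 2 1 2 0 (-2 * j - 1),
      idxExt (12 * j + 18) 2 1 2 1 (-4 * j - 7)] : Fin 8 → ℕ → _) p.1 (p.2 : ℕ)) ?_ ?_ ?_
  · exact EndData.even (1 * j) (by omega) (by omega) (by omega) (by omega)
  · ring
  intro T s12 s23 hA hG hE hO
  have G0 : OrbT T 1 0 (4 * j + 8) (2 * j + 1) := fun z _ => hG 0 z
  have G1 : OrbT T 1 0 (3 * j + 4) (5 * j + 8) := fun z _ => hG 1 z
  have G2 : OrbT T 1 0 (2 * j + 2) (-4 * j - 5) := fun z _ => hG 2 z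
  have I0 : OrbT T 2 0 (2 * j + 2) (2 * j + 3) :=
    idxTri_all (w := (6 * j + 9)) (by omega) (by push_cast; ring) (by omega) (fun t => hO (0, t))
  have I1 : OrbT T 2 1 (4 * j + 5) (4 * j + 6) :=
    idxTri_all (w := (6 * j + 9)) (by omega) (by push_cast; ring) (by omega) (fun t => hO (1, t))
  have I2 : OrbT T 2 0 (2 * j + 4) (-4 * j - 7) :=
    idxTri_all (w := (6 * j + 9)) (by omega) (by push_cast; ring) (by omega) (fun t => hO (2, t))
  have I3 : OrbT T 2 1 (2 * j + 4) (2 * j + 2) :=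
    idxTri_all (w := (6 * j + 9)) (by omega) (by push_cast; ring) (by omega) (fun t => hO (3, t))
  have J0 : OrbX T 0 2 0 (2 * j + 1) :=
    idxExt_all (w := (6 * j + 9)) (by omega) (by push_cast; ring) (by omega) (fun t => hO (4, t))
  have J1 : OrbX T 0 2 1 (4 * j + 7) :=
    idxExt_all (w := (6 * j + 9)) (by omega) (by push_cast; ring) (by omega) (fun t => hO (5, t))
  have J2 : OrbX T 1 2 0 (-2 * j - 1) :=
    idxExt_all (w := (6 * j + 9)) (by omega) (by push_cast; ring) (by omega) (fun t => hO (6, t))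
  have J3 : OrbX T 1 2 1 (-4 * j - 7) :=
    idxExt_all (w := (6 * j + 9)) (by omega) (by push_cast; ring) (by omega) (fun t => hO (7, t))
  refine ⟨fun z => ?_, ?_⟩
  · obtain ⟨SX, SY, SP, SQ, F⟩ := hA z
    have AX : LkA T z (-2 * j - 4) (-3 * j - 4) ((2 * j) + 1) SX := F.X.fit
    have AY : LkA T z (4 * j + 8) (5 * j + 8) ((2 * j) + 1) SY := F.Y.fit
    have AP : LkA T z (2 * j + 4) (3 * j + 4) (2 * (2 * j) + 1) SP := F.P.fit
    have AQ : LkA T z (-4 * j - 8) (-5 * j - 8) (2 * (2 * j) + 1) SQ := F.Q.fit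
    have hz : z % 2 = 0 ∨ z % 2 = 1 := by omega
    rcases hz with hz | hz
    · have hzz := hz
      have E0 : LkE T z (-3 * j - 4) (5 * j + 8) := gedge1 s12 s23 G1 0 0
      have E1 : LkE T z (4 * j + 8) (-6 * j - 9) := gedge0 s12 s23 G0 0 (-1)
      have E2 : LkE T z (-6 * j - 9) (-2 * j - 1) := gedge2 s12 s23 G0 0 0
      have E3 : T (ZN (12 * j + 18) 2 z) (ZN (12 * j + 18) 2 (z + (-2 * j - 1))) (.inr 1) := s23 _ _ _ (xedge0 s12 s23 J2 0)
      have E4 : T (ZN (12 * j + 18) 2 z) (.inr 1) (ZN (12 * j + 18) 2 (z + (-8 * j - 11))) := xedge1 s12 s23 J3 (-1)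
      have E5 : LkE T z (-8 * j - 11) (8 * j + 12) := gedge2 s12 s23 I1 0 1
      have E6 : LkE T z (8 * j + 12) (3 * j + 4) := s23 _ _ _ (gedge0 s12 s23 G1 0 0)
      have E7 : LkE T z (2 * j + 4) (-2 * j - 3) := gedge0 s12 s23 I2 0 0
      have E8 : LkE T z (-2 * j - 3) (2 * j + 2) := s23 _ _ _ (gedge0 s12 s23 G2 0 0)
      have E9 : LkE T z (2 * j + 2) (4 * j + 5) := gedge0 s12 s23 I0 0 0
      have E10 : LkE T z (4 * j + 5) (2 * j + 3) := s23 _ _ _ (gedge2 s12 s23 G2 0 0)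
      have E11 : LkE T z (2 * j + 3) (-2 * j - 2) := s23 _ _ _ (gedge1 s12 s23 I0 0 0)
      have E12 : LkE T z (-2 * j - 2) (-4 * j - 5) := gedge1 s12 s23 G2 0 0
      have E13 : LkE T z (-4 * j - 5) (-8 * j - 12) := gedge1 s12 s23 I1 0 (-1)
      have E14 : LkE T z (-8 * j - 12) (-5 * j - 8) := gedge2 s12 s23 G1 0 0
      have E15 : LkE T z (-4 * j - 8) (2 * j + 1) := gedge1 s12 s23 G0 0 0
      have E16 : T (ZN (12 * j + 18) 2 z) (ZN (12 * j + 18) 2 (z + (2 * j + 1))) (.inr 0) := s23 _ _ _ (xedge0 s12 s23 J0 0)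
      have E17 : T (ZN (12 * j + 18) 2 z) (.inr 0) (ZN (12 * j + 18) 2 (z + (-4 * j - 7))) := xedge1 s12 s23 J1 0
      have E18 : LkE T z (-4 * j - 7) (-2 * j - 4) := s23 _ _ _ (gedge1 s12 s23 I2 0 0)
      have B0 := AX
      have B1 := B0.app E0 (AY.rev (s23 _))
      have B2 := B1.app E1 (Arc.single _)
      have B3 := B2.app E2 (Arc.single _)
      have B4 := B3.app E3 (Arc.single _)
      have B5 := B4.app E4 (Arc.single _)
      have B6 := B5.app E5 (Arc.single _)
      have B7 := B6.app E6 (AP.rev (s23 _))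
      have B8 := B7.app E7 (Arc.single _)
      have B9 := B8.app E8 (Arc.single _)
      have B10 := B9.app E9 (Arc.single _)
      have B11 := B10.app E10 (Arc.single _)
      have B12 := B11.app E11 (Arc.single _)
      have B13 := B12.app E12 (Arc.single _)
      have B14 := B13.app E13 (Arc.single _)
      have B15 := B14.app E14 (AQ.rev (s23 _))
      have B16 := B15.app E15 (Arc.single _)
      have B17 := B16.app E16 (Arc.single _)
      have B18 := B17.app E17 (Arc.single _)
      refine ⟨_, _, _, _, B18, E18, by omega, ?_, ?_⟩
      · intro e he0 he1
        by_cases c0 : e ≤ (2 * j)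
        · exact in_left (in_left (in_left (in_right (mem_iv 0 F.cQ3 (by omega) (by omega)))))
        by_cases c1 : e ≤ (2 * j + 1)
        · exact in_left (in_left (in_right (mem_nd 0)))
        by_cases c2 : e ≤ (2 * j + 2)
        · exact in_left (in_left4 (in_left4 (in_right (mem_nd 0))))
        by_cases c3 : e ≤ (2 * j + 3)
        · exact in_left (in_left (in_left (in_left4 (in_right (mem_nd 0)))))
        by_cases c4 : e ≤ (3 * j + 4)
        · exact in_left (in_left (in_left (in_left4 (in_left4 (in_right (mem_iv 0 F.cP1 (by omega) (by omega)))))))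
        by_cases c5 : e ≤ (4 * j + 4)
        · exact in_left (in_left (in_left (in_right (mem_iv 0 F.cQ2 (by omega) (by omega)))))
        by_cases c6 : e ≤ (4 * j + 5)
        · exact in_left4 (in_left4 (in_right (mem_nd 0)))
        by_cases c7 : e ≤ (4 * j + 6)
        · exact in_left4 (in_right (mem_nd 1))
        by_cases c8 : e ≤ (4 * j + 7)
        · exact in_left (in_left4 (in_left4 (in_left4 (in_right (mem_nd 1)))))
        by_cases c9 : e ≤ (5 * j + 8)
        · exact in_left (in_left4 (in_left4 (in_left4 (in_left4 (in_right (mem_iv 0 F.cY1 (by omega) (by omega)))))))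
        by_cases c10 : e ≤ (6 * j + 8)
        · exact in_left (in_left4 (in_left4 (in_left4 (in_left4 (in_right (mem_iv 0 F.cY2 (by omega) (by omega)))))))
        by_cases c11 : e ≤ (6 * j + 9)
        · exact in_left4 (in_left4 (in_left4 (in_left4 (in_right (mem_nd 1)))))
        by_cases c12 : e ≤ (7 * j + 9)
        · exact in_left (in_left (in_left (in_left4 (in_left4 (in_right (mem_iv 1 F.cP2 (by omega) (by omega)))))))
        by_cases c13 : e ≤ (8 * j + 10)
        · exact in_left (in_left (in_left (in_right (mem_iv 1 F.cQ1 (by omega) (by omega)))))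
        by_cases c14 : e ≤ (8 * j + 11)
        · exact in_right (mem_nd 1)
        by_cases c15 : e ≤ (8 * j + 12)
        · exact in_left4 (in_left4 (in_left4 (in_right (mem_nd 0))))
        by_cases c16 : e ≤ (8 * j + 13)
        · exact in_left (in_left4 (in_right (mem_nd 1)))
        by_cases c17 : e ≤ (9 * j + 13)
        · exact in_left (in_left (in_left4 (in_left4 (in_left4 (in_left4 (mem_iv 1 F.cX2 (by omega) (by omega)))))))
        by_cases c18 : e ≤ (10 * j + 14)
        · exact in_left (in_left (in_left4 (in_left4 (in_left4 (in_left4 (mem_iv 1 F.cX1 (by omega) (by omega)))))))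
        by_cases c19 : e ≤ (10 * j + 15)
        · exact in_left (in_left (in_left4 (in_left4 (in_right (mem_nd 1)))))
        by_cases c20 : e ≤ (10 * j + 16)
        · exact in_left (in_left (in_left4 (in_right (mem_nd 1))))
        by_cases c21 : e ≤ (10 * j + 17)
        · exact in_left (in_left (in_left (in_left4 (in_left4 (in_left4 (in_right (mem_nd 1)))))))
        exact in_left (in_left (in_left (in_left4 (in_left4 (in_right (mem_iv 1 F.cP3 (by omega) (by omega)))))))
      · exact Fin.forall_fin_two.2 ⟨in_left (in_right (rfl)), in_left (in_left (in_left4 (in_left4 (in_left4 (in_right (rfl))))))⟩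
    · have hzz := hz
      have E0 : LkE T z (-3 * j - 4) (5 * j + 8) := gedge1 s12 s23 G1 0 0
      have E1 : LkE T z (4 * j + 8) (-6 * j - 9) := gedge0 s12 s23 G0 0 (-1)
      have E2 : LkE T z (-6 * j - 9) (-2 * j - 1) := gedge2 s12 s23 G0 0 0
      have E3 : T (ZN (12 * j + 18) 2 z) (ZN (12 * j + 18) 2 (z + (-2 * j - 1))) (.inr 0) := s23 _ _ _ (xedge1 s12 s23 J0 0)
      have E4 : T (ZN (12 * j + 18) 2 z) (.inr 0) (ZN (12 * j + 18) 2 (z + (4 * j + 7))) := xedge0 s12 s23 J1 0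
      have E5 : LkE T z (4 * j + 7) (2 * j + 3) := s23 _ _ _ (gedge2 s12 s23 I2 0 0)
      have E6 : LkE T z (2 * j + 3) (4 * j + 5) := gedge2 s12 s23 G2 0 0
      have E7 : LkE T z (4 * j + 5) (-4 * j - 7) := gedge0 s12 s23 I1 0 (-1)
      have E8 : T (ZN (12 * j + 18) 2 z) (ZN (12 * j + 18) 2 (z + (-4 * j - 7))) (.inr 1) := s23 _ _ _ (xedge0 s12 s23 J3 0)
      have E9 : T (ZN (12 * j + 18) 2 z) (.inr 1) (ZN (12 * j + 18) 2 (z + (2 * j + 1))) := xedge1 s12 s23 J2 0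
      have E10 : LkE T z (2 * j + 1) (-4 * j - 8) := s23 _ _ _ (gedge1 s12 s23 G0 0 0)
      have E11 : LkE T z (-5 * j - 8) (4 * j + 6) := s23 _ _ _ (gedge2 s12 s23 G1 1 0)
      have E12 : LkE T z (4 * j + 6) (2 * j + 4) := s23 _ _ _ (gedge0 s12 s23 I3 0 0)
      have E13 : LkE T z (3 * j + 4) (-4 * j - 6) := gedge0 s12 s23 G1 0 (-1)
      have E14 : LkE T z (-4 * j - 6) (-2 * j - 2) := gedge2 s12 s23 I3 0 0
      have E15 : LkE T z (-2 * j - 2) (-4 * j - 5) := gedge1 s12 s23 G2 0 0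
      have E16 : LkE T z (-4 * j - 5) (-2 * j - 3) := gedge2 s12 s23 I0 0 0
      have E17 : LkE T z (-2 * j - 3) (2 * j + 2) := s23 _ _ _ (gedge0 s12 s23 G2 0 0)
      have E18 : LkE T z (2 * j + 2) (-2 * j - 4) := s23 _ _ _ (gedge1 s12 s23 I3 0 0)
      have B0 := AX
      have B1 := B0.app E0 (AY.rev (s23 _))
      have B2 := B1.app E1 (Arc.single _)
      have B3 := B2.app E2 (Arc.single _)
      have B4 := B3.app E3 (Arc.single _)
      have B5 := B4.app E4 (Arc.single _)
      have B6 := B5.app E5 (Arc.single _)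
      have B7 := B6.app E6 (Arc.single _)
      have B8 := B7.app E7 (Arc.single _)
      have B9 := B8.app E8 (Arc.single _)
      have B10 := B9.app E9 (Arc.single _)
      have B11 := B10.app E10 AQ
      have B12 := B11.app E11 (Arc.single _)
      have B13 := B12.app E12 AP
      have B14 := B13.app E13 (Arc.single _)
      have B15 := B14.app E14 (Arc.single _)
      have B16 := B15.app E15 (Arc.single _)
      have B17 := B16.app E16 (Arc.single _)
      have B18 := B17.app E17 (Arc.single _)
      refine ⟨_, _, _, _, B18, E18, by omega, ?_, ?_⟩
      · intro e he0 he1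
        by_cases c0 : e ≤ (2 * j)
        · exact in_left (in_left (in_left (in_left4 (in_right (mem_iv 0 F.cQ3 (by omega) (by omega))))))
        by_cases c1 : e ≤ (2 * j + 1)
        · exact in_left4 (in_left4 (in_right (mem_nd 0)))
        by_cases c2 : e ≤ (2 * j + 2)
        · exact in_right (mem_nd 0)
        by_cases c3 : e ≤ (2 * j + 3)
        · exact in_left4 (in_left4 (in_left4 (in_right (mem_nd 0))))
        by_cases c4 : e ≤ (3 * j + 4)
        · exact in_left (in_left4 (in_right (mem_iv 0 F.cP1 (by omega) (by omega))))
        by_cases c5 : e ≤ (4 * j + 4)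
        · exact in_left (in_left (in_left (in_left4 (in_right (mem_iv 0 F.cQ2 (by omega) (by omega))))))
        by_cases c6 : e ≤ (4 * j + 5)
        · exact in_left (in_left (in_left (in_left4 (in_left4 (in_right (mem_nd 0))))))
        by_cases c7 : e ≤ (4 * j + 6)
        · exact in_left (in_left (in_left4 (in_right (mem_nd 0))))
        by_cases c8 : e ≤ (4 * j + 7)
        · exact in_left (in_left4 (in_left4 (in_left4 (in_right (mem_nd 0)))))
        by_cases c9 : e ≤ (5 * j + 8)
        · exact in_left (in_left4 (in_left4 (in_left4 (in_left4 (in_right (mem_iv 0 F.cY1 (by omega) (by omega)))))))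
        by_cases c10 : e ≤ (6 * j + 8)
        · exact in_left (in_left4 (in_left4 (in_left4 (in_left4 (in_right (mem_iv 0 F.cY2 (by omega) (by omega)))))))
        by_cases c11 : e ≤ (6 * j + 9)
        · exact in_left4 (in_left4 (in_left4 (in_left4 (in_right (mem_nd 1)))))
        by_cases c12 : e ≤ (7 * j + 9)
        · exact in_left (in_left4 (in_right (mem_iv 1 F.cP2 (by omega) (by omega))))
        by_cases c13 : e ≤ (8 * j + 10)
        · exact in_left (in_left (in_left (in_left4 (in_right (mem_iv 1 F.cQ1 (by omega) (by omega))))))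
        by_cases c14 : e ≤ (8 * j + 11)
        · exact in_left (in_left (in_left4 (in_left4 (in_right (mem_nd 1)))))
        by_cases c15 : e ≤ (8 * j + 12)
        · exact in_left4 (in_right (mem_nd 1))
        by_cases c16 : e ≤ (8 * j + 13)
        · exact in_left (in_left (in_right (mem_nd 1)))
        by_cases c17 : e ≤ (9 * j + 13)
        · exact in_left (in_left (in_left4 (in_left4 (in_left4 (in_left4 (mem_iv 1 F.cX2 (by omega) (by omega)))))))
        by_cases c18 : e ≤ (10 * j + 14)
        · exact in_left (in_left (in_left4 (in_left4 (in_left4 (in_left4 (mem_iv 1 F.cX1 (by omega) (by omega)))))))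
        by_cases c19 : e ≤ (10 * j + 15)
        · exact in_left (in_right (mem_nd 1))
        by_cases c20 : e ≤ (10 * j + 16)
        · exact in_left (in_left (in_left (in_right (mem_nd 1))))
        by_cases c21 : e ≤ (10 * j + 17)
        · exact in_left (in_left (in_left (in_left4 (in_left4 (in_left4 (in_right (mem_nd 1)))))))
        exact in_left (in_left4 (in_right (mem_iv 1 F.cP3 (by omega) (by omega))))
      · exact Fin.forall_fin_two.2 ⟨in_left (in_left (in_left4 (in_left4 (in_left4 (in_right (rfl)))))), in_left (in_left4 (in_left4 (in_right (rfl))))⟩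
  · exact Fin.forall_fin_two.2 ⟨linkX_of_two (w := (6 * j + 9)) (d := (3 * j + 4)) (u := ((-2))) (v := ((1))) (by omega) (by omega) (by omega) (by omega) (by push_cast; ring) J0 J1,
      linkX_of_two (w := (6 * j + 9)) (d := (-3 * j - 4)) (u := ((2))) (v := ((1))) (by omega) (by omega) (by omega) (by omega) (by push_cast; ring) J2 J3⟩

/-- `u` and `w` are consecutive in the cyclic list `l` -/
def consec {n : ℕ} (l : List (Fin n)) (u w : Fin n) : Bool :=
  (l.zip (l.rotate 1)).any fun p => (p.1 == u && p.2 == w) || (p.1 == w && p.2 == u)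

/-- corners given by a rotation system -/
def RotT {n : ℕ} (R : List (List (Fin n))) (v u w : Fin n) : Prop :=
  consec (R.getD v []) u w = true

instance {n : ℕ} (R : List (List (Fin n))) (v u w : Fin n) : Decidable (RotT R v u w) := by
  unfold RotT; infer_instance

instance {n : ℕ} (a b u v : Fin n) : Decidable (KMinus a b u v) := by
  unfold KMinus; infer_instance

instance {n : ℕ} (T : Fin n → Fin n → Prop) [DecidableRel T] (l : List (Fin n)) :
    Decidable (Cyc T l) := by
  unfold Cyc; infer_instance

theorem two_of_filter {n : ℕ} (P : Fin n → Prop) [DecidablePred P]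
    (h : ((List.finRange n).filter (fun w => decide (P w))).length = 2) :
    ∃ w w', w ≠ w' ∧ P w ∧ P w' ∧ ∀ y, P y → y = w ∨ y = w' := by
  obtain ⟨w, w', h⟩ := List.length_eq_two.1 h
  have hn := (List.nodup_finRange n).filter (fun w => decide (P w))
  have hm : ∀ y, y ∈ (List.finRange n).filter (fun w => decide (P w)) ↔ P y := by simp
  rw [h] at hn hm
  refine ⟨w, w', ?_, (hm w).1 (by simp), (hm w').1 (by simp), fun y hy => ?_⟩
  · simpa using hn
  · simpa using (hm y).2 hy

theorem isTriang_rot {n : ℕ} (A : Fin n → Fin n → Prop) [DecidableRel A] (R : List (List (Fin n)))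
    (h1 : ∀ u v w, RotT R u v w → RotT R v u w ∧ RotT R u w v ∧ A u v)
    (h2 : ∀ v u, A v u → ((List.finRange n).filter (fun w => decide (RotT R v u w))).length = 2)
    (h3 : ∀ v : Fin n, (R.getD v []).Nodup ∧ Cyc (RotT R v) (R.getD v []) ∧
      ∀ u, u ∈ R.getD v [] ↔ A v u) : IsTriang A (RotT R) :=
  ⟨fun u v w h => (h1 u v w h).1, fun u v w h => (h1 u v w h).2.1, fun u v w h => (h1 u v w h).2.2,
    fun v u h => two_of_filter _ (h2 v u h), fun v => ⟨_, h3 v⟩⟩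

theorem good_4 : Good 4 :=
  good_of_triang (Fin 4) 4 (by norm_num) (by simp) _ (isTriang_rot _
    [[1, 2, 3],
     [0, 2, 3],
     [0, 1, 3],
     [0, 1, 2]]
    (by decide +kernel) (by decide +kernel) (by decide +kernel))

theorem good_9 : Good 9 :=
  good_of_triang (Fin 9) 9 (by norm_num) (by simp) _ (isTriang_rot _
    [[1, 4, 5, 8, 3, 7, 6, 2],
     [0, 4, 3, 8, 6, 5, 7, 2],
     [0, 1, 7, 3, 5, 8, 4, 6],
     [0, 7, 2, 5, 6, 4, 1, 8],
     [0, 1, 3, 6, 2, 8, 7, 5],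
     [0, 4, 7, 1, 6, 3, 2, 8],
     [0, 2, 4, 3, 5, 1, 8, 7],
     [0, 6, 8, 4, 5, 1, 2, 3],
     [0, 5, 2, 4, 7, 6, 1, 3]]
    (by decide +kernel) (by decide +kernel) (by decide +kernel))

theorem good_5 : Good 5 :=
  good_of_addEdge (V := Fin 5) 5 (by norm_num) (by simp) _ 3 4 (by decide) (isTriang_rot _
    [[1, 3, 2, 4],
     [0, 3, 2, 4],
     [0, 3, 1, 4],
     [0, 1, 2],
     [0, 1, 2]]
    (by decide +kernel) (by decide +kernel) (by decide +kernel))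

theorem good_11 : Good 11 :=
  good_of_addEdge (V := Fin 11) 11 (by norm_num) (by simp) _ 9 10 (by decide) (isTriang_rot _
    [[1, 9, 4, 6, 8, 10, 7, 2, 3, 5],
     [0, 9, 8, 10, 6, 2, 4, 3, 7, 5],
     [0, 7, 9, 6, 1, 4, 10, 5, 8, 3],
     [0, 2, 8, 9, 7, 1, 4, 6, 10, 5],
     [0, 9, 5, 8, 7, 10, 2, 1, 3, 6],
     [0, 1, 7, 6, 9, 4, 8, 2, 10, 3],
     [0, 4, 3, 10, 1, 2, 9, 5, 7, 8],
     [0, 2, 9, 3, 1, 5, 6, 8, 4, 10],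
     [0, 6, 7, 4, 5, 2, 3, 9, 1, 10],
     [0, 1, 8, 3, 7, 2, 6, 5, 4],
     [0, 7, 4, 2, 5, 3, 6, 1, 8]]
    (by decide +kernel) (by decide +kernel) (by decide +kernel))

theorem good_14 : Good 14 :=
  good_of_addEdge (V := Fin 14) 14 (by norm_num) (by simp) _ 12 13 (by decide) (isTriang_rot _
    [[1, 2, 6, 12, 7, 13, 8, 3, 11, 9, 10, 4, 5],
     [0, 2, 3, 7, 12, 8, 13, 9, 4, 6, 10, 11, 5],
     [0, 6, 11, 7, 5, 10, 13, 9, 12, 8, 4, 3, 1],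
     [0, 8, 6, 7, 1, 2, 4, 5, 9, 12, 10, 13, 11],
     [0, 10, 12, 11, 13, 6, 1, 9, 7, 8, 2, 3, 5],
     [0, 4, 3, 9, 8, 10, 2, 7, 13, 6, 12, 11, 1],
     [0, 12, 5, 13, 4, 1, 10, 7, 3, 8, 9, 11, 2],
     [0, 12, 1, 3, 6, 10, 9, 4, 8, 11, 2, 5, 13],
     [0, 13, 1, 12, 2, 4, 7, 11, 10, 5, 9, 6, 3],
     [0, 10, 7, 4, 1, 13, 2, 12, 3, 5, 8, 6, 11],
     [0, 4, 12, 3, 13, 2, 5, 8, 11, 1, 6, 7, 9],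
     [0, 3, 13, 4, 12, 5, 1, 10, 8, 7, 2, 6, 9],
     [0, 7, 1, 8, 2, 9, 3, 10, 4, 11, 5, 6],
     [0, 7, 5, 6, 4, 11, 3, 10, 2, 9, 1, 8]]
    (by decide +kernel) (by decide +kernel) (by decide +kernel))

/-- rotation system of an embedding of `K_8` with 17 triangles and the pentagon `01234` -/
def R8 : List (List (Fin 8)) :=
    [[1, 4, 2, 6, 7, 5, 3],
     [0, 2, 5, 4, 6, 7, 3],
     [0, 4, 7, 3, 1, 5, 6],
     [0, 1, 7, 2, 4, 6, 5],
     [0, 3, 6, 1, 5, 7, 2],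
     [0, 3, 6, 2, 1, 4, 7],
     [0, 2, 5, 3, 4, 1, 7],
     [0, 5, 4, 2, 3, 1, 6]]

/-- the pentagonal corners -/
def Pent8 : Finset (Fin 8 × Fin 8 × Fin 8) :=
  {(0, 1, 4), (1, 2, 0), (2, 3, 1), (3, 4, 2), (4, 0, 3),
   (0, 4, 1), (1, 0, 2), (2, 1, 3), (3, 2, 4), (4, 3, 0)}

/-- continuation of the face at a corner -/
def z8 (v u w : Fin 8) : Fin 8 :=
  match v, u, w with
  | 0, 1, 4 => 2
  | 1, 2, 0 => 3
  | 2, 3, 1 => 4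
  | 3, 4, 2 => 0
  | 4, 0, 3 => 1
  | 0, 4, 1 => 3
  | 1, 0, 2 => 4
  | 2, 1, 3 => 0
  | 3, 2, 4 => 1
  | 4, 3, 0 => 2
  | _, _, w => w

theorem R8_conn : ∀ v : Fin 8, Cyc (RotT R8 v) (R8.getD v []) ∧ ∀ u, u ≠ v → u ∈ R8.getD v [] := by
  decide +kernel

theorem R8_sym : ∀ v u w, RotT R8 v u w → RotT R8 v w u := by
  decide +kernel

theorem reach_of_cyc {n : ℕ} {T : Fin n → Fin n → Prop} (hs : ∀ u w, T u w → T w u)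
    {l : List (Fin n)} (h : l.IsChain T) : ∀ u ∈ l, ∀ w ∈ l, Relation.ReflTransGen T u w := by
  have key : ∀ (a : Fin n) (l : List (Fin n)), (a :: l).IsChain T → ∀ u ∈ a :: l, Relation.ReflTransGen T a u := by
    intro a l
    induction l generalizing a with
    | nil => intro _ u hu; simp at hu; subst hu; exact .refl
    | cons b l ih =>
      intro h u hu
      rw [List.isChain_cons_cons] at h
      rcases List.mem_cons.1 hu with rfl | hu
      · exact .refl
      · exact .head h.1 (ih b h.2 u hu)
  cases l with
  | nil => simp
  | cons a l =>
    intro u hu w hw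
    have h1 := key a l h u hu
    have h2 := key a l h w hw
    haveI : Std.Symm T := ⟨fun x y h => hs x y h⟩
    exact (Relation.ReflTransGen.symmetric.symm _ _ h1).trans h2

theorem Pent8_cl : ∀ v u w : Fin 8, (v, u, w) ∈ Pent8 → (v, w, u) ∈ Pent8 ∧ (u, v, z8 v u w) ∈ Pent8 := by
  decide +kernel

theorem good_8 : Good 8 := by
  refine good_of_corners (Fin 8) 8 (by norm_num) (by simp) (RotT R8) z8 R8_sym
    (by decide +kernel) (fun v u h => two_of_filter _ ?_) (fun v u u' h h' => ?_) (by decide +kernel)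
    Pent8 (by decide +kernel) (fun v u w _ => Pent8_cl v u w) (fun v u w h hS => ?_)
  · revert v u; decide +kernel
  · exact reach_of_cyc (R8_sym v) (R8_conn v).1.1 u ((R8_conn v).2 u h) u' ((R8_conn v).2 u' h')
  · refine ⟨{(v, u, w), (v, w, u), (u, v, w), (u, w, v), (w, u, v), (w, v, u)}, by simp, Finset.card_le_six, ?_⟩
    have : ∀ v u w, RotT R8 v u w → (v, u, w) ∉ Pent8 →
      z8 v u w = w ∧ z8 v w u = u ∧ z8 u v w = w ∧ z8 u w v = v ∧ z8 w u v = v ∧ z8 w v u = u := by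
      decide +kernel
    obtain ⟨e1, e2, e3, e4, e5, e6⟩ := this v u w h hS
    intro x y s _ hm
    simp only [Finset.mem_insert, Finset.mem_singleton, Prod.mk.injEq] at hm
    rcases hm with ⟨rfl, rfl, rfl⟩ | ⟨rfl, rfl, rfl⟩ | ⟨rfl, rfl, rfl⟩ | ⟨rfl, rfl, rfl⟩ |
      ⟨rfl, rfl, rfl⟩ | ⟨rfl, rfl, rfl⟩ <;> simp [*]

/-- flags of the triangle on the sphere: a vertex, a direction and a side -/
abbrev F3 : Type := Fin 3 × Bool × Bool

/-- the other end of the edge of a flag -/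
def nb3 (x : F3) : Fin 3 := if x.2.1 then x.1 + 1 else x.1 + 2

/-- involutions of the triangle -/
def t0 (x : F3) : F3 := (nb3 x, !x.2.1, x.2.2)
def t1 (x : F3) : F3 := (x.1, !x.2.1, x.2.2)
def t2 (x : F3) : F3 := (x.1, x.2.1, !x.2.2)

theorem t0_inv : Function.Involutive t0 := by unfold Function.Involutive; decide
theorem t1_inv : Function.Involutive t1 := by unfold Function.Involutive; decide
theorem t2_inv : Function.Involutive t2 := by unfold Function.Involutive; decide

/-- the triangle embedded in the sphere -/
def M3 : FlagSystem where
  F := F3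
  fin := inferInstance
  σ₀ := t0_inv.toPerm
  σ₁ := t1_inv.toPerm
  σ₂ := t2_inv.toPerm
  inv₀ := Equiv.ext fun x => t0_inv x
  inv₁ := Equiv.ext fun x => t1_inv x
  inv₂ := Equiv.ext fun x => t2_inv x
  fpf₀ := show ∀ x : F3, t0 x ≠ x by decide
  fpf₁ := show ∀ x : F3, t1 x ≠ x by decide
  fpf₂ := show ∀ x : F3, t2 x ≠ x by decide
  comm02 := Equiv.ext (show ∀ x : F3, t0 (t2 x) = t2 (t0 x) by decide)
  fpf02 := show ∀ x : F3, t0 (t2 x) ≠ x by decide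

theorem nb3_ne : ∀ x : F3, x.1 ≠ nb3 x := by decide

theorem F3_v : ∀ x y : F3, x.1 = y.1 → y = x ∨ y = t1 x ∨ y = t2 x ∨ y = t1 (t2 x) := by decide
theorem F3_e : ∀ x y : F3, (x.1 = y.1 ∧ nb3 x = nb3 y) ∨ (x.1 = nb3 y ∧ nb3 x = y.1) →
    y = x ∨ y = t0 x ∨ y = t2 x ∨ y = t0 (t2 x) := by decide
theorem F3_s : ∀ v w : Fin 3, v ≠ w → ∃ x : F3, x.1 = v ∧ nb3 x = w := by decide

theorem so_four {M : FlagSystem} {a b : Equiv.Perm M.F} {x y : M.F}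
    (h : y = x ∨ y = a x ∨ y = b x ∨ y = a (b x)) : M.SameOrbit {a, b} x y := by
  rcases h with rfl | rfl | rfl | rfl
  · exact ⟨1, Subgroup.one_mem _, rfl⟩
  · exact ⟨a, Subgroup.subset_closure (by simp), rfl⟩
  · exact ⟨b, Subgroup.subset_closure (by simp), rfl⟩
  · exact ⟨a * b, Subgroup.mul_mem _ (Subgroup.subset_closure (by simp)) (Subgroup.subset_closure (by simp)), rfl⟩

theorem good_3 : Good 3 := by
  refine ⟨M3, ⟨fun x => ⟨x.1, s(x.1, nb3 x), by simpa using nb3_ne x, by simp⟩,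
    fun x => ⟨s(x.1, nb3 x), by simpa using nb3_ne x⟩, ?_, ?_, ?_, ?_, ?_, ?_, ?_, ?_, ?_, ?_⟩, ?_⟩
  · intro x; simp
  · intro x; rfl
  · intro x; rfl
  · intro x h
    exact nb3_ne x (congrArg Subtype.val h).symm
  · intro x
    apply Subtype.ext
    exact (show ∀ x : F3, s((t0 x).1, nb3 (t0 x)) = s(x.1, nb3 x) by decide) x
  · intro x; rfl
  · intro x y h
    exact so_four (F3_v x y (congrArg Subtype.val h))
  · intro x y h
    have h' : s(x.1, nb3 x) = s(y.1, nb3 y) := congrArg Subtype.val h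
    rw [Sym2.eq_iff] at h'
    exact so_four (F3_e x y h')
  · rintro ⟨v, hv⟩
    exact ⟨(v, true, true), rfl⟩
  · rintro ⟨e, he⟩ v hv
    obtain ⟨w, rfl⟩ := hv
    obtain ⟨x, h1, h2⟩ := F3_s v w (by simpa using he)
    exact ⟨x, Subtype.ext (by simp [h1, h2]), h1⟩
  · have := FlagSystem.faces_lower M3 (∅ : Finset F3) (fun x hx => absurd hx (Finset.notMem_empty x))
      (fun x _ => (show ∀ x : F3, ∃ O : Finset F3, x ∈ O ∧ O.card ≤ 6 ∧ ∀ y ∈ O, t0 y ∈ O ∧ t1 y ∈ O from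
        fun x => ⟨Finset.univ.filter (fun y => y.2.2 = x.2.2), by simp, by revert x; decide,
          fun y hy => by simpa [t0, t1] using hy⟩) x) (Nat.zero_le _)
    have h12 : Nat.card M3.F = 12 := by
      show Nat.card F3 = 12
      simp [F3]
    omega

theorem good_all (t : ℕ) (ht : 3 ≤ t) : Good t := by
  obtain ⟨q, h⟩ : ∃ q, t = 12 * q ∨ t = 12 * q + 1 ∨ t = 12 * q + 2 ∨ t = 12 * q + 3 ∨
      t = 12 * q + 4 ∨ t = 12 * q + 5 ∨ t = 12 * q + 6 ∨ t = 12 * q + 7 ∨ t = 12 * q + 8 ∨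
      t = 12 * q + 9 ∨ t = 12 * q + 10 ∨ t = 12 * q + 11 := ⟨t / 12, by omega⟩
  rcases h with rfl | rfl | rfl | rfl | rfl | rfl | rfl | rfl | rfl | rfl | rfl | rfl
  · rcases q with _ | q
    · omega
    refine (congrArg Good ?_).mpr (fam6o q)
    omega
  · rcases q with _ | q
    · omega
    refine (congrArg Good ?_).mpr (fam1e q)
    omega
  · rcases q with _ | q
    · omega
    rcases q with _ | q
    · exact good_14
    refine (congrArg Good ?_).mpr (fam2e q)
    omega
  · rcases q with _ | q
    · exact good_3
    refine (congrArg Good ?_).mpr (fam3e q)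
    omega
  · rcases q with _ | q
    · exact good_4
    refine (congrArg Good ?_).mpr (fam4e q)
    omega
  · rcases q with _ | q
    · exact good_5
    refine (congrArg Good ?_).mpr (fam5e q)
    omega
  · refine (congrArg Good ?_).mpr (fam6e q)
    omega
  · refine (congrArg Good ?_).mpr (fam1o q)
    omega
  · rcases q with _ | q
    · exact good_8
    refine (congrArg Good ?_).mpr (fam2oA q)
    omega
  · rcases q with _ | q
    · exact good_9
    refine (congrArg Good ?_).mpr (fam3o q)
    omega
  · refine (congrArg Good ?_).mpr (fam4o q)
    omega
  · rcases q with _ | q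
    · exact good_11
    refine (congrArg Good ?_).mpr (fam5o q)
    omega

/-- (Ringel–Youngs) For `t ≥ 3`, the Euler genus of the complete graph `K_t` equals
`⌈(t-3)(t-4)/6⌉`. -/
theorem eulerGenus_completeGraph (t : ℕ) (ht : 3 ≤ t) :
    eulerGenus (⊤ : SimpleGraph (Fin t)) = ((t - 3) * (t - 4) + 5) / 6 := by
  exact eulerGenus_of_good t ht (good_all t ht)
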